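/- arXiv:2107.06385 — 2 statements merged into one kernel-verified Lean document; each statement's English description precedes it below -/
import Mathlib

section
/- The groups Aut(P_λ) and Aut(U_λ) are isomorphic as groups. -/
noncomputable section

open scoped Pointwise

variable (K : Type*) [Field K] [IsAlgClosed K] [CharZero K] (lam : K)

/-- `P_λ`: the quotient of `K[X,Y,Z]` by the ideal generated by `4XZ + Y² - λ`. -/
abbrev PQ : Type _ :=
  MvPolynomial (Fin 3) K ⧸
    Ideal.span {4 * MvPolynomial.X 0 * MvPolynomial.X 2 + MvPolynomial.X 1 ^ 2 -
      MvPolynomial.C lam}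

/-- `e`, the image of `X`. -/
def pe : PQ K lam := Ideal.Quotient.mk _ (MvPolynomial.X 0)

/-- `h`, the image of `Y`. -/
def ph : PQ K lam := Ideal.Quotient.mk _ (MvPolynomial.X 1)

/-- `f`, the image of `Z`. -/
def pf : PQ K lam := Ideal.Quotient.mk _ (MvPolynomial.X 2)

/-- A Poisson bracket on `P_λ`: a `K`-bilinear Lie bracket satisfying the Leibniz rule with
`{e,f} = h`, `{h,e} = 2e`, `{h,f} = -2f`. -/
structure PoissonBr : Type _ where
  br : PQ K lam → PQ K lam → PQ K lam
  add_left : ∀ a b c, br (a + b) c = br a c + br b c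
  add_right : ∀ a b c, br a (b + c) = br a b + br a c
  smul_left : ∀ (μ : K) (a b), br (μ • a) b = μ • br a b
  smul_right : ∀ (μ : K) (a b), br a (μ • b) = μ • br a b
  alternate : ∀ a, br a a = 0
  jacobi : ∀ a b c, br a (br b c) + br b (br c a) + br c (br a b) = 0
  leibniz : ∀ a b c, br a (b * c) = b * br a c + br a b * c
  br_ef : br (pe K lam) (pf K lam) = ph K lam
  br_he : br (ph K lam) (pe K lam) = 2 * pe K lam
  br_hf : br (ph K lam) (pf K lam) = -2 * pf K lam

variable {K lam}

/-- `Aut(P_λ)`: the subgroup of `K`-algebra automorphisms of `P_λ` preserving the bracket.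
Multiplication is composition: `(θ * φ) x = θ (φ x)`. -/
def PAut (B : PoissonBr K lam) : Subgroup ((PQ K lam) ≃ₐ[K] (PQ K lam)) where
  carrier := {φ | ∀ a b, φ (B.br a b) = B.br (φ a) (φ b)}
  one_mem' := fun _ _ => rfl
  mul_mem' := by
    intro φ ψ hφ hψ a b
    show φ (ψ (B.br a b)) = _
    rw [hψ, hφ]
    rfl
  inv_mem' := by
    intro φ hφ a b
    apply φ.injective
    show φ (φ.symm (B.br a b)) = φ (B.br (φ.symm a) (φ.symm b))
    rw [hφ]
    simp

variable (K lam)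

/-- The standard basis element `E` of `sl₂(K)`. -/
def slE : ↥(LieAlgebra.SpecialLinear.sl (Fin 2) K) :=
  ⟨!![0, 1; 0, 0], LinearMap.mem_ker.2 (by simp [Matrix.trace_fin_two])⟩

/-- The standard basis element `H` of `sl₂(K)`. -/
def slH : ↥(LieAlgebra.SpecialLinear.sl (Fin 2) K) :=
  ⟨!![1, 0; 0, -1], LinearMap.mem_ker.2 (by simp [Matrix.trace_fin_two])⟩

/-- The standard basis element `F` of `sl₂(K)`. -/
def slF : ↥(LieAlgebra.SpecialLinear.sl (Fin 2) K) :=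
  ⟨!![0, 0; 1, 0], LinearMap.mem_ker.2 (by simp [Matrix.trace_fin_two])⟩

/-- The universal enveloping algebra `U(sl₂(K))`. -/
abbrev USl2 : Type _ :=
  UniversalEnvelopingAlgebra K ↥(LieAlgebra.SpecialLinear.sl (Fin 2) K)

/-- The Casimir element `C_U = 2EF + 2FE + H²` of `U(sl₂(K))`. -/
def casimirU : USl2 K :=
  2 * UniversalEnvelopingAlgebra.ι K (slE K) * UniversalEnvelopingAlgebra.ι K (slF K) +
    2 * UniversalEnvelopingAlgebra.ι K (slF K) * UniversalEnvelopingAlgebra.ι K (slE K) +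
    UniversalEnvelopingAlgebra.ι K (slH K) ^ 2

/-- `U_λ`: the quotient of `U(sl₂(K))` by the two-sided ideal generated by `C_U − λ`. -/
abbrev ULam : Type _ :=
  RingQuot (fun a b : USl2 K => a = casimirU K ∧ b = algebraMap K (USl2 K) lam)

/-- `e`, the image of `E` in `U_λ`. -/
def ue : ULam K lam :=
  RingQuot.mkAlgHom K _ (UniversalEnvelopingAlgebra.ι K (slE K))

/-- `h`, the image of `H` in `U_λ`. -/
def uh : ULam K lam :=
  RingQuot.mkAlgHom K _ (UniversalEnvelopingAlgebra.ι K (slH K))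

/-- `f`, the image of `F` in `U_λ`. -/
def uf : ULam K lam :=
  RingQuot.mkAlgHom K _ (UniversalEnvelopingAlgebra.ι K (slF K))

variable {K lam}

/-- `D` is the automorphism `δ_g` of `U_λ`:
`e ↦ e − g(f)h − f·g(f)² + f·g′(f)`, `h ↦ h + 2f·g(f)`, `f ↦ f`. -/
def IsDeltaU (g : Polynomial K) (D : ULam K lam ≃ₐ[K] ULam K lam) : Prop :=
  D (ue K lam) =
      ue K lam - Polynomial.aeval (uf K lam) g * uh K lam -
        uf K lam * Polynomial.aeval (uf K lam) g ^ 2 +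
        uf K lam * Polynomial.aeval (uf K lam) (Polynomial.derivative g) ∧
  D (uh K lam) = uh K lam + 2 * (uf K lam * Polynomial.aeval (uf K lam) g) ∧
  D (uf K lam) = uf K lam

/-- `D` is the hyperbolic rotation `H_β` of `U_λ`: `e ↦ βe`, `h ↦ h`, `f ↦ β⁻¹f`. -/
def IsHRotU (β : Kˣ) (D : ULam K lam ≃ₐ[K] ULam K lam) : Prop :=
  D (ue K lam) = (β : K) • ue K lam ∧
  D (uh K lam) = uh K lam ∧
  D (uf K lam) = (β : K)⁻¹ • uf K lam

section AutomorphismGroups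

variable {K : Type*} [Field K] [CharZero K] {lam : K}

open MvPolynomial
set_option linter.unusedSectionVars false
set_option linter.unusedSimpArgs false

section Derivations

theorem iterate_leibniz_eq_zero {R : Type*} [Ring R] {D : R →+ R}
    (hD : ∀ a b, D (a * b) = a * D b + D a * b) {a b : R} {m n : ℕ}
    (ha : D^[m] a = 0) (hb : D^[n] b = 0) : D^[m + n] (a * b) = 0 := by
  induction h : m + n generalizing m n a b with
  | zero =>
    obtain ⟨rfl, rfl⟩ : m = 0 ∧ n = 0 := by omega
    simp_all
  | succ N ih =>
    rcases m with _ | m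
    · simp only [Function.iterate_zero, id] at ha
      simp [ha, iterate_map_zero]
    rcases n with _ | n
    · simp only [Function.iterate_zero, id] at hb
      simp [hb, iterate_map_zero]
    rw [Function.iterate_succ_apply, hD, iterate_map_add]
    rw [ih ha (n := n) hb (by omega), ih (m := m) ha hb (by omega), add_zero]

/-- `a` has exact nilpotency degree `m` with respect to the additive map `D`. -/
def HasNilDeg {R : Type*} [AddCommGroup R] (D : R →+ R) (a : R) (m : ℕ) : Prop :=
  D^[m] a ≠ 0 ∧ D^[m + 1] a = 0

theorem iterate_eq_zero_of_le {R : Type*} [AddCommGroup R] {D : R →+ R} {a : R} {m n : ℕ}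
    (h : D^[m] a = 0) (hmn : m ≤ n) : D^[n] a = 0 := by
  obtain ⟨k, rfl⟩ := Nat.exists_eq_add_of_le' hmn
  rw [Function.iterate_add_apply, h, iterate_map_zero]

theorem exists_hasNilDeg {R : Type*} [AddCommGroup R] {D : R →+ R} {a : R} (ha : a ≠ 0)
    (h : ∃ m, D^[m] a = 0) : ∃ m, HasNilDeg D a m := by
  classical
  obtain ⟨m, hm⟩ : ∃ m, Nat.find h = m + 1 := by
    refine Nat.exists_eq_succ_of_ne_zero fun h0 => ha ?_
    simpa [h0] using Nat.find_spec h
  exact ⟨m, Nat.find_min h (by omega), hm ▸ Nat.find_spec h⟩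

theorem HasNilDeg.unique {R : Type*} [AddCommGroup R] {D : R →+ R} {a : R} {m n : ℕ}
    (hm : HasNilDeg D a m) (hn : HasNilDeg D a n) : m = n := by
  by_contra hne
  rcases Nat.lt_or_gt_of_ne hne with h | h
  · exact hn.1 (iterate_eq_zero_of_le hm.2 h)
  · exact hm.1 (iterate_eq_zero_of_le hn.2 h)

theorem iterate_leibniz_top {R : Type*} [CommRing R] {D : R →+ R}
    (hD : ∀ a b, D (a * b) = a * D b + D a * b) {a b : R} {m n : ℕ}
    (ha : D^[m + 1] a = 0) (hb : D^[n + 1] b = 0) :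
    D^[m + n] (a * b) = (m + n).choose m * (D^[m] a * D^[n] b) := by
  induction h : m + n generalizing m n a b with
  | zero =>
    obtain ⟨rfl, rfl⟩ : m = 0 ∧ n = 0 := by omega
    simp
  | succ N ih =>
    rw [Function.iterate_succ_apply, hD, iterate_map_add]
    rcases m with _ | m
    · obtain rfl : n = N + 1 := by omega
      simp only [zero_add, Function.iterate_one] at ha
      rw [ih (m := 0) (n := N) ha hb (by omega), ha, zero_mul, iterate_map_zero]
      simp
    rcases n with _ | n
    · obtain rfl : m = N := by omega
      simp only [zero_add, Function.iterate_one] at hb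
      rw [ih (m := m) (n := 0) ha hb (by omega), hb, mul_zero, iterate_map_zero]
      simp
    rw [ih (n := n) ha hb (by omega), ih (m := m) ha hb (by omega), Nat.choose_succ_succ]
    push_cast
    rw [← Function.iterate_succ_apply, ← Function.iterate_succ_apply]
    ring

theorem HasNilDeg.mul {R : Type*} [CommRing R] [IsDomain R] [CharZero R] {D : R →+ R}
    (hD : ∀ a b, D (a * b) = a * D b + D a * b) {a b : R} {m n : ℕ}
    (ha : HasNilDeg D a m) (hb : HasNilDeg D b n) : HasNilDeg D (a * b) (m + n) := by
  refine ⟨?_, ?_⟩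
  · rw [iterate_leibniz_top hD ha.2 hb.2]
    have := (Nat.choose_pos (Nat.le_add_right m n)).ne'
    exact mul_ne_zero (Nat.cast_ne_zero.2 this) (mul_ne_zero ha.1 hb.1)
  · rcases n with _ | n
    · have hb' : D b = 0 := hb.2
      have : ∀ k, D^[k] (a * b) = D^[k] a * b := by
        intro k
        induction k with
        | zero => rfl
        | succ k ih => rw [Function.iterate_succ_apply', ih, hD, hb', mul_zero, zero_add,
            Function.iterate_succ_apply']
      rw [this, add_zero, ha.2, zero_mul]
    · have h1 := iterate_leibniz_top hD ha.2 (n := n + 2)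
        (b := b) (iterate_eq_zero_of_le hb.2 (by omega))
      rw [hb.2, mul_zero, mul_zero] at h1
      exact h1

theorem HasNilDeg.pow {R : Type*} [CommRing R] [IsDomain R] [CharZero R] {D : R →+ R}
    (hD : ∀ a b, D (a * b) = a * D b + D a * b) {a : R} {m : ℕ}
    (ha : HasNilDeg D a m) (k : ℕ) : HasNilDeg D (a ^ k) (k * m) := by
  induction k with
  | zero =>
    have h1 : D 1 = 0 := by simpa using hD 1 1
    simpa [HasNilDeg] using h1
  | succ k ih =>
    rw [pow_succ, Nat.succ_mul]
    exact ih.mul hD ha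

theorem HasNilDeg.apply {R : Type*} [AddCommGroup R] {D : R →+ R} {a : R} {m : ℕ}
    (ha : HasNilDeg D a (m + 1)) : HasNilDeg D (D a) m := by
  simpa [HasNilDeg] using ha

theorem eq_zero_of_mul_mem_ker {R : Type*} [CommRing R] [IsDomain R] [CharZero R] {D : R →+ R}
    (hD : ∀ a b, D (a * b) = a * D b + D a * b) (hnil : ∀ a, ∃ m, D^[m] a = 0) {a b : R}
    (hab : a * b ≠ 0) (h : D (a * b) = 0) : D a = 0 := by
  obtain ⟨m, hm⟩ := exists_hasNilDeg (left_ne_zero_of_mul hab) (hnil a)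
  obtain ⟨n, hn⟩ := exists_hasNilDeg (right_ne_zero_of_mul hab) (hnil b)
  have h0 : HasNilDeg D (a * b) 0 := ⟨hab, h⟩
  have := (hm.mul hD hn).unique h0
  obtain rfl : m = 0 := by omega
  exact hm.2

theorem exists_iterate_eq_zero_of_sq {R : Type*} [CommRing R] [IsDomain R] [CharZero R]
    {D : R →+ R} (hD : ∀ a b, D (a * b) = a * D b + D a * b) {S : Set R}
    (hS : ∀ u ∈ S, D u ∈ S) (hsq : ∀ u ∈ S, ∃ m, D^[m] (u ^ 2) = 0) {u : R} (hu : u ∈ S) :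
    ∃ m, D^[m] u = 0 := by
  by_cases hu0 : u = 0
  · exact ⟨0, hu0⟩
  obtain ⟨m, hm⟩ := exists_hasNilDeg (pow_ne_zero 2 hu0) (hsq u hu)
  induction m using Nat.strong_induction_on generalizing u with
  | _ m ih =>
    have hDu : D (u ^ 2) = 2 * (u * D u) := by rw [sq, hD]; ring
    by_cases hv : D u = 0
    · exact ⟨1, hv⟩
    rcases m with _ | m
    · have h0 : D (u ^ 2) = 0 := hm.2
      rw [hDu] at h0
      exact ⟨1, by simpa [hu0] using h0⟩
    · obtain ⟨k, hk⟩ := exists_hasNilDeg (pow_ne_zero 2 hv) (hsq _ (hS u hu))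
      have h1 := hm.mul hD hk
      have h2 := hm.apply.pow hD 2
      have h4 : HasNilDeg D (4 : R) 0 := by
        have h1 : D 1 = 0 := by simpa using hD 1 1
        refine ⟨by simp, ?_⟩
        have : (4 : R) = 4 • (1 : R) := by simp
        simp only [zero_add, Function.iterate_one]
        rw [this, map_nsmul, h1, smul_zero]
      have h3 := h4.mul hD h1
      rw [show (4 : R) * (u ^ 2 * D u ^ 2) = D (u ^ 2) ^ 2 by rw [hDu]; ring] at h3
      have := h3.unique h2
      obtain ⟨j, hj⟩ := ih k (by omega) (hS u hu) hv hk
      exact ⟨j + 1, hj⟩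

end Derivations

section Plane

variable (K) in
/-- The polynomial ring `K[x, y]`. -/
abbrev Plane : Type _ := MvPolynomial (Fin 2) K

/-- The Hamiltonian derivation `{s, ·}` of `K[x, y]`, normalised by `{y, x} = 1/2`. -/
def ham (s : Plane K) : Derivation K (Plane K) (Plane K) :=
  (2⁻¹ : K) • (pderiv 1 s • pderiv 0 - pderiv 0 s • pderiv 1)

theorem ham_apply (s v : Plane K) :
    ham s v = C (2⁻¹ : K) * (pderiv 1 s * pderiv 0 v - pderiv 0 s * pderiv 1 v) := by
  simp [ham, smul_eq_C_mul]

theorem ham_self (s : Plane K) : ham s s = 0 := by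
  rw [ham_apply]; ring

theorem ham_X_zero (s : Plane K) : ham s (X 0) = C (2⁻¹ : K) * pderiv 1 s := by
  simp [ham_apply, pderiv_X]

theorem ham_X_one (s : Plane K) : ham s (X 1) = C (2⁻¹ : K) * -pderiv 0 s := by
  simp [ham_apply, pderiv_X]

/-- `{s, ·}` as an additive map. -/
def hamHom (s : Plane K) : Plane K →+ Plane K := (ham s).toLinearMap.toAddMonoidHom

theorem hamHom_apply (s v : Plane K) : hamHom s v = ham s v := rfl

theorem hamHom_mul (s : Plane K) (a b : Plane K) :
    hamHom s (a * b) = a * hamHom s b + hamHom s a * b := by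
  simp only [hamHom_apply, Derivation.leibniz, smul_eq_mul]; ring

variable (K) in
/-- The subalgebra of polynomials invariant under `(x, y) ↦ (-x, -y)`. -/
def evenPart : Subalgebra K (Plane K) :=
  Algebra.adjoin K {X 0 ^ 2, X 0 * X 1, X 1 ^ 2}

theorem X_zero_sq_mem : (X 0 ^ 2 : Plane K) ∈ evenPart K :=
  Algebra.subset_adjoin (by simp)

theorem X_zero_mul_mem : (X 0 * X 1 : Plane K) ∈ evenPart K :=
  Algebra.subset_adjoin (by simp)

theorem X_one_sq_mem : (X 1 ^ 2 : Plane K) ∈ evenPart K :=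
  Algebra.subset_adjoin (by simp)

theorem C_mem_evenPart (c : K) : (C c : Plane K) ∈ evenPart K :=
  (evenPart K).algebraMap_mem c

theorem eval_neg_of_mem_evenPart {s : Plane K} (hs : s ∈ evenPart K) (a b : K) :
    eval ![-a, -b] s = eval ![a, b] s := by
  have h : evenPart K ≤ AlgHom.equalizer (aeval ![-a, -b] : Plane K →ₐ[K] K) (aeval ![a, b]) := by
    refine Algebra.adjoin_le ?_
    rintro _ (rfl | rfl | rfl) <;> simp
  simpa [aeval_eq_eval] using h hs

variable (K) in
/-- Polynomials anti-invariant under `(x, y) ↦ (-x, -y)`. -/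
def oddPart : Set (Plane K) :=
  {u | ∃ a ∈ evenPart K, ∃ b ∈ evenPart K, u = X 0 * a + X 1 * b}

theorem mul_mem_oddPart {a u : Plane K} (ha : a ∈ evenPart K) (hu : u ∈ oddPart K) :
    a * u ∈ oddPart K := by
  obtain ⟨b, hb, c, hc, rfl⟩ := hu
  exact ⟨a * b, mul_mem ha hb, a * c, mul_mem ha hc, by ring⟩

theorem add_mem_oddPart {u v : Plane K} (hu : u ∈ oddPart K) (hv : v ∈ oddPart K) :
    u + v ∈ oddPart K := by
  obtain ⟨b, hb, c, hc, rfl⟩ := hu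
  obtain ⟨b', hb', c', hc', rfl⟩ := hv
  exact ⟨b + b', add_mem hb hb', c + c', add_mem hc hc', by ring⟩

theorem oddPart_mul_mem {u v : Plane K} (hu : u ∈ oddPart K) (hv : v ∈ oddPart K) :
    u * v ∈ evenPart K := by
  obtain ⟨b, hb, c, hc, rfl⟩ := hu
  obtain ⟨b', hb', c', hc', rfl⟩ := hv
  have : (X 0 * b + X 1 * c) * (X 0 * b' + X 1 * c') =
      X 0 ^ 2 * (b * b') + X 0 * X 1 * (b * c' + c * b') + X 1 ^ 2 * (c * c') := by ring
  rw [this]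
  exact add_mem (add_mem (mul_mem X_zero_sq_mem (mul_mem hb hb'))
    (mul_mem X_zero_mul_mem (add_mem (mul_mem hb hc') (mul_mem hc hb'))))
    (mul_mem X_one_sq_mem (mul_mem hc hc'))

theorem X_zero_mem_oddPart : (X 0 : Plane K) ∈ oddPart K :=
  ⟨1, one_mem _, 0, zero_mem _, by ring⟩

theorem X_one_mem_oddPart : (X 1 : Plane K) ∈ oddPart K :=
  ⟨0, zero_mem _, 1, one_mem _, by ring⟩

theorem pderiv_mem_oddPart {s : Plane K} (hs : s ∈ evenPart K) (i : Fin 2) :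
    pderiv i s ∈ oddPart K := by
  have h0 : (0 : Plane K) ∈ oddPart K := ⟨0, zero_mem _, 0, zero_mem _, by ring⟩
  have h2 : ∀ u ∈ oddPart K, 2 * u ∈ oddPart K := fun u hu => by
    have h : (2 : Plane K) = C 2 := (map_ofNat C 2).symm
    rw [h]; exact mul_mem_oddPart (C_mem_evenPart 2) hu
  induction hs using Algebra.adjoin_induction with
  | mem u hu =>
    rcases hu with rfl | rfl | rfl <;> fin_cases i <;>
      simp [pderiv_X, h0, X_zero_mem_oddPart, X_one_mem_oddPart,
        h2 _ X_zero_mem_oddPart, h2 _ X_one_mem_oddPart]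
  | algebraMap r => simpa [algebraMap_eq] using h0
  | add u v _ _ hu hv => rw [map_add]; exact add_mem_oddPart hu hv
  | mul u v hu' hv' hu hv =>
    rw [Derivation.leibniz, smul_eq_mul, smul_eq_mul]
    exact add_mem_oddPart (mul_mem_oddPart hu' hv) (mul_mem_oddPart hv' hu)

theorem ham_mem_evenPart {s v : Plane K} (hs : s ∈ evenPart K) (hv : v ∈ evenPart K) :
    ham s v ∈ evenPart K := by
  rw [ham_apply]
  exact mul_mem (C_mem_evenPart _) (sub_mem
    (oddPart_mul_mem (pderiv_mem_oddPart hs 1) (pderiv_mem_oddPart hv 0))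
    (oddPart_mul_mem (pderiv_mem_oddPart hs 0) (pderiv_mem_oddPart hv 1)))

theorem ham_mem_oddPart {s v : Plane K} (hs : s ∈ evenPart K) (hv : v ∈ oddPart K) :
    ham s v ∈ oddPart K := by
  obtain ⟨a, ha, b, hb, rfl⟩ := hv
  have hx : ham s (X 0) ∈ oddPart K := by
    rw [ham_X_zero]; exact mul_mem_oddPart (C_mem_evenPart _) (pderiv_mem_oddPart hs 1)
  have hy : ham s (X 1) ∈ oddPart K := by
    rw [ham_X_one, mul_neg, ← neg_mul, ← C_neg]
    exact mul_mem_oddPart (C_mem_evenPart _) (pderiv_mem_oddPart hs 0)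
  have h : ham s (X 0 * a + X 1 * b) =
      (ham s a * X 0 + a * ham s (X 0)) + (ham s b * X 1 + b * ham s (X 1)) := by
    simp only [map_add, Derivation.leibniz, smul_eq_mul]; ring
  rw [h]
  exact add_mem_oddPart
    (add_mem_oddPart (mul_mem_oddPart (ham_mem_evenPart hs ha) X_zero_mem_oddPart)
      (mul_mem_oddPart ha hx))
    (add_mem_oddPart (mul_mem_oddPart (ham_mem_evenPart hs hb) X_one_mem_oddPart)
      (mul_mem_oddPart hb hy))

/-- If `{s, ·}` is locally nilpotent on even polynomials then it is so on all polynomials. -/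
theorem hamHom_locally_nilpotent {s : Plane K} (hs : s ∈ evenPart K)
    (h0 : ∃ m, (hamHom s)^[m] (X 0 ^ 2) = 0) (h1 : ∃ m, (hamHom s)^[m] (X 0 * X 1) = 0)
    (h2 : ∃ m, (hamHom s)^[m] (X 1 ^ 2) = 0) (u : Plane K) : ∃ m, (hamHom s)^[m] u = 0 := by
  have hadd : ∀ a b, (∃ m, (hamHom s)^[m] a = 0) → (∃ m, (hamHom s)^[m] b = 0) →
      ∃ m, (hamHom s)^[m] (a + b) = 0 := by
    rintro a b ⟨m, hm⟩ ⟨n, hn⟩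
    refine ⟨max m n, ?_⟩
    rw [iterate_map_add, iterate_eq_zero_of_le hm (le_max_left _ _),
      iterate_eq_zero_of_le hn (le_max_right _ _), add_zero]
  have hmul : ∀ a b, (∃ m, (hamHom s)^[m] a = 0) → (∃ m, (hamHom s)^[m] b = 0) →
      ∃ m, (hamHom s)^[m] (a * b) = 0 := by
    rintro a b ⟨m, hm⟩ ⟨n, hn⟩
    exact ⟨m + n, iterate_leibniz_eq_zero (hamHom_mul s) hm hn⟩
  have hC : ∀ c : K, ∃ m, (hamHom s)^[m] (C c) = 0 := fun c => ⟨1, by simp [hamHom_apply]⟩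
  have heven : ∀ a ∈ evenPart K, ∃ m, (hamHom s)^[m] a = 0 := by
    intro a ha
    induction ha using Algebra.adjoin_induction with
    | mem u hu => rcases hu with rfl | rfl | rfl <;> assumption
    | algebraMap r => exact hC r
    | add u v _ _ hu hv => exact hadd _ _ hu hv
    | mul u v _ _ hu hv => exact hmul _ _ hu hv
  have hodd : ∀ a ∈ oddPart K, ∃ m, (hamHom s)^[m] a = 0 := fun a ha =>
    exists_iterate_eq_zero_of_sq (hamHom_mul s) (fun u hu => ham_mem_oddPart hs hu)
      (fun u hu => heven _ (by rw [sq]; exact oddPart_mul_mem hu hu)) ha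
  induction u using MvPolynomial.induction_on with
  | C a => exact hC a
  | add p q hp hq => exact hadd _ _ hp hq
  | mul_X p i hp =>
    refine hmul _ _ hp (hodd _ ?_)
    fin_cases i
    exacts [X_zero_mem_oddPart, X_one_mem_oddPart]

/-- The weight of a monomial when `x` has weight `ρ` and `y` has weight `σ`. -/
def wtm (ρ σ : ℤ) (d : Fin 2 →₀ ℕ) : ℤ := ρ * d 0 + σ * d 1

/-- Quasi-homogeneity of weight `n`. -/
def IsQH (ρ σ n : ℤ) (u : Plane K) : Prop := ∀ d, coeff d u ≠ 0 → wtm ρ σ d = n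

theorem IsQH.eval_scale {ρ σ n : ℕ} {u : Plane K} (hu : IsQH ρ σ n u) (μ a b : K) :
    eval ![μ ^ ρ * a, μ ^ σ * b] u = μ ^ n * eval ![a, b] u := by
  rw [eval_eq', eval_eq', Finset.mul_sum]
  refine Finset.sum_congr rfl fun d hd => ?_
  have h := hu d (mem_support_iff.1 hd)
  have h' : ρ * d 0 + σ * d 1 = n := by unfold wtm at h; exact_mod_cast h
  simp only [Fin.prod_univ_two, Matrix.cons_val_zero, Matrix.cons_val_one, mul_pow, ← pow_mul,
    ← h', pow_add]
  ring

theorem IsQH.euler {ρ σ n : ℕ} {u : Plane K} (hu : IsQH ρ σ n u) :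
    (ρ : Plane K) * X 0 * pderiv 0 u + (σ : Plane K) * X 1 * pderiv 1 u = (n : Plane K) * u := by
  have h : IsWeightedHomogeneous ![ρ, σ] u n := by
    intro d hd
    have h := hu d hd
    unfold wtm at h
    rw [Finsupp.weight_apply, Finsupp.sum_fintype _ _ (by simp)]
    simp only [Fin.sum_univ_two, smul_eq_mul, Matrix.cons_val_zero, Matrix.cons_val_one]
    zify; linarith
  have := h.sum_weight_X_mul_pderiv
  simpa [Fin.sum_univ_two, mul_assoc] using this

end Plane

section QuasiHomogeneous

theorem pderiv_aeval_plane (g : Fin 2 → Plane K) (i : Fin 2) (s : Plane K) :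
    pderiv i (aeval g s) = aeval g (pderiv 0 s) * pderiv i (g 0) +
      aeval g (pderiv 1 s) * pderiv i (g 1) := by
  induction s using MvPolynomial.induction_on with
  | C a => simp
  | add p q hp hq => simp only [map_add, hp, hq]; ring
  | mul_X p j hp =>
    simp only [map_mul, aeval_X, Derivation.leibniz, smul_eq_mul, map_add, hp, pderiv_X]
    fin_cases j <;> simp <;> ring

theorem IsQH.eq_add_mul {ρ σ n : ℕ} (hσ : 0 < σ) (hc : ρ.Coprime σ) {d : Fin 2 →₀ ℕ}
    (h : wtm ρ σ d = (σ * n : ℕ)) : ∃ j, d 0 = σ * j ∧ n = ρ * j + d 1 := by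
  unfold wtm at h
  have h' : ρ * d 0 + σ * d 1 = σ * n := by exact_mod_cast h
  have h1 : σ ∣ ρ * d 0 := (Nat.dvd_add_left (Dvd.intro _ rfl)).1 (h' ▸ Dvd.intro _ rfl)
  obtain ⟨j, hj⟩ := (hc.symm.dvd_of_dvd_mul_left h1)
  refine ⟨j, hj, ?_⟩
  rw [hj] at h'
  exact Nat.eq_of_mul_eq_mul_left hσ (by rw [← h']; ring)

theorem IsQH.eval_zero_one {ρ σ n : ℕ} (hσ : 0 < σ) {s : Plane K}
    (hs : IsQH ρ σ (σ * n : ℕ) s) :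
    eval ![0, 1] s = coeff (Finsupp.single 1 n) s := by
  rw [eval_eq', Finset.sum_eq_single (Finsupp.single 1 n)]
  · simp
  · intro d hd hne
    have h := hs d (mem_support_iff.1 hd)
    by_cases h0 : d 0 = 0
    · refine absurd ?_ hne
      unfold wtm at h
      rw [h0] at h
      have h1 : σ * d 1 = σ * n := by
        push_cast at h
        have : (σ : ℤ) * d 1 = σ * n := by linarith
        exact_mod_cast this
      ext i
      fin_cases i
      · simpa using h0
      · simpa using Nat.eq_of_mul_eq_mul_left hσ h1
    · simp [h0]
  · intro hn
    simp [notMem_support_iff.1 hn]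

theorem IsQH.dvd_sub {ρ σ n : ℕ} (hσ : 0 < σ) (hc : ρ.Coprime σ) {s : Plane K}
    (hs : IsQH ρ σ (σ * n : ℕ) s) (a : K) :
    (X 0 ^ σ - C (a ^ σ) * X 1 ^ ρ : Plane K) ∣ s - C (eval ![a, 1] s) * X 1 ^ n := by
  have h : s - C (eval ![a, 1] s) * X 1 ^ n =
      ∑ d ∈ s.support, (C (coeff d s) * (X 0 ^ d 0 * X 1 ^ d 1) -
        C (coeff d s * a ^ d 0) * X 1 ^ n) := by
    rw [Finset.sum_sub_distrib, ← Finset.sum_mul, ← map_sum]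
    congr 1
    · conv_lhs => rw [s.as_sum]
      refine Finset.sum_congr rfl fun d _ => ?_
      rw [monomial_eq, Finsupp.prod_fintype _ _ (by simp), Fin.prod_univ_two]
    · congr 2
      rw [eval_eq']
      simp
  rw [h]
  refine Finset.dvd_sum fun d hd => ?_
  obtain ⟨j, h0, h1⟩ := IsQH.eq_add_mul hσ hc (hs d (mem_support_iff.1 hd))
  have h2 : C (coeff d s) * (X 0 ^ d 0 * X 1 ^ d 1) - C (coeff d s * a ^ d 0) * X 1 ^ n =
      C (coeff d s) * X 1 ^ d 1 * ((X 0 ^ σ) ^ j - (C (a ^ σ) * X 1 ^ ρ) ^ j : Plane K) := by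
    rw [h1, h0]
    simp only [map_mul, map_pow, pow_add, pow_mul, mul_pow]
    ring
  rw [h2]
  exact (sub_dvd_pow_sub_pow _ _ j).mul_left _

theorem IsQH.exists_root [IsAlgClosed K] {ρ σ n : ℕ} (hσ : 0 < σ) {s : Plane K}
    (hs : IsQH ρ σ (σ * n : ℕ) s) (hx : pderiv 0 s ≠ 0) : ∃ a, eval ![a, 1] s = 0 := by
  set p : Polynomial K := aeval ![Polynomial.X, 1] s with hp
  have hev : ∀ a, p.eval a = eval ![a, 1] s := by
    intro a
    have h : (Polynomial.aeval a).comp (aeval ![Polynomial.X, 1] : Plane K →ₐ[K] Polynomial K) =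
        aeval ![a, 1] := by
      ext i; fin_cases i <;> simp
    simpa [aeval_eq_eval, Polynomial.aeval_def, hp] using DFunLike.congr_fun h s
  by_cases hdeg : p.degree = 0
  · exfalso
    obtain ⟨c, hc⟩ : ∃ c, p = Polynomial.C c := ⟨_, Polynomial.eq_C_of_degree_eq_zero hdeg⟩
    have hc' : ∀ a, eval ![a, 1] s = c := fun a => by rw [← hev, hc, Polynomial.eval_C]
    have key : X 1 * (s - C c * X 1 ^ n) = 0 := by
      refine MvPolynomial.funext fun v => ?_
      have hv : v = ![v 0, v 1] := by ext i; fin_cases i <;> rfl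
      by_cases h1 : v 1 = 0
      · simp [h1]
      obtain ⟨μ, hμ⟩ := IsAlgClosed.exists_pow_nat_eq (v 1) hσ
      have hμ0 : μ ≠ 0 := by rintro rfl; rw [zero_pow hσ.ne'] at hμ; exact h1 hμ.symm
      have h2 := hs.eval_scale μ (v 0 / μ ^ ρ) 1
      rw [hc', mul_one, mul_div_cancel₀ _ (pow_ne_zero _ hμ0), hμ, ← hv, pow_mul, hμ] at h2
      simp [h2, mul_comm]
    have h3 : s = C c * X 1 ^ n := by
      simpa [sub_eq_zero, X_ne_zero] using key
    exact hx (by rw [h3]; simp [Derivation.leibniz, pderiv_X])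
  · obtain ⟨a, ha⟩ := IsAlgClosed.exists_root p hdeg
    exact ⟨a, by rw [← hev]; exact ha⟩

/-- A quasi-homogeneous even polynomial depending on `x` whose Hamiltonian derivation is locally
nilpotent becomes independent of `y` after a triangular substitution. -/
theorem IsQH.exists_triangular [IsAlgClosed K] {ρ σ n : ℕ} (hρ : 0 < ρ) (hσ : 0 < σ) (hn : 0 < n)
    (hc : ρ.Coprime σ)
    {s : Plane K} (heven : s ∈ evenPart K) (hs : IsQH ρ σ (σ * n : ℕ) s)
    (hnil : ∀ u, ∃ m, (hamHom s)^[m] u = 0) (hx : pderiv 0 s ≠ 0)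
    (hcase : (ρ = 1 ∧ σ = 1) ∨ (σ < ρ ∧ coeff (Finsupp.single 1 n) s ≠ 0)) :
    σ = 1 ∧ Odd ρ ∧
      ∃ a : K, pderiv 1 (aeval ![X 0 + C a * X 1 ^ ρ, X 1] s : Plane K) = 0 := by
  have hs0 : s ≠ 0 := by rintro rfl; simp at hx
  have hker : ∀ a, eval ![a, 1] s = 0 →
      hamHom s (X 0 ^ σ - C (a ^ σ) * X 1 ^ ρ) = 0 := by
    intro a ha
    obtain ⟨q, hq⟩ := hs.dvd_sub hσ hc a
    rw [ha, C_0, zero_mul, sub_zero] at hq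
    refine eq_zero_of_mul_mem_ker (hamHom_mul s) hnil (b := q) (hq ▸ hs0) ?_
    rw [← hq, hamHom_apply, ham_self]
  have hC2 : (C (2⁻¹ : K) : Plane K) ≠ 0 := by simp
  have hker' : ∀ a, eval ![a, 1] s = 0 →
      pderiv 1 s * ((σ : Plane K) * X 0 ^ (σ - 1)) +
        pderiv 0 s * (C (a ^ σ) * ((ρ : Plane K) * X 1 ^ (ρ - 1))) = 0 := by
    intro a ha
    have h := hker a ha
    rw [hamHom_apply, ham_apply, mul_eq_zero, or_iff_right hC2] at h
    rw [← h]
    simp [Derivation.leibniz, Derivation.leibniz_pow, pderiv_X]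
  obtain ⟨a, ha⟩ := hs.exists_root hσ hx
  have hρK : (ρ : Plane K) ≠ 0 := Nat.cast_ne_zero.2 hρ.ne'
  have hσK : (σ : Plane K) ≠ 0 := Nat.cast_ne_zero.2 hσ.ne'
  have hcase' : (ρ = 1 ∧ σ = 1) ∨ (σ < ρ ∧ a ≠ 0 ∧ pderiv 1 s ≠ 0) := by
    refine hcase.imp_right fun ⟨h, h'⟩ => ?_
    have ha0 : a ≠ 0 := by
      rintro rfl
      exact h' (by rw [← hs.eval_zero_one hσ, ha])
    refine ⟨h, ha0, fun hy => ?_⟩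
    have h1 := hker' a ha
    rw [hy, zero_mul, zero_add] at h1
    simp [hx, ha0, hρK, X_ne_zero] at h1
  have hσ1 : σ = 1 := by
    rcases hcase' with ⟨-, h⟩ | ⟨hlt, ha0, hy⟩
    · exact h
    by_contra hne
    set r : Plane K := X 0 ^ σ - C (a ^ σ) * X 1 ^ ρ with hr
    have hr0 : r ≠ 0 := by
      intro h
      have := congrArg (pderiv 0) h
      simp [hr, Derivation.leibniz, Derivation.leibniz_pow, pderiv_X, hσK, X_ne_zero] at this
    have hDr : hamHom s r = 0 := hker a ha
    have e1 := hs.euler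
    have e2 := hker' a ha
    have hx' : X 0 * (X 0 : Plane K) ^ (σ - 1) = X 0 ^ σ := mul_pow_sub_one hσ.ne' _
    have hy' : X 1 * (X 1 : Plane K) ^ (ρ - 1) = X 1 ^ ρ := mul_pow_sub_one hρ.ne' _
    push_cast at e1
    have k1 : (σ * n : Plane K) * s * ((σ : Plane K) * X 0 ^ (σ - 1)) = (ρ : Plane K) * (σ : Plane K) * r * pderiv 0 s := by
      rw [← e1, hr, ← hx', ← hy']
      linear_combination ((σ : Plane K) * X 1) * e2
    have k2 : (σ * n : Plane K) * s * (C (a ^ σ) * ((ρ : Plane K) * X 1 ^ (ρ - 1))) =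
        -((ρ : Plane K) * (σ : Plane K) * r * pderiv 1 s) := by
      rw [← e1, hr, ← hx', ← hy']
      linear_combination ((ρ : Plane K) * X 0) * e2
    have hdeg0 : ∀ u, u ≠ 0 → hamHom s u = 0 → HasNilDeg (hamHom s) u 0 := fun u h h' => ⟨h, h'⟩
    have hcst : ∀ c : K, c ≠ 0 → HasNilDeg (hamHom s) (C c) 0 := fun c h =>
      hdeg0 _ (by simpa) (by simp [hamHom_apply])
    have hnat : ∀ m : ℕ, m ≠ 0 → HasNilDeg (hamHom s) (m : Plane K) 0 := fun c h => by
      have := hcst c (by simpa using h)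
      simpa using this
    obtain ⟨dx, hdx⟩ := exists_hasNilDeg (X_ne_zero (R := K) (0 : Fin 2)) (hnil (X 0))
    obtain ⟨dy, hdy⟩ := exists_hasNilDeg (X_ne_zero (R := K) (1 : Fin 2)) (hnil (X 1))
    have hs' := hdeg0 s hs0 (by rw [hamHom_apply, ham_self])
    have hr' := hdeg0 r hr0 hDr
    have hDx : hamHom s (X 0) ≠ 0 := by
      rw [hamHom_apply, ham_X_zero]; exact mul_ne_zero hC2 hy
    have hDy : hamHom s (X 1) ≠ 0 := by
      rw [hamHom_apply, ham_X_one]; exact mul_ne_zero hC2 (neg_ne_zero.2 hx)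
    obtain ⟨dx, rfl⟩ : ∃ k, dx = k + 1 := Nat.exists_eq_succ_of_ne_zero
      (by rintro rfl; exact hDx hdx.2)
    obtain ⟨dy, rfl⟩ : ∃ k, dy = k + 1 := Nat.exists_eq_succ_of_ne_zero
      (by rintro rfl; exact hDy hdy.2)
    have mulD := fun {a b : Plane K} {m n : ℕ} (ha : HasNilDeg (hamHom s) a m)
      (hb : HasNilDeg (hamHom s) b n) => ha.mul (hamHom_mul s) hb
    have hsx : HasNilDeg (hamHom s) (pderiv 0 s) dy := by
      have h := mulD (hcst (-2) (by simp)) hdy.apply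
      rw [hamHom_apply, ham_X_one, zero_add, ← mul_assoc, ← C_mul] at h
      simpa using h
    have hsy : HasNilDeg (hamHom s) (pderiv 1 s) dx := by
      have h := mulD (hcst 2 (by simp)) hdx.apply
      rw [hamHom_apply, ham_X_zero, zero_add, ← mul_assoc, ← C_mul] at h
      simpa using h
    have m1 := (mulD (mulD (mulD (hnat σ hσ.ne') (hnat n hn.ne')) hs')
      (mulD (hnat σ hσ.ne') (hdx.pow (hamHom_mul s) (σ - 1))))
    rw [k1] at m1
    have n1 := m1.unique (mulD (mulD (mulD (hnat ρ hρ.ne') (hnat σ hσ.ne')) hr') hsx)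
    have m2 := (mulD (mulD (mulD (hnat σ hσ.ne') (hnat n hn.ne')) hs')
      (mulD (hcst (a ^ σ) (pow_ne_zero _ ha0)) 
        (mulD (hnat ρ hρ.ne') (hdy.pow (hamHom_mul s) (ρ - 1)))))
    rw [k2, show -((ρ : Plane K) * (σ : Plane K) * r * pderiv 1 s) = C (-1) * ((ρ : Plane K) * (σ : Plane K) * r * pderiv 1 s) by simp] at m2
    have n2 := m2.unique (mulD (hcst (-1) (by simp))
      (mulD (mulD (mulD (hnat ρ hρ.ne') (hnat σ hσ.ne')) hr') hsy))
    obtain ⟨s', rfl⟩ : ∃ k, σ = k + 2 := ⟨σ - 2, by omega⟩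
    obtain ⟨r', rfl⟩ : ∃ k, ρ = k + 2 := ⟨ρ - 2, by omega⟩
    simp only [zero_add, show ∀ k, k + 2 - 1 = k + 1 by omega] at n1 n2
    nlinarith
  subst hσ1
  refine ⟨rfl, ?_, a, ?_⟩
  · rcases hcase' with ⟨h, -⟩ | ⟨hlt, ha0, hy⟩
    · rw [h]; exact odd_one
    by_contra hodd
    rw [Nat.not_odd_iff_even] at hodd
    have h1 : eval ![-a, 1] s = 0 := by
      have h := hs.eval_scale (-1) (-a) 1
      rw [hodd.neg_one_pow, one_mul, pow_one, mul_one, eval_neg_of_mem_evenPart heven, ha] at h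
      have h' := h.symm
      rw [mul_eq_zero] at h'
      exact h'.resolve_left (pow_ne_zero _ (by simp))
    have h2 := hker' a ha
    have h3 := hker' (-a) h1
    have h4 : (2 : Plane K) * pderiv 1 s = 0 := by
      simp only [Nat.cast_one, Nat.sub_self, pow_zero, pow_one, C_neg] at h2 h3
      linear_combination h2 + h3
    simp [hy] at h4
  · have h := hker' a ha
    simp only [Nat.cast_one, Nat.sub_self, pow_zero, pow_one] at h
    rw [pderiv_aeval_plane]
    have h' := congrArg (aeval ![X 0 + C a * X 1 ^ ρ, X 1] : Plane K →ₐ[K] Plane K) h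
    rw [map_zero] at h'
    rw [← h']
    simp [Derivation.leibniz, Derivation.leibniz_pow, pderiv_X, algHom_C]
    ring

end QuasiHomogeneous

section Model

/-- The relations of `sl₂` together with the Casimir relation, for a triple in an algebra with a
bilinear bracket. -/
structure IsSlTriple {A : Type*} [Ring A] [Algebra K A] (br : A →ₗ[K] A →ₗ[K] A) (lam : K)
    (e h f : A) : Prop where
  ef : br e f = h
  he : br h e = 2 * e
  hf : br h f = -2 * f
  casimir : 2 * e * f + 2 * f * e + h ^ 2 = algebraMap K A lam

/-- A common description of `P_λ` (with `eps = 0`) and `U_λ` (with `eps = 1`): an algebra with a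
biderivation, presented by an `sl₂`-triple, and acting on a polynomial ring. -/
structure SlModel (K : Type*) [Field K] [CharZero K] (lam : K) (A : Type*) [Ring A]
    [Algebra K A] where
  br : A →ₗ[K] A →ₗ[K] A
  leib : ∀ a b c, br a (b * c) = b * br a c + br a b * c
  alt : ∀ a, br a a = 0
  eps : K
  comm : ∀ a b, a * b - b * a = eps • br a b
  g : Fin 3 → A
  triple : IsSlTriple br lam (g 0) (g 1) (g 2)
  adjoin_eq_top : Algebra.adjoin K (Set.range g) = ⊤
  exists_hom : ∀ e h f, IsSlTriple br lam e h f →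
    ∃ φ : A →ₐ[K] A, φ (g 0) = e ∧ φ (g 1) = h ∧ φ (g 2) = f
  kap : K
  op : A →ₐ[K] Module.End K (Plane K)
  op_zero : ∀ u, op (g 0) u =
    X 0 ^ 2 * X 1 ^ 2 * u + (C eps * X 0 ^ 2 * pderiv 0 u + C kap * X 0 * u)
  op_one : ∀ u, op (g 1) u =
    2 * X 0 * X 1 ^ 2 * u + (C (2 * eps) * X 0 * pderiv 0 u + C kap * u)
  op_two : ∀ u, op (g 2) u = -X 1 ^ 2 * u + -(C eps * pderiv 0 u)

variable {A : Type*} [Ring A] [Algebra K A] (M : SlModel K lam A)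

namespace SlModel

theorem br_swap (a b : A) : M.br a b = -M.br b a := by
  have h := M.alt (a + b)
  simp only [map_add, LinearMap.add_apply, M.alt, zero_add, add_zero] at h
  exact eq_neg_of_add_eq_zero_right h

theorem leib_left (a b c : A) : M.br (a * b) c = a * M.br b c + M.br a c * b := by
  rw [M.br_swap, M.leib, M.br_swap c b, M.br_swap c a]; simp [add_comm]

theorem br_one_right (a : A) : M.br a 1 = 0 := by
  simpa using M.leib a 1 1

theorem br_one_left (a : A) : M.br 1 a = 0 := by
  rw [M.br_swap, br_one_right, neg_zero]

theorem br_algebraMap_right (a : A) (c : K) : M.br a (algebraMap K A c) = 0 := by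
  rw [Algebra.algebraMap_eq_smul_one, map_smul, br_one_right, smul_zero]

theorem br_algebraMap_left (a : A) (c : K) : M.br (algebraMap K A c) a = 0 := by
  rw [M.br_swap, br_algebraMap_right, neg_zero]

theorem br_ef : M.br (M.g 0) (M.g 2) = M.g 1 := M.triple.ef
theorem br_he : M.br (M.g 1) (M.g 0) = 2 * M.g 0 := M.triple.he
theorem br_hf : M.br (M.g 1) (M.g 2) = -2 * M.g 2 := M.triple.hf
theorem br_fe : M.br (M.g 2) (M.g 0) = -M.g 1 := by rw [M.br_swap, br_ef]
theorem br_eh : M.br (M.g 0) (M.g 1) = -(2 * M.g 0) := by rw [M.br_swap, br_he]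
theorem br_fh : M.br (M.g 2) (M.g 1) = 2 * M.g 2 := by rw [M.br_swap, br_hf]; simp

/-- The action `{a, ·}` as an additive map. -/
def ad (a : A) : A →+ A := (M.br a).toAddMonoidHom

theorem ad_apply (a b : A) : M.ad a b = M.br a b := rfl

theorem ad_mul (a b c : A) : M.ad a (b * c) = b * M.ad a c + M.ad a b * c := M.leib a b c

end SlModel

/-- The symbols `x²`, `2 * x * y`, `-y²` of `e`, `h`, `f`. -/
def symG : Fin 3 → Plane K := ![X 0 ^ 2, 2 * X 0 * X 1, -X 1 ^ 2]

/-- The exponents of the symbols of `e`, `h`, `f`. -/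
def expG : Fin 3 → (Fin 2 →₀ ℕ) :=
  ![Finsupp.single 0 2, Finsupp.single 0 1 + Finsupp.single 1 1, Finsupp.single 1 2]

/-- The exponent of the symbol of a word in `e`, `h`, `f`. -/
def expL (l : List (Fin 3)) : Fin 2 →₀ ℕ := (l.map expG).sum

/-- The symbol of a word in `e`, `h`, `f`. -/
def symL (l : List (Fin 3)) : Plane K := (l.map symG).prod

theorem wtm_add (ρ σ : ℤ) (d d' : Fin 2 →₀ ℕ) : wtm ρ σ (d + d') = wtm ρ σ d + wtm ρ σ d' := by
  simp only [wtm, Finsupp.add_apply, Nat.cast_add]; ring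

theorem expL_cons (i : Fin 3) (l : List (Fin 3)) : expL (i :: l) = expG i + expL l := by
  simp [expL]

theorem expL_append (l l' : List (Fin 3)) : expL (l ++ l') = expL l + expL l' := by
  simp [expL]

theorem symL_cons (i : Fin 3) (l : List (Fin 3)) :
    symL (K := K) (i :: l) = symG i * symL l := by
  simp [symL]

theorem symL_append (l l' : List (Fin 3)) : symL (K := K) (l ++ l') = symL l * symL l' := by
  simp [symL]

theorem symG_eq (i : Fin 3) : ∃ c : K, c ≠ 0 ∧ symG i = monomial (expG i) c := by
  fin_cases i
  · exact ⟨1, one_ne_zero, by simp [symG, expG, X_pow_eq_monomial]⟩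
  · refine ⟨2, two_ne_zero, ?_⟩
    have : (2 : Plane K) = C 2 := (map_ofNat C 2).symm
    simp [symG, expG, this, X, C_mul_monomial, monomial_mul]
  · exact ⟨-1, by simp, by simp [symG, expG, X_pow_eq_monomial]⟩

theorem symL_eq (l : List (Fin 3)) : ∃ c : K, c ≠ 0 ∧ symL l = monomial (expL l) c := by
  induction l with
  | nil => exact ⟨1, one_ne_zero, by simp [symL, expL]⟩
  | cons i l ih =>
    obtain ⟨c, hc, h⟩ := ih
    obtain ⟨c', hc', h'⟩ := symG_eq (K := K) i
    exact ⟨c' * c, mul_ne_zero hc' hc, by rw [symL_cons, h, h', expL_cons, monomial_mul]⟩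

theorem symG_mem (i : Fin 3) : symG (K := K) i ∈ evenPart K := by
  fin_cases i
  · exact X_zero_sq_mem
  · have : (2 : Plane K) = C 2 := (map_ofNat C 2).symm
    simp only [symG, Fin.mk_one, Matrix.cons_val_one, Matrix.cons_val_zero, this, mul_assoc]
    exact mul_mem (C_mem_evenPart _) X_zero_mul_mem
  · exact neg_mem X_one_sq_mem

theorem symL_mem (l : List (Fin 3)) : symL (K := K) l ∈ evenPart K := by
  induction l with
  | nil => exact one_mem _
  | cons i l ih => rw [symL_cons]; exact mul_mem (symG_mem i) ih

namespace SlModel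

/-- The product of a word in `e`, `h`, `f`. -/
def word (l : List (Fin 3)) : A := (l.map M.g).prod

theorem word_nil : M.word [] = 1 := rfl

theorem word_cons (i : Fin 3) (l : List (Fin 3)) : M.word (i :: l) = M.g i * M.word l := by
  simp [word]

theorem word_append (l l' : List (Fin 3)) : M.word (l ++ l') = M.word l * M.word l' := by
  simp [word]

/-- The symbol relation: pairs `(a, u)` with `a` of weight at most `n` and symbol `u` in weight
`n`, for the weights `ρ`, `σ` of `x`, `y`. -/
def symRel (ρ σ n : ℤ) : Submodule K (A × Plane K) :=
  Submodule.span K {p | ∃ l, wtm ρ σ (expL l) ≤ n ∧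
    p = (M.word l, if wtm ρ σ (expL l) = n then symL l else 0)}

/-- `a` has weight at most `n` with symbol `u`. -/
def IsSym (ρ σ n : ℤ) (a : A) (u : Plane K) : Prop := (a, u) ∈ M.symRel ρ σ n

variable {M} {ρ σ m n : ℤ} {a b : A} {u v : Plane K}

theorem isSym_word {l : List (Fin 3)} (h : wtm ρ σ (expL l) = n) :
    M.IsSym ρ σ n (M.word l) (symL l) :=
  Submodule.subset_span ⟨l, h.le, by rw [if_pos h]⟩

theorem isSym_word_of_lt {l : List (Fin 3)} (h : wtm ρ σ (expL l) < n) :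
    M.IsSym ρ σ n (M.word l) 0 :=
  Submodule.subset_span ⟨l, h.le, by rw [if_neg h.ne]⟩

theorem isSym_g (i : Fin 3) : M.IsSym ρ σ (wtm ρ σ (expG i)) (M.g i) (symG i) := by
  have := M.isSym_word (ρ := ρ) (σ := σ) (l := [i]) rfl
  simpa [word, symL, expL] using this

theorem isSym_zero : M.IsSym ρ σ n 0 0 := zero_mem _

theorem isSym_one : M.IsSym ρ σ 0 1 1 := by
  simpa [word, symL] using M.isSym_word (ρ := ρ) (σ := σ) (l := []) (n := 0) (by simp [expL, wtm])

theorem IsSym.add (ha : M.IsSym ρ σ n a u) (hb : M.IsSym ρ σ n b v) :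
    M.IsSym ρ σ n (a + b) (u + v) := add_mem (S := Submodule K (A × Plane K)) ha hb

theorem IsSym.sub (ha : M.IsSym ρ σ n a u) (hb : M.IsSym ρ σ n b v) :
    M.IsSym ρ σ n (a - b) (u - v) := sub_mem (S := Submodule K (A × Plane K)) ha hb

theorem IsSym.neg (ha : M.IsSym ρ σ n a u) : M.IsSym ρ σ n (-a) (-u) :=
  neg_mem (S := Submodule K (A × Plane K)) ha

theorem IsSym.smul (c : K) (ha : M.IsSym ρ σ n a u) : M.IsSym ρ σ n (c • a) (c • u) :=
  Submodule.smul_mem _ c ha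

/-- Induction principle for `IsSym`. -/
theorem IsSym.induct {P : A → Plane K → Prop}
    (hw : ∀ l, wtm ρ σ (expL l) = n → P (M.word l) (symL l))
    (hlt : ∀ l, wtm ρ σ (expL l) < n → P (M.word l) 0)
    (h0 : P 0 0) (hadd : ∀ a b u v, P a u → P b v → P (a + b) (u + v))
    (hsmul : ∀ (c : K) a u, P a u → P (c • a) (c • u)) (ha : M.IsSym ρ σ n a u) : P a u := by
  suffices h : ∀ p ∈ M.symRel ρ σ n, P p.1 p.2 from h _ ha
  intro p hp
  induction hp using Submodule.span_induction with
  | mem p hp =>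
    obtain ⟨l, hl, rfl⟩ := hp
    rcases hl.eq_or_lt with h | h
    · simpa [h] using hw l h
    · simpa [h.ne] using hlt l h
  | zero => exact h0
  | add p q _ _ hp hq => exact hadd _ _ _ _ hp hq
  | smul c p _ hp => exact hsmul _ _ _ hp

theorem IsSym.of_lt (ha : M.IsSym ρ σ n a u) (h : n < m) : M.IsSym ρ σ m a 0 := by
  refine IsSym.induct (P := fun a _ => M.IsSym ρ σ m a 0) ?_ ?_ isSym_zero ?_ ?_ ha
  · intro l hl; exact isSym_word_of_lt (by omega)
  · intro l hl; exact isSym_word_of_lt (by omega)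
  · intro a b _ _ ha hb; simpa using ha.add hb
  · intro c a _ ha; simpa using ha.smul c

theorem IsSym.mem_evenPart (ha : M.IsSym ρ σ n a u) : u ∈ evenPart K := by
  refine IsSym.induct (P := fun _ u => u ∈ evenPart K) (fun l _ => symL_mem l)
    (fun _ _ => zero_mem _) (zero_mem _) (fun _ _ _ _ => add_mem)
    (fun c _ _ h => Subalgebra.smul_mem _ h c) ha

theorem IsSym.isQH (ha : M.IsSym ρ σ n a u) : IsQH ρ σ n u := by
  refine IsSym.induct (P := fun _ u => IsQH ρ σ n u) ?_ ?_ ?_ ?_ ?_ ha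
  · intro l hl d hd
    obtain ⟨c, -, h⟩ := symL_eq (K := K) l
    rw [h, coeff_monomial] at hd
    rw [← hl]
    rw [ne_eq, ite_eq_right_iff, Classical.not_imp] at hd
    rw [hd.1]
  · intro l _ d hd; simp at hd
  · intro d hd; simp at hd
  · intro a b u v hu hv d hd
    rw [coeff_add] at hd
    by_cases h : coeff d u = 0
    · exact hv d (by simpa [h] using hd)
    · exact hu d h
  · intro c a u hu d hd
    rw [coeff_smul, smul_eq_mul] at hd
    exact hu d (right_ne_zero_of_mul hd)

theorem IsSym.mul (ha : M.IsSym ρ σ m a u) (hb : M.IsSym ρ σ n b v) :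
    M.IsSym ρ σ (m + n) (a * b) (u * v) := by
  have h1 : ∀ l, ∀ {n b v}, M.IsSym ρ σ n b v →
      M.IsSym ρ σ (wtm ρ σ (expL l) + n) (M.word l * b) (symL l * v) := by
    intro l n b v hb
    refine IsSym.induct (P := fun b v => M.IsSym ρ σ (wtm ρ σ (expL l) + n) (M.word l * b)
      (symL l * v)) ?_ ?_ (by simpa using isSym_zero) ?_ ?_ hb
    · intro l' hl'
      rw [← word_append, ← symL_append]
      exact isSym_word (by rw [expL_append, wtm_add, hl'])
    · intro l' hl'
      rw [← word_append, mul_zero]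
      exact isSym_word_of_lt (by rw [expL_append, wtm_add]; omega)
    · intro a b u v ha hb; rw [mul_add, mul_add]; exact ha.add hb
    · intro c a u ha; rw [mul_smul_comm, mul_smul_comm]; exact ha.smul c
  refine IsSym.induct (P := fun a u => M.IsSym ρ σ (m + n) (a * b) (u * v)) ?_ ?_
    (by simpa using isSym_zero) ?_ ?_ ha
  · intro l hl; rw [← hl]; exact h1 l hb
  · intro l hl; rw [zero_mul]; exact (h1 l hb).of_lt (by omega)
  · intro a b u v ha hb; rw [add_mul, add_mul]; exact ha.add hb
  · intro c a u ha; rw [smul_mul_assoc, smul_mul_assoc]; exact ha.smul c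

theorem IsSym.pow (ha : M.IsSym ρ σ m a u) (k : ℕ) : M.IsSym ρ σ (k * m) (a ^ k) (u ^ k) := by
  induction k with
  | zero => simpa using isSym_one
  | succ k ih =>
    rw [pow_succ, pow_succ]
    convert ih.mul ha using 1
    push_cast; ring

theorem isSym_algebraMap (c : K) : M.IsSym ρ σ 0 (algebraMap K A c) (C c) := by
  have := (isSym_one (M := M) (ρ := ρ) (σ := σ)).smul c
  rwa [← Algebra.algebraMap_eq_smul_one, smul_eq_C_mul, mul_one] at this

theorem ham_mul_left (u v w : Plane K) : ham (u * v) w = u * ham v w + ham u w * v := by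
  simp only [ham_apply, Derivation.leibniz, smul_eq_mul]; ring

theorem isSym_br_g (i j : Fin 3) : M.IsSym ρ σ (wtm ρ σ (expG i) + wtm ρ σ (expG j) - (ρ + σ))
    (M.br (M.g i) (M.g j)) (ham (symG i) (symG j)) := by
  have h2 : (C (2⁻¹ : K) : Plane K) * 2 = 1 := by
    rw [show (2 : Plane K) = C 2 from (map_ofNat C 2).symm, ← C_mul]; simp
  have key : ∀ {n m : ℤ} {a a' : A} {u u' : Plane K}, M.IsSym ρ σ n a u → n = m → a = a' →
      u = u' → M.IsSym ρ σ m a' u' := by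
    rintro n m a a' u u' h rfl rfl rfl; exact h
  have two : ∀ {n : ℤ} {a : A} {u : Plane K}, M.IsSym ρ σ n a u → M.IsSym ρ σ n (2 * a) (2 * u) :=
    fun h => by rw [two_mul, two_mul]; exact h.add h
  have w0 : wtm ρ σ (expG 0) = 2 * ρ := by simp [wtm, expG]; ring
  have w1 : wtm ρ σ (expG 1) = ρ + σ := by simp [wtm, expG]
  have w2 : wtm ρ σ (expG 2) = 2 * σ := by simp [wtm, expG]; ring
  have d0 : ∀ i, pderiv i (2 : Plane K) = 0 := fun i => by
    rw [show (2 : Plane K) = C 2 from (map_ofNat C 2).symm]; simp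
  have hd : ∀ i : Fin 3, (i = 0 ∨ i = 1 ∨ i = 2) := by decide
  rcases hd i with rfl | rfl | rfl <;> rcases hd j with rfl | rfl | rfl
  · rw [M.alt, ham_self]; exact isSym_zero
  · refine key (two (isSym_g 0)).neg ?_ M.br_eh.symm ?_
    · rw [w0, w1]; ring
    · simp [ham_apply, symG, Derivation.leibniz, Derivation.leibniz_pow, pderiv_X, d0]
      linear_combination (-2 * X 0 ^ 2 : Plane K) * h2
  · refine key (isSym_g 1) ?_ M.br_ef.symm ?_
    · rw [w0, w1, w2]; ring
    · simp [ham_apply, symG, Derivation.leibniz, Derivation.leibniz_pow, pderiv_X, d0]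
      linear_combination (-2 * X 0 * X 1 : Plane K) * h2
  · refine key (two (isSym_g 0)) ?_ M.br_he.symm ?_
    · rw [w0, w1]; ring
    · simp [ham_apply, symG, Derivation.leibniz, Derivation.leibniz_pow, pderiv_X, d0]
      linear_combination (-X 0 ^ 2 : Plane K) * h2
  · rw [M.alt, ham_self]; exact isSym_zero
  · refine key (two (isSym_g 2)).neg ?_ (by rw [M.br_hf]; simp) ?_
    · rw [w1, w2]; ring
    · simp [ham_apply, symG, Derivation.leibniz, Derivation.leibniz_pow, pderiv_X, d0]
      linear_combination (-2 * X 1 ^ 2 : Plane K) * h2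
  · refine key (isSym_g 1).neg ?_ M.br_fe.symm ?_
    · rw [w0, w1, w2]; ring
    · simp [ham_apply, symG, Derivation.leibniz, Derivation.leibniz_pow, pderiv_X, d0]
      linear_combination (-2 * X 0 * X 1 : Plane K) * h2
  · refine key (two (isSym_g 2)) ?_ M.br_fh.symm ?_
    · rw [w1, w2]; ring
    · simp [ham_apply, symG, Derivation.leibniz, Derivation.leibniz_pow, pderiv_X, d0]
      linear_combination (-2 * X 1 ^ 2 : Plane K) * h2
  · rw [M.alt, ham_self]; exact isSym_zero

theorem IsSym.br (ha : M.IsSym ρ σ m a u) (hb : M.IsSym ρ σ n b v) :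
    M.IsSym ρ σ (m + n - (ρ + σ)) (M.br a b) (ham u v) := by
  have h1 : ∀ i l, M.IsSym ρ σ (wtm ρ σ (expG i) + wtm ρ σ (expL l) - (ρ + σ))
      (M.br (M.g i) (M.word l)) (ham (symG i) (symL l)) := by
    intro i l
    induction l with
    | nil => simpa [word_nil, br_one_right, symL] using isSym_zero
    | cons j l ih =>
      rw [word_cons, symL_cons, M.leib, Derivation.leibniz, smul_eq_mul, smul_eq_mul,
        mul_comm (symL l), expL_cons, wtm_add]
      refine IsSym.add ?_ ?_
      · convert (isSym_g j).mul ih using 1; ring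
      · convert (isSym_br_g i j).mul (isSym_word rfl) using 1; ring
  have h2 : ∀ l' l, M.IsSym ρ σ (wtm ρ σ (expL l') + wtm ρ σ (expL l) - (ρ + σ))
      (M.br (M.word l') (M.word l)) (ham (symL l') (symL l)) := by
    intro l' l
    induction l' with
    | nil =>
      have : ham (K := K) 1 = 0 := by ext i; simp [ham_apply]
      simpa [word_nil, br_one_left, symL, this] using isSym_zero
    | cons j l' ih =>
      rw [word_cons, symL_cons, M.leib_left, ham_mul_left, expL_cons, wtm_add]
      refine IsSym.add ?_ ?_
      · convert (isSym_g j).mul ih using 1; ring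
      · convert (h1 j l).mul (isSym_word rfl) using 1; ring
  have hz : ∀ w, ham (K := K) 0 w = 0 := fun w => by simp [ham_apply]
  have hadd : ∀ u v w : Plane K, ham (u + v) w = ham u w + ham v w := fun u v w => by
    simp only [ham_apply, map_add]; ring
  have hsmul : ∀ (c : K) (v w : Plane K), ham (c • v) w = c • ham v w := fun u v w => by
    rw [ham_apply, ham_apply, Derivation.map_smul, Derivation.map_smul]
    simp only [smul_eq_C_mul]; ring
  have h3 : ∀ l, M.IsSym ρ σ (wtm ρ σ (expL l) + n - (ρ + σ))
      (M.br (M.word l) b) (ham (symL l) v) := by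
    intro l
    refine IsSym.induct (P := fun b v => M.IsSym ρ σ (wtm ρ σ (expL l) + n - (ρ + σ))
      (M.br (M.word l) b) (ham (symL l) v)) ?_ ?_ (by simpa using isSym_zero) ?_ ?_ hb
    · intro l' hl'; rw [← hl']; exact h2 l l'
    · intro l' hl'; rw [map_zero]; exact (h2 l l').of_lt (by omega)
    · intro a b u v ha hb; rw [map_add, map_add]; exact ha.add hb
    · intro c a u ha; rw [map_smul, Derivation.map_smul]; exact ha.smul c
  refine IsSym.induct (P := fun a u => M.IsSym ρ σ (m + n - (ρ + σ)) (M.br a b) (ham u v)) ?_ ?_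
    (by rw [map_zero, LinearMap.zero_apply, hz]; exact isSym_zero) ?_ ?_ ha
  · intro l hl; rw [← hl]; exact h3 l
  · intro l hl; rw [hz]; exact (h3 l).of_lt (by omega)
  · intro a b u v ha hb; rw [map_add, LinearMap.add_apply, hadd]; exact ha.add hb
  · intro c a u ha; rw [map_smul, LinearMap.smul_apply, hsmul]; exact ha.smul c

end SlModel

end Model

section Symbols

variable {A : Type*} [Ring A] [Algebra K A] {M : SlModel K lam A}
variable {ρ σ m n : ℤ} {a b : A} {u v : Plane K}

variable (K) in
/-- Polynomials of weight at most `n`. -/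
def weightLE (ρ σ n : ℤ) : Submodule K (Plane K) where
  carrier := {u | ∀ d, coeff d u ≠ 0 → wtm ρ σ d ≤ n}
  add_mem' := by
    intro u v hu hv d hd
    rw [coeff_add] at hd
    by_cases h : coeff d u = 0
    · exact hv d (by simpa [h] using hd)
    · exact hu d h
  zero_mem' := fun d hd => by simp at hd
  smul_mem' := by
    intro c u hu d hd
    rw [coeff_smul, smul_eq_mul] at hd
    exact hu d (right_ne_zero_of_mul hd)

theorem weightLE_mono (h : m ≤ n) : weightLE K ρ σ m ≤ weightLE K ρ σ n :=
  fun _ hu d hd => (hu d hd).trans h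

theorem monomial_mem_weightLE {d : Fin 2 →₀ ℕ} (h : wtm ρ σ d ≤ n) (c : K) :
    monomial d c ∈ weightLE K ρ σ n := by
  intro d' hd'
  rw [coeff_monomial, ne_eq, ite_eq_right_iff, Classical.not_imp] at hd'
  rwa [← hd'.1]

theorem weightLE_induct {P : Plane K → Prop} (hm : ∀ d c, wtm ρ σ d ≤ n → P (monomial d c))
    (h0 : P 0) (hadd : ∀ u v, P u → P v → P (u + v)) (hu : u ∈ weightLE K ρ σ n) : P u := by
  rw [u.as_sum]
  exact Finset.sum_induction _ _ hadd h0 fun d hd => hm _ _ (hu d (mem_support_iff.1 hd))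

theorem mul_mem_weightLE (hu : u ∈ weightLE K ρ σ m) (hv : v ∈ weightLE K ρ σ n) :
    u * v ∈ weightLE K ρ σ (m + n) := by
  refine weightLE_induct (P := fun u => u * v ∈ _) (fun d c hd => ?_) (by simp) ?_ hu
  · refine weightLE_induct (P := fun v => _ * v ∈ _) (fun d' c' hd' => ?_) (by simp) ?_ hv
    · rw [monomial_mul]
      exact monomial_mem_weightLE (by rw [wtm_add]; omega) _
    · intro u v hu hv; rw [mul_add]; exact add_mem hu hv
  · intro u v hu hv; rw [add_mul]; exact add_mem hu hv

theorem pderiv_zero_mem_weightLE (hu : u ∈ weightLE K ρ σ n) :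
    pderiv 0 u ∈ weightLE K ρ σ (n - ρ) := by
  refine weightLE_induct (P := fun u => pderiv 0 u ∈ _) (fun d c hd => ?_) (by simp) ?_ hu
  · rw [pderiv_monomial]
    by_cases h : d 0 = 0
    · simp [h]
    · refine monomial_mem_weightLE ?_ _
      unfold wtm at hd ⊢
      simp only [Finsupp.tsub_apply, Finsupp.single_eq_same, ne_eq, one_ne_zero,
        not_false_eq_true, Finsupp.single_eq_of_ne, tsub_zero]
      rw [Nat.cast_sub (by omega)]
      push_cast
      linarith
  · intro u v hu hv; rw [map_add]; exact add_mem hu hv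

variable (K) in
/-- The substitution `x ↦ qs`, `y ↦ s`. -/
def blowUp : Plane K →ₐ[K] Plane K := aeval ![X 0 * X 1, X 1]

/-- The effect of `blowUp` on exponents. -/
def blowUpExp (d : Fin 2 →₀ ℕ) : Fin 2 →₀ ℕ :=
  Finsupp.single 0 (d 0) + Finsupp.single 1 (d 0 + d 1)

theorem blowUp_monomial (d : Fin 2 →₀ ℕ) (c : K) :
    blowUp K (monomial d c) = monomial (blowUpExp d) c := by
  rw [blowUp, aeval_monomial, Finsupp.prod_fintype _ _ (by simp), Fin.prod_univ_two,
    monomial_eq, Finsupp.prod_fintype _ _ (by simp), Fin.prod_univ_two]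
  simp [blowUpExp, mul_pow, pow_add, mul_assoc, algebraMap_eq]

theorem blowUpExp_injective : Function.Injective blowUpExp := by
  intro d d' h
  have h0 := DFunLike.congr_fun h 0
  have h1 := DFunLike.congr_fun h 1
  simp [blowUpExp] at h0 h1
  ext i; fin_cases i
  · exact h0
  · simp; omega

theorem coeff_blowUp (d : Fin 2 →₀ ℕ) (u : Plane K) :
    coeff (blowUpExp d) (blowUp K u) = coeff d u := by
  induction u using MvPolynomial.induction_on' with
  | monomial e c =>
    rw [blowUp_monomial, coeff_monomial, coeff_monomial]
    simp only [blowUpExp_injective.eq_iff]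
  | add p q hp hq => simp [hp, hq]

theorem wtm_blowUpExp (d : Fin 2 →₀ ℕ) : wtm (ρ - σ) σ (blowUpExp d) = wtm ρ σ d := by
  simp [wtm, blowUpExp]; ring

theorem blowUp_mem_weightLE (hu : u ∈ weightLE K ρ σ n) :
    blowUp K u ∈ weightLE K (ρ - σ) σ n := by
  refine weightLE_induct (P := fun u => blowUp K u ∈ _) (fun d c hd => ?_) (by simp) ?_ hu
  · rw [blowUp_monomial]
    exact monomial_mem_weightLE (by rwa [wtm_blowUpExp]) _
  · intro u v hu hv; rw [map_add]; exact add_mem hu hv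

namespace SlModel

theorem op_g_sub_mem (h : 0 < ρ + σ) (i : Fin 3) (hu : u ∈ weightLE K (ρ - σ) σ n) :
    M.op (M.g i) u - blowUp K (symG i) * u ∈
      weightLE K (ρ - σ) σ (wtm ρ σ (expG i) + n - 1) := by
  have hq : (X 0 : Plane K) ∈ weightLE K (ρ - σ) σ (ρ - σ) :=
    monomial_mem_weightLE (by simp [wtm]) _
  have hC : ∀ c : K, (C c : Plane K) ∈ weightLE K (ρ - σ) σ 0 := fun c =>
    monomial_mem_weightLE (by simp [wtm]) _
  have hd := pderiv_zero_mem_weightLE hu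
  have w0 : wtm ρ σ (expG 0) = 2 * ρ := by simp [wtm, expG]; ring
  have w1 : wtm ρ σ (expG 1) = ρ + σ := by simp [wtm, expG]
  have w2 : wtm ρ σ (expG 2) = 2 * σ := by simp [wtm, expG]; ring
  have hi : ∀ i : Fin 3, (i = 0 ∨ i = 1 ∨ i = 2) := by decide
  rcases hi i with rfl | rfl | rfl
  · rw [w0]
    have h1 : M.op (M.g 0) u - blowUp K (symG 0) * u =
        C M.eps * (X 0 * X 0) * pderiv 0 u + C M.kap * X 0 * u := by
      rw [M.op_zero]; simp [blowUp, symG]; ring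
    rw [h1]
    exact add_mem
      (weightLE_mono (by omega) (mul_mem_weightLE (mul_mem_weightLE (hC _)
        (mul_mem_weightLE hq hq)) hd))
      (weightLE_mono (by omega) (mul_mem_weightLE (mul_mem_weightLE (hC _) hq) hu))
  · rw [w1]
    have h1 : M.op (M.g 1) u - blowUp K (symG 1) * u =
        C (2 * M.eps) * X 0 * pderiv 0 u + C M.kap * u := by
      have h2 : blowUp K (symG 1) = 2 * (X 0 * X 1) * X 1 := by
        simp only [symG, Matrix.cons_val_one, Matrix.cons_val_zero, map_mul, map_ofNat]
        simp [blowUp]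
      rw [M.op_one, h2]; ring
    rw [h1]
    exact add_mem
      (weightLE_mono (by omega) (mul_mem_weightLE (mul_mem_weightLE (hC _) hq) hd))
      (weightLE_mono (by omega) (mul_mem_weightLE (hC _) hu))
  · rw [w2]
    have h1 : M.op (M.g 2) u - blowUp K (symG 2) * u = -(C M.eps * pderiv 0 u) := by
      rw [M.op_two]; simp [blowUp, symG]
    rw [h1]
    exact neg_mem (weightLE_mono (by omega) (mul_mem_weightLE (hC _) hd))

theorem symL_mem_weightLE {l : List (Fin 3)} (h : wtm ρ σ (expL l) ≤ n) :
    symL l ∈ weightLE K ρ σ n := by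
  obtain ⟨c, -, hc⟩ := symL_eq (K := K) l
  rw [hc]
  exact monomial_mem_weightLE h _

theorem op_word_sub_mem (h : 0 < ρ + σ) (l : List (Fin 3)) :
    M.op (M.word l) 1 - blowUp K (symL l) ∈
      weightLE K (ρ - σ) σ (wtm ρ σ (expL l) - 1) := by
  induction l with
  | nil => simp [word_nil, symL]
  | cons i l ih =>
    have h1 : M.op (M.word l) 1 ∈ weightLE K (ρ - σ) σ (wtm ρ σ (expL l)) := by
      have h2 := add_mem (weightLE_mono (by omega) ih)
        (blowUp_mem_weightLE (symL_mem_weightLE (K := K) (le_refl (wtm ρ σ (expL l)))))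
      simpa using h2
    have h2 := op_g_sub_mem (M := M) h i h1
    have h3 := mul_mem_weightLE (blowUp_mem_weightLE
      (symL_mem_weightLE (K := K) (l := [i]) (le_refl (wtm ρ σ (expL [i]))))) ih
    have h4 : M.op (M.word (i :: l)) 1 - blowUp K (symL (i :: l)) =
        (M.op (M.g i) (M.op (M.word l) 1) - blowUp K (symG i) * M.op (M.word l) 1) +
        blowUp K (symL [i]) * (M.op (M.word l) 1 - blowUp K (symL l)) := by
      rw [word_cons, map_mul, Module.End.mul_apply, symL_cons, map_mul]
      simp only [symL, List.map_cons, List.map_nil, List.prod_cons, List.prod_nil, mul_one]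
      ring
    rw [h4, expL_cons, wtm_add]
    refine add_mem (weightLE_mono (by omega) h2) (weightLE_mono ?_ h3)
    simp only [expL, List.map_cons, List.map_nil, List.sum_cons, List.sum_nil, add_zero]
    omega

theorem IsSym.op_sub_mem (h : 0 < ρ + σ) (ha : M.IsSym ρ σ n a u) :
    M.op a 1 - blowUp K u ∈ weightLE K (ρ - σ) σ (n - 1) := by
  refine IsSym.induct (P := fun a u => M.op a 1 - blowUp K u ∈ weightLE K (ρ - σ) σ (n - 1))
    ?_ ?_ (by simp) ?_ ?_ ha
  · rintro l rfl; exact op_word_sub_mem h l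
  · intro l hl
    rw [map_zero, sub_zero]
    have h2 := add_mem (weightLE_mono (by omega) (op_word_sub_mem (M := M) h l))
        (blowUp_mem_weightLE (symL_mem_weightLE (K := K) (l := l) (n := n - 1) (by omega)))
    simpa using h2
  · intro a b u v ha hb
    have := add_mem ha hb
    rw [map_add, map_add, LinearMap.add_apply]
    convert this using 1; ring
  · intro c a u ha
    have := Submodule.smul_mem _ c ha
    rw [map_smul, map_smul, LinearMap.smul_apply, ← smul_sub]
    exact this

theorem IsSym.eq_zero (h : 0 < ρ + σ) (ha : M.IsSym ρ σ n 0 u) : u = 0 := by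
  have h1 := ha.op_sub_mem h
  rw [map_zero, LinearMap.zero_apply, zero_sub] at h1
  have h1 := neg_mem h1
  rw [neg_neg] at h1
  ext d
  by_contra hd
  have h2 := h1 (blowUpExp d) (by rwa [coeff_blowUp])
  rw [wtm_blowUpExp, ha.isQH d hd] at h2
  omega

theorem IsSym.unique (h : 0 < ρ + σ) (ha : M.IsSym ρ σ n a u) (hb : M.IsSym ρ σ n a v) :
    u = v := by
  have := ha.sub hb
  rw [sub_self] at this
  exact sub_eq_zero.1 (this.eq_zero h)

theorem IsSym.map {φ : A →ₐ[K] A} {ψ : Plane K →ₐ[K] Plane K}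
    (hφ : ∀ i, M.IsSym ρ σ (wtm ρ σ (expG i)) (φ (M.g i)) (ψ (symG i)))
    (ha : M.IsSym ρ σ n a u) : M.IsSym ρ σ n (φ a) (ψ u) := by
  have hw : ∀ l, M.IsSym ρ σ (wtm ρ σ (expL l)) (φ (M.word l)) (ψ (symL l)) := by
    intro l
    induction l with
    | nil => simpa [word_nil, symL, expL, wtm] using isSym_one
    | cons i l ih =>
      rw [word_cons, symL_cons, map_mul, map_mul, expL_cons, wtm_add]
      exact (hφ i).mul ih
  refine IsSym.induct (P := fun a u => M.IsSym ρ σ n (φ a) (ψ u)) ?_ ?_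
    (by simpa using isSym_zero) ?_ ?_ ha
  · rintro l rfl; exact hw l
  · intro l hl; rw [map_zero]; exact (hw l).of_lt hl
  · intro a b u v ha hb; rw [map_add, map_add]; exact ha.add hb
  · intro c a u ha; rw [map_smul, map_smul]; exact ha.smul c

end SlModel

variable (K) in
/-- The component of weight `n`. -/
def wcomp (ρ σ n : ℤ) : Plane K →ₗ[K] Plane K := weightedHomogeneousComponent ![ρ, σ] n

theorem coeff_wcomp (ρ σ n : ℤ) (d : Fin 2 →₀ ℕ) (u : Plane K) :
    coeff d (wcomp K ρ σ n u) = if wtm ρ σ d = n then coeff d u else 0 := by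
  classical
  rw [wcomp, coeff_weightedHomogeneousComponent]
  have : Finsupp.weight ![ρ, σ] d = wtm ρ σ d := by
    rw [Finsupp.weight_apply, Finsupp.sum_fintype _ _ (by simp)]
    simp [Fin.sum_univ_two, wtm, mul_comm]
  rw [this]

theorem wcomp_monomial (ρ σ n : ℤ) (d : Fin 2 →₀ ℕ) (c : K) :
    wcomp K ρ σ n (monomial d c) = if wtm ρ σ d = n then monomial d c else 0 := by
  ext d'
  rw [coeff_wcomp]
  by_cases h : d = d'
  · subst h; split_ifs <;> simp
  · split_ifs <;> simp [coeff_monomial, h]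

theorem SlModel.IsSym.change {ρ' σ' n' : ℤ} (hle : ∀ d, wtm ρ σ d ≤ n → wtm ρ' σ' d ≤ n')
    (hlt : ∀ d, wtm ρ σ d < n → wtm ρ' σ' d < n') (ha : M.IsSym ρ σ n a u) :
    M.IsSym ρ' σ' n' a (wcomp K ρ' σ' n' u) := by
  refine IsSym.induct (P := fun a u => M.IsSym ρ' σ' n' a (wcomp K ρ' σ' n' u)) ?_ ?_
    (by simpa using isSym_zero) ?_ ?_ ha
  · intro l hl
    obtain ⟨c, hc, hl'⟩ := symL_eq (K := K) l
    rw [hl', wcomp_monomial]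
    rcases (hle _ hl.le).eq_or_lt with h | h
    · rw [if_pos h, ← hl']; exact isSym_word h
    · rw [if_neg h.ne]; exact isSym_word_of_lt h
  · intro l hl; rw [map_zero]; exact isSym_word_of_lt (hlt _ hl)
  · intro a b u v ha hb; rw [map_add]; exact ha.add hb
  · intro c a u ha; rw [map_smul]; exact ha.smul c

end Symbols

section EvenSymbols

variable {A : Type*} [Ring A] [Algebra K A] {M : SlModel K lam A}
variable {ρ σ m n : ℤ} {a b : A} {u v : Plane K}

/-- The monomials of `u` have even total degree. -/
def EvenSupp (u : Plane K) : Prop := ∀ d, coeff d u ≠ 0 → d 0 % 2 = d 1 % 2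

theorem EvenSupp.add (hu : EvenSupp u) (hv : EvenSupp v) : EvenSupp (u + v) := by
  intro d hd
  rw [coeff_add] at hd
  by_cases h : coeff d u = 0
  · exact hv d (by simpa [h] using hd)
  · exact hu d h

theorem EvenSupp.smul (c : K) (hu : EvenSupp u) : EvenSupp (c • u) := by
  intro d hd
  rw [coeff_smul, smul_eq_mul] at hd
  exact hu d (right_ne_zero_of_mul hd)

theorem evenSupp_zero : EvenSupp (0 : Plane K) := fun d hd => by simp at hd

theorem expL_parity (l : List (Fin 3)) : expL l 0 % 2 = expL l 1 % 2 := by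
  induction l with
  | nil => simp [expL]
  | cons i l ih =>
    rw [expL_cons]
    have hi : ∀ i : Fin 3, (i = 0 ∨ i = 1 ∨ i = 2) := by decide
    rcases hi i with rfl | rfl | rfl <;> simp [expG] <;> omega

theorem evenSupp_symL (l : List (Fin 3)) : EvenSupp (symL (K := K) l) := by
  intro d hd
  obtain ⟨c, -, h⟩ := symL_eq (K := K) l
  rw [h, coeff_monomial, ne_eq, ite_eq_right_iff, Classical.not_imp] at hd
  rw [← hd.1]
  exact expL_parity l

variable (K) in
/-- The coefficient of the symbol of the standard monomial with exponent `d`. -/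
def stdCoeff (d : Fin 2 →₀ ℕ) : K := 2 ^ (d 0 % 2) * (-1) ^ (d 1 / 2)

theorem stdCoeff_ne_zero (d : Fin 2 →₀ ℕ) : stdCoeff K d ≠ 0 := by
  simp [stdCoeff]

namespace SlModel

theorem IsSym.evenSupp (ha : M.IsSym ρ σ n a u) : EvenSupp u :=
  IsSym.induct (P := fun _ u => EvenSupp u) (fun l _ => evenSupp_symL l)
    (fun _ _ => evenSupp_zero) evenSupp_zero (fun _ _ _ _ => EvenSupp.add)
    (fun c _ _ h => h.smul c) ha

/-- `a` has weight at most `n`. -/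
def IsLow (M : SlModel K lam A) (ρ σ n : ℤ) (a : A) : Prop := ∃ u, M.IsSym ρ σ n a u

theorem IsSym.isLow (ha : M.IsSym ρ σ n a u) : M.IsLow ρ σ n a := ⟨u, ha⟩

theorem IsLow.add (ha : M.IsLow ρ σ n a) (hb : M.IsLow ρ σ n b) : M.IsLow ρ σ n (a + b) :=
  ⟨_, ha.choose_spec.add hb.choose_spec⟩

theorem IsLow.smul (c : K) (ha : M.IsLow ρ σ n a) : M.IsLow ρ σ n (c • a) :=
  ⟨_, ha.choose_spec.smul c⟩

theorem IsLow.mul (ha : M.IsLow ρ σ m a) (hb : M.IsLow ρ σ n b) : M.IsLow ρ σ (m + n) (a * b) :=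
  ⟨_, ha.choose_spec.mul hb.choose_spec⟩

theorem IsLow.pow (ha : M.IsLow ρ σ m a) (k : ℕ) : M.IsLow ρ σ (k * m) (a ^ k) :=
  ⟨_, ha.choose_spec.pow k⟩

theorem IsLow.mono (ha : M.IsLow ρ σ m a) (h : m ≤ n) : M.IsLow ρ σ n a := by
  rcases h.eq_or_lt with rfl | h
  · exact ha
  · exact ⟨0, ha.choose_spec.of_lt h⟩

theorem IsLow.comm (h : 0 < ρ + σ) (ha : M.IsLow ρ σ m a) (hb : M.IsLow ρ σ n b) :
    M.IsLow ρ σ (m + n - 1) (a * b - b * a) := by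
  rw [M.comm]
  exact (IsSym.isLow ((ha.choose_spec.br hb.choose_spec).smul M.eps)).mono (by omega)

theorem isLow_zero : M.IsLow ρ σ n 0 := ⟨0, isSym_zero⟩

variable (M) in
/-- The standard monomial `eⁱ hᵇ fʲ` whose symbol has exponent `d`. -/
def stdMon (d : Fin 2 →₀ ℕ) : A := M.g 0 ^ (d 0 / 2) * M.g 1 ^ (d 0 % 2) * M.g 2 ^ (d 1 / 2)

theorem isSym_stdMon {d : Fin 2 →₀ ℕ} (hd : d 0 % 2 = d 1 % 2) :
    M.IsSym ρ σ (wtm ρ σ d) (M.stdMon d) (monomial d (stdCoeff K d)) := by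
  have h := (((M.isSym_g (ρ := ρ) (σ := σ) 0).pow (d 0 / 2)).mul
    ((M.isSym_g 1).pow (d 0 % 2))).mul ((M.isSym_g 2).pow (d 1 / 2))
  have e0 := Nat.div_add_mod (d 0) 2
  have e1 := Nat.div_add_mod (d 1) 2
  have w : ((d 0 / 2 : ℕ) : ℤ) * wtm ρ σ (expG 0) + ((d 0 % 2 : ℕ) : ℤ) * wtm ρ σ (expG 1) +
      ((d 1 / 2 : ℕ) : ℤ) * wtm ρ σ (expG 2) = wtm ρ σ d := by
    have c0 : (2 : ℤ) * (d 0 / 2 : ℕ) + (d 0 % 2 : ℕ) = d 0 := by exact_mod_cast e0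
    have c1 : (2 : ℤ) * (d 1 / 2 : ℕ) + (d 0 % 2 : ℕ) = d 1 := by rw [hd]; exact_mod_cast e1
    have w0 : wtm ρ σ (expG 0) = 2 * ρ := by simp [wtm, expG]; ring
    have w1 : wtm ρ σ (expG 1) = ρ + σ := by simp [wtm, expG]
    have w2 : wtm ρ σ (expG 2) = 2 * σ := by simp [wtm, expG]; ring
    rw [w0, w1, w2, wtm]
    linear_combination ρ * c0 + σ * c1
  have s : symG (K := K) 0 ^ (d 0 / 2) * symG 1 ^ (d 0 % 2) * symG 2 ^ (d 1 / 2) =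
      monomial d (stdCoeff K d) := by
    rw [monomial_eq, Finsupp.prod_fintype _ _ (by simp), Fin.prod_univ_two, stdCoeff]
    have x0 : (X 0 : Plane K) ^ d 0 = (X 0 ^ 2) ^ (d 0 / 2) * X 0 ^ (d 0 % 2) := by
      rw [← pow_mul, ← pow_add, e0]
    have x1 : (X 1 : Plane K) ^ d 1 = (X 1 ^ 2) ^ (d 1 / 2) * X 1 ^ (d 0 % 2) := by
      rw [← pow_mul, ← pow_add, hd, e1]
    rw [x0, x1]
    have h2 : (C 2 : Plane K) = 2 := map_ofNat C 2
    simp only [symG, Matrix.cons_val_zero, Matrix.cons_val_one, Matrix.cons_val, map_mul, map_pow,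
      mul_pow, h2, C_neg, C_1]
    rw [neg_pow (X 1 ^ 2 : Plane K)]
    ring
  rw [w, s] at h
  exact h

theorem stdMon_zero : M.stdMon 0 = 1 := by simp [stdMon]

theorem h_sq_add : M.IsLow ρ σ (2 * (ρ + σ) - 1) (M.g 1 ^ 2 + (4 : K) • (M.g 0 * M.g 2)) ∨
    ρ + σ ≤ 0 := by
  by_cases h : 0 < ρ + σ
  · left
    have h1 : M.g 1 ^ 2 + (4 : K) • (M.g 0 * M.g 2) =
        algebraMap K A lam + (2 * M.eps) • M.g 1 := by
      have hc := M.triple.casimir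
      have he := M.comm (M.g 0) (M.g 2)
      rw [M.br_ef] at he
      have e4 : ∀ x : A, (4 : K) • x = x + x + x + x := fun x => by module
      rw [mul_smul, ← he, ← hc, e4, two_smul]
      noncomm_ring
    rw [h1]
    have w1 : wtm ρ σ (expG 1) = ρ + σ := by simp [wtm, expG]
    have := (M.isSym_g (ρ := ρ) (σ := σ) 1).isLow
    rw [w1] at this
    exact ((isSym_algebraMap lam).isLow.mono (by omega)).add ((this.smul _).mono (by omega))
  · exact Or.inr (by omega)

/-- Every word is a multiple of a standard monomial up to lower weight. -/
theorem exists_word_sub_isLow (h : 0 < ρ + σ) (l : List (Fin 3)) :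
    ∃ c : K, M.IsLow ρ σ (wtm ρ σ (expL l) - 1) (M.word l - c • M.stdMon (expL l)) := by
  have w0 : wtm ρ σ (expG 0) = 2 * ρ := by simp [wtm, expG]; ring
  have w1 : wtm ρ σ (expG 1) = ρ + σ := by simp [wtm, expG]
  have w2 : wtm ρ σ (expG 2) = 2 * σ := by simp [wtm, expG]; ring
  have g0 := (M.isSym_g (ρ := ρ) (σ := σ) 0).isLow
  have g1 := (M.isSym_g (ρ := ρ) (σ := σ) 1).isLow
  have g2 := (M.isSym_g (ρ := ρ) (σ := σ) 2).isLow
  rw [w0] at g0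
  rw [w1] at g1
  rw [w2] at g2
  have step : ∀ (i : Fin 3) (d : Fin 2 →₀ ℕ), d 0 % 2 = d 1 % 2 →
      ∃ c : K, M.IsLow ρ σ (wtm ρ σ (expG i + d) - 1)
        (M.g i * M.stdMon d - c • M.stdMon (expG i + d)) := by
    intro i d hd
    rw [wtm_add]
    have hwd : wtm ρ σ d = (d 0 / 2 : ℕ) * (2 * ρ) + (d 0 % 2 : ℕ) * (ρ + σ) +
        (d 1 / 2 : ℕ) * (2 * σ) := by
      have c0 : (2 : ℤ) * (d 0 / 2 : ℕ) + (d 0 % 2 : ℕ) = d 0 := by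
        exact_mod_cast Nat.div_add_mod (d 0) 2
      have c1 : (2 : ℤ) * (d 1 / 2 : ℕ) + (d 0 % 2 : ℕ) = d 1 := by
        rw [hd]; exact_mod_cast Nat.div_add_mod (d 1) 2
      rw [wtm]
      linear_combination -ρ * c0 - σ * c1
    have hi : ∀ i : Fin 3, (i = 0 ∨ i = 1 ∨ i = 2) := by decide
    rcases hi i with rfl | rfl | rfl
    · refine ⟨1, ?_⟩
      have : M.g 0 * M.stdMon d = M.stdMon (expG 0 + d) := by
        have a0 : (2 + d 0) / 2 = d 0 / 2 + 1 := by omega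
        have a1 : (2 + d 0) % 2 = d 0 % 2 := by omega
        simp [stdMon, expG, a0, a1, pow_succ', mul_assoc]
      rw [this, one_smul, sub_self]
      exact isLow_zero
    · rw [w1]
      rcases Nat.mod_two_eq_zero_or_one (d 0) with hp | hp
      · refine ⟨1, ?_⟩
        have : M.g 1 * M.stdMon d - (1 : K) • M.stdMon (expG 1 + d) =
            (M.g 1 * M.g 0 ^ (d 0 / 2) - M.g 0 ^ (d 0 / 2) * M.g 1) * M.g 2 ^ (d 1 / 2) := by
          have a0 : (1 + d 0) / 2 = d 0 / 2 := by omega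
          have a1 : (1 + d 0) % 2 = 1 := by omega
          have a2 : (1 + d 1) / 2 = d 1 / 2 := by omega
          simp [stdMon, expG, a0, a1, a2, hp, sub_mul, mul_assoc]
        rw [this, hwd, hp]
        exact ((IsLow.comm h g1 (g0.pow _)).mul (g2.pow _)).mono (by push_cast; linarith)
      · refine ⟨-4, ?_⟩
        have : M.g 1 * M.stdMon d - (-4 : K) • M.stdMon (expG 1 + d) =
            (M.g 1 * M.g 0 ^ (d 0 / 2) - M.g 0 ^ (d 0 / 2) * M.g 1) * M.g 1 * M.g 2 ^ (d 1 / 2) +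
            M.g 0 ^ (d 0 / 2) * (M.g 1 ^ 2 + (4 : K) • (M.g 0 * M.g 2)) * M.g 2 ^ (d 1 / 2) := by
          have a0 : (1 + d 0) / 2 = d 0 / 2 + 1 := by omega
          have a1 : (1 + d 0) % 2 = 0 := by omega
          have a2 : (1 + d 1) / 2 = d 1 / 2 + 1 := by omega
          simp [stdMon, expG, a0, a1, a2, hp, sub_mul, mul_assoc, mul_add, add_mul, pow_succ]
          rw [← pow_succ', ← pow_succ]
          abel
        rw [this, hwd, hp]
        have hs := (h_sq_add (M := M) (ρ := ρ) (σ := σ)).resolve_right (by omega)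
        exact ((((IsLow.comm h g1 (g0.pow _)).mul g1).mul (g2.pow _)).mono
          (by push_cast; linarith)).add
          ((((g0.pow _).mul hs).mul (g2.pow _)).mono (by push_cast; linarith))
    · refine ⟨1, ?_⟩
      rw [w2, hwd]
      have : M.g 2 * M.stdMon d - (1 : K) • M.stdMon (expG 2 + d) =
          (M.g 2 * (M.g 0 ^ (d 0 / 2) * M.g 1 ^ (d 0 % 2)) -
            (M.g 0 ^ (d 0 / 2) * M.g 1 ^ (d 0 % 2)) * M.g 2) * M.g 2 ^ (d 1 / 2) := by
        have a0 : (2 + d 1) / 2 = d 1 / 2 + 1 := by omega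
        simp [stdMon, expG, a0, sub_mul, mul_assoc, pow_succ']
      rw [this]
      exact ((IsLow.comm h g2 ((g0.pow _).mul (g1.pow _))).mul (g2.pow _)).mono (by linarith)
  induction l with
  | nil => exact ⟨1, by simpa [word_nil, expL, stdMon_zero] using isLow_zero⟩
  | cons i l ih =>
    obtain ⟨c, hc⟩ := ih
    obtain ⟨c', hc'⟩ := step i (expL l) (expL_parity l)
    refine ⟨c * c', ?_⟩
    rw [expL_cons]
    have e : M.word (i :: l) - (c * c') • M.stdMon (expG i + expL l) =
        M.g i * (M.word l - c • M.stdMon (expL l)) +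
        c • (M.g i * M.stdMon (expL l) - c' • M.stdMon (expG i + expL l)) := by
      rw [word_cons, mul_sub, smul_sub, mul_smul_comm, mul_smul]; abel
    rw [e]
    refine IsLow.add ?_ (hc'.smul c)
    rw [wtm_add]
    exact ((M.isSym_g i).isLow.mul hc).mono (by omega)

variable (M) in
/-- A linear section of the symbol map. -/
def lift : Plane K →ₗ[K] A :=
  (basisMonomials (Fin 2) K).constr K fun d => (stdCoeff K d)⁻¹ • M.stdMon d

theorem lift_monomial (d : Fin 2 →₀ ℕ) (c : K) :
    M.lift (monomial d c) = (c * (stdCoeff K d)⁻¹) • M.stdMon d := by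
  have h := (basisMonomials (Fin 2) K).constr_basis K
    (fun d => (stdCoeff K d)⁻¹ • M.stdMon d) d
  rw [coe_basisMonomials] at h
  have h2 : monomial d c = c • monomial d (1 : K) := by rw [smul_monomial, smul_eq_mul, mul_one]
  rw [h2, map_smul, mul_smul]
  exact congrArg _ h

theorem isSym_lift_monomial {d : Fin 2 →₀ ℕ} (hd : d 0 % 2 = d 1 % 2) (c : K) :
    M.IsSym ρ σ (wtm ρ σ d) (M.lift (monomial d c)) (monomial d c) := by
  rw [lift_monomial]
  convert (isSym_stdMon hd).smul (c * (stdCoeff K d)⁻¹) using 1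
  rw [smul_monomial, smul_eq_mul, mul_assoc, inv_mul_cancel₀ (stdCoeff_ne_zero d), mul_one]

theorem isSym_lift (hu : EvenSupp u) (hw : u ∈ weightLE K ρ σ n) :
    M.IsSym ρ σ n (M.lift u) (wcomp K ρ σ n u) := by
  have h : ∑ d ∈ u.support, ((M.lift (monomial d (coeff d u)),
      wcomp K ρ σ n (monomial d (coeff d u))) : A × Plane K) ∈ M.symRel ρ σ n := by
    refine Submodule.sum_mem _ fun d hd => ?_
    rw [mem_support_iff] at hd
    rw [wcomp_monomial]
    rcases (hw d hd).eq_or_lt with h | h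
    · rw [if_pos h, ← h]; exact isSym_lift_monomial (hu d hd) _
    · rw [if_neg h.ne]; exact (isSym_lift_monomial (hu d hd) _).of_lt h
  have e : ∑ d ∈ u.support, ((M.lift (monomial d (coeff d u)),
      wcomp K ρ σ n (monomial d (coeff d u))) : A × Plane K) = (M.lift u, wcomp K ρ σ n u) := by
    conv_rhs => rw [u.as_sum, map_sum, map_sum]
    ext1
    · rw [Prod.fst_sum]
    · rw [Prod.snd_sum]
  rwa [e] at h

theorem IsSym.sub_lift (h : 0 < ρ + σ) (ha : M.IsSym ρ σ n a u) :
    M.IsLow ρ σ (n - 1) (a - M.lift u) := by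
  refine IsSym.induct (P := fun a u => M.IsLow ρ σ (n - 1) (a - M.lift u)) ?_ ?_
    (by simpa using isLow_zero) ?_ ?_ ha
  · rintro l rfl
    obtain ⟨c, hc⟩ := exists_word_sub_isLow (M := M) h l
    have h1 := hc.choose_spec.of_lt (show _ < wtm ρ σ (expL l) by omega)
    have h2 := (isSym_word (M := M) (l := l) rfl).sub
      ((isSym_stdMon (M := M) (ρ := ρ) (σ := σ) (expL_parity l)).smul c)
    have h3 := sub_eq_zero.1 (h2.unique h h1)
    rw [h3, map_smul, lift_monomial, mul_inv_cancel₀ (stdCoeff_ne_zero _), one_smul]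
    exact hc
  · intro l hl
    rw [map_zero, sub_zero]
    exact (isSym_word rfl).isLow.mono (by omega)
  · intro a b u v ha hb
    rw [map_add, add_sub_add_comm]
    exact ha.add hb
  · intro c a u ha
    rw [map_smul, ← smul_sub]
    exact ha.smul c

theorem IsSym.descend (h : 0 < ρ + σ) (ha : M.IsSym ρ σ n a 0) : M.IsLow ρ σ (n - 1) a := by
  simpa using ha.sub_lift h

theorem isLow_neg (hρ : 0 ≤ ρ) (hσ : 0 ≤ σ) (hn : n < 0) (ha : M.IsLow ρ σ n a) : a = 0 := by
  obtain ⟨u, ha⟩ := ha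
  have hw : ∀ d, 0 ≤ wtm ρ σ d := fun d => by unfold wtm; positivity
  refine IsSym.induct (P := fun a _ => a = 0) ?_ ?_ rfl ?_ ?_ ha
  · intro l hl; have := hw (expL l); omega
  · intro l hl; have := hw (expL l); omega
  · rintro a b _ _ rfl rfl; simp
  · rintro c a _ rfl; simp

theorem exists_lift {n : ℕ} (ha : M.IsLow 1 1 n a) :
    ∃ u, EvenSupp u ∧ u ∈ weightLE K 1 1 n ∧ M.lift u = a := by
  suffices H : ∀ n : ℕ, ∀ a, M.IsLow 1 1 ((n : ℤ) - 1) a →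
      ∃ u, EvenSupp u ∧ u ∈ weightLE K 1 1 ((n : ℤ) - 1) ∧ M.lift u = a by
    simpa using H (n + 1) a (by simpa using ha)
  intro n
  induction n with
  | zero =>
    intro a ha
    obtain rfl := isLow_neg (by norm_num) (by norm_num) (by norm_num) ha
    exact ⟨0, evenSupp_zero, zero_mem _, map_zero _⟩
  | succ n ih =>
    rintro a ⟨u, ha⟩
    obtain ⟨v, hv, hv', h⟩ := ih (a - M.lift u)
      ((ha.sub_lift (by norm_num)).mono (by push_cast; omega))
    refine ⟨u + v, ha.evenSupp.add hv, add_mem ?_ (weightLE_mono (by push_cast; omega) hv'), ?_⟩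
    · exact fun d hd => (ha.isQH d hd).le
    · rw [map_add, h]; abel

theorem exists_isLow (a : A) : ∃ n : ℕ, M.IsLow 1 1 n a := by
  have h : a ∈ Algebra.adjoin K (Set.range M.g) := by rw [M.adjoin_eq_top]; trivial
  have hw : ∀ d, 0 ≤ wtm 1 1 d := fun d => by unfold wtm; positivity
  induction h using Algebra.adjoin_induction with
  | mem x hx =>
    obtain ⟨i, rfl⟩ := hx
    exact ⟨(wtm 1 1 (expG i)).toNat, (isSym_g i).isLow.mono (Int.self_le_toNat _)⟩
  | algebraMap r => exact ⟨0, (isSym_algebraMap r).isLow⟩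
  | add x y _ _ hx hy =>
    obtain ⟨m, hm⟩ := hx
    obtain ⟨n, hn⟩ := hy
    exact ⟨max m n, (hm.mono (by simp)).add (hn.mono (by simp))⟩
  | mul x y _ _ hx hy =>
    obtain ⟨m, hm⟩ := hx
    obtain ⟨n, hn⟩ := hy
    exact ⟨m + n, by push_cast; exact hm.mul hn⟩

end SlModel

end EvenSymbols

section LinearAutomorphisms

variable {A : Type*} [Ring A] [Algebra K A] {M : SlModel K lam A}

namespace SlModel

variable (M) in
/-- The algebra automorphisms preserving the bracket. -/
def autGroup : Subgroup (A ≃ₐ[K] A) where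
  carrier := {φ | ∀ a b, φ (M.br a b) = M.br (φ a) (φ b)}
  one_mem' := fun _ _ => rfl
  mul_mem' := by
    intro φ ψ hφ hψ a b
    rw [AlgEquiv.mul_apply, hψ, hφ]
    rfl
  inv_mem' := by
    intro φ hφ a b
    apply φ.injective
    rw [hφ]
    simp [AlgEquiv.aut_inv]

theorem hom_ext {φ ψ : A →ₐ[K] A} (h0 : φ (M.g 0) = ψ (M.g 0)) (h1 : φ (M.g 1) = ψ (M.g 1))
    (h2 : φ (M.g 2) = ψ (M.g 2)) : φ = ψ := by
  refine AlgHom.ext_of_adjoin_eq_top M.adjoin_eq_top ?_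
  rintro _ ⟨i, rfl⟩
  have hi : ∀ i : Fin 3, (i = 0 ∨ i = 1 ∨ i = 2) := by decide
  rcases hi i with rfl | rfl | rfl <;> assumption

theorem induction_gen {P : A → Prop} (hg : ∀ i, P (M.g i)) (hC : ∀ r, P (algebraMap K A r))
    (hadd : ∀ a b, P a → P b → P (a + b)) (hmul : ∀ a b, P a → P b → P (a * b)) (a : A) : P a := by
  have h : a ∈ Algebra.adjoin K (Set.range M.g) := by rw [M.adjoin_eq_top]; trivial
  induction h using Algebra.adjoin_induction with
  | mem x hx => obtain ⟨i, rfl⟩ := hx; exact hg i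
  | algebraMap r => exact hC r
  | add x y _ _ hx hy => exact hadd _ _ hx hy
  | mul x y _ _ hx hy => exact hmul _ _ hx hy

theorem map_br {φ : A →ₐ[K] A}
    (h : IsSlTriple M.br lam (φ (M.g 0)) (φ (M.g 1)) (φ (M.g 2))) (a b : A) :
    φ (M.br a b) = M.br (φ a) (φ b) := by
  have hg : ∀ i j, φ (M.br (M.g i) (M.g j)) = M.br (φ (M.g i)) (φ (M.g j)) := by
    have hi : ∀ i : Fin 3, (i = 0 ∨ i = 1 ∨ i = 2) := by decide
    intro i j
    rcases hi i with rfl | rfl | rfl <;> rcases hi j with rfl | rfl | rfl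
    · simp [M.alt]
    · rw [M.br_swap, M.br_swap (φ _), M.br_he, h.he]; simp [two_mul]
    · rw [M.br_ef, h.ef]
    · rw [M.br_he, h.he]; simp [two_mul]
    · simp [M.alt]
    · rw [M.br_hf, h.hf]; simp [two_mul]
    · rw [M.br_swap, M.br_swap (φ _), M.br_ef, h.ef]; simp
    · rw [M.br_swap, M.br_swap (φ _), M.br_hf, h.hf]; simp [two_mul]
    · simp [M.alt]
  induction a using M.induction_gen with
  | hC r => simp [br_algebraMap_left]
  | hadd a b ha hb => simp [ha, hb]
  | hmul a a' ha ha' => simp [leib_left, ha, ha']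
  | hg i =>
    induction b using M.induction_gen with
    | hC r => simp [br_algebraMap_right]
    | hadd a b ha hb => simp [ha, hb]
    | hmul a a' ha ha' => simp [M.leib, ha, ha']
    | hg j => exact hg i j

/-- The endomorphism with given values on the generators. -/
def hom {e h f : A} (t : IsSlTriple M.br lam e h f) : A →ₐ[K] A := (M.exists_hom e h f t).choose

section
variable {e h f : A} (t : IsSlTriple M.br lam e h f)
theorem hom_zero : M.hom t (M.g 0) = e := (M.exists_hom e h f t).choose_spec.1
theorem hom_one : M.hom t (M.g 1) = h := (M.exists_hom e h f t).choose_spec.2.1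
theorem hom_two : M.hom t (M.g 2) = f := (M.exists_hom e h f t).choose_spec.2.2

theorem hom_br (a b : A) : M.hom t (M.br a b) = M.br (M.hom t a) (M.hom t b) :=
  map_br (by rw [hom_zero, hom_one, hom_two]; exact t) a b
end

/-- A group acting by endomorphisms that preserve the bracket acts by automorphisms. -/
def toAutGroup {G : Type*} [Group G] (F : G →* (A →ₐ[K] A))
    (hF : ∀ s a b, F s (M.br a b) = M.br (F s a) (F s b)) : G →* M.autGroup :=
  ((AlgEquiv.algHomUnitsEquiv K A).toMonoidHom.comp F.toHomUnits).codRestrict M.autGroup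
    fun s => hF s

theorem two_mul_eq (a : A) : 2 * a = (2 : K) • a := by rw [two_mul, two_smul]

section Linear

variable (s : Matrix.SpecialLinearGroup (Fin 2) K)

theorem det_eq : s 0 0 * s 1 1 - s 0 1 * s 1 0 = 1 := by
  rw [← Matrix.det_fin_two, s.det_coe]

variable (M) in
/-- The images of the generators under the linear substitution `s`. -/
def linImage (i : Fin 3) : A :=
  ![(s 0 0 ^ 2) • M.g 0 + (s 0 0 * s 1 0) • M.g 1 - (s 1 0 ^ 2) • M.g 2,
    (2 * s 0 0 * s 0 1) • M.g 0 + (s 0 0 * s 1 1 + s 1 0 * s 0 1) • M.g 1 -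
      (2 * s 1 0 * s 1 1) • M.g 2,
    (s 1 1 ^ 2) • M.g 2 - (s 0 1 * s 1 1) • M.g 1 - (s 0 1 ^ 2) • M.g 0] i

theorem isSlTriple_linImage :
    IsSlTriple M.br lam (M.linImage s 0) (M.linImage s 1) (M.linImage s 2) := by
  have hd := det_eq s
  have b1 := M.br_ef
  have b2 := M.br_fe
  have b3 := M.br_he
  have b4 := M.br_eh
  have b5 := M.br_hf
  have b6 := M.br_fh
  simp only [neg_mul, two_mul_eq (K := K)] at b1 b2 b3 b4 b5 b6
  simp only [linImage, Matrix.cons_val_zero, Matrix.cons_val_one, Matrix.cons_val]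
  constructor
  · simp only [map_add, map_sub, map_smul, LinearMap.add_apply, LinearMap.sub_apply,
      LinearMap.smul_apply, b1, b2, b3, b4, b5, b6, M.alt]
    match_scalars
    · linear_combination (s 0 0 * s 1 1 + s 1 0 * s 0 1) * hd
    · linear_combination (-2 * s 1 0 * s 1 1) * hd
    · linear_combination (2 * s 0 0 * s 0 1) * hd
  · simp only [map_add, map_sub, map_smul, LinearMap.add_apply, LinearMap.sub_apply,
      LinearMap.smul_apply, b1, b2, b3, b4, b5, b6, M.alt, two_mul_eq (K := K)]
    match_scalars
    · linear_combination (2 * s 0 0 ^ 2) * hd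
    · linear_combination (2 * s 0 0 * s 1 0) * hd
    · linear_combination (-2 * s 1 0 ^ 2) * hd
  · simp only [map_add, map_sub, map_smul, LinearMap.add_apply, LinearMap.sub_apply,
      LinearMap.smul_apply, b1, b2, b3, b4, b5, b6, M.alt, two_mul_eq (K := K), neg_mul]
    match_scalars
    · linear_combination (2 * s 0 1 * s 1 1) * hd
    · linear_combination (-2 * s 1 1 ^ 2) * hd
    · linear_combination (2 * s 0 1 ^ 2) * hd
  · rw [← M.triple.casimir]
    simp only [pow_two, mul_add, add_mul, mul_sub, sub_mul, two_mul_eq (K := K),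
      smul_mul_assoc, mul_smul_comm]
    have hd2 : (s 0 0 * s 1 1 - s 0 1 * s 1 0) ^ 2 = 1 := by rw [hd, one_pow]
    match_scalars <;> first | ring1 | linear_combination 2 * hd2 | linear_combination hd2

variable (M) in
/-- Linear substitutions as endomorphisms. -/
def linHom : Matrix.SpecialLinearGroup (Fin 2) K →* (A →ₐ[K] A) where
  toFun s := M.hom (isSlTriple_linImage s)
  map_one' := by
    refine M.hom_ext ?_ ?_ ?_ <;>
    simp [hom_zero, hom_one, hom_two, linImage]
  map_mul' s t := by
    refine M.hom_ext ?_ ?_ ?_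
    · simp only [AlgHom.mul_apply, hom_zero, hom_one, hom_two, linImage, map_add, map_sub, map_smul,
        Matrix.cons_val_zero, Matrix.cons_val_one, Matrix.cons_val,
        Matrix.SpecialLinearGroup.coe_mul, Matrix.mul_apply, Fin.sum_univ_two]
      match_scalars <;> ring
    · simp only [AlgHom.mul_apply, hom_zero, hom_one, hom_two, linImage, map_add, map_sub, map_smul,
        Matrix.cons_val_zero, Matrix.cons_val_one, Matrix.cons_val,
        Matrix.SpecialLinearGroup.coe_mul, Matrix.mul_apply, Fin.sum_univ_two]
      match_scalars <;> ring
    · simp only [AlgHom.mul_apply, hom_zero, hom_one, hom_two, linImage, map_add, map_sub, map_smul,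
        Matrix.cons_val_zero, Matrix.cons_val_one, Matrix.cons_val,
        Matrix.SpecialLinearGroup.coe_mul, Matrix.mul_apply, Fin.sum_univ_two]
      match_scalars <;> ring

variable (M) in
/-- Linear substitutions as automorphisms. -/
def lin : Matrix.SpecialLinearGroup (Fin 2) K →* M.autGroup :=
  toAutGroup M.linHom fun s => hom_br (isSlTriple_linImage s)

theorem lin_zero : (M.lin s : A ≃ₐ[K] A) (M.g 0) = M.linImage s 0 :=
  hom_zero (isSlTriple_linImage s)
theorem lin_one : (M.lin s : A ≃ₐ[K] A) (M.g 1) = M.linImage s 1 :=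
  hom_one (isSlTriple_linImage s)
theorem lin_two : (M.lin s : A ≃ₐ[K] A) (M.g 2) = M.linImage s 2 :=
  hom_two (isSlTriple_linImage s)

theorem lin_g (i : Fin 3) : (M.lin s : A ≃ₐ[K] A) (M.g i) = M.linImage s i := by
  have hi : ∀ i : Fin 3, (i = 0 ∨ i = 1 ∨ i = 2) := by decide
  rcases hi i with rfl | rfl | rfl
  exacts [lin_zero s, lin_one s, lin_two s]

/-- The linear substitution on symbols. -/
def linSub : Plane K →ₐ[K] Plane K :=
  aeval ![C (s 0 0) * X 0 + C (s 1 0) * X 1, C (s 0 1) * X 0 + C (s 1 1) * X 1]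

theorem IsSym.lin {n : ℤ} {a : A} {u : Plane K} (ha : M.IsSym 1 1 n a u) :
    M.IsSym 1 1 n ((M.lin s : A ≃ₐ[K] A) a) (linSub s u) := by
  refine IsSym.map (φ := ((M.lin s : A ≃ₐ[K] A) : A →ₐ[K] A)) (fun i => ?_) ha
  change M.IsSym 1 1 _ ((M.lin s : A ≃ₐ[K] A) (M.g i)) _
  rw [lin_g]
  have w : ∀ i : Fin 3, wtm 1 1 (expG i) = 2 := by
    intro i; fin_cases i <;> simp [wtm, expG]
  have h := fun i => isSym_g (M := M) (ρ := 1) (σ := 1) i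
  simp only [w] at h
  rw [w]
  have h2 : (C 2 : Plane K) = 2 := map_ofNat C 2
  have hi : ∀ i : Fin 3, (i = 0 ∨ i = 1 ∨ i = 2) := by decide
  rcases hi i with rfl | rfl | rfl
  · convert (((h 0).smul (s 0 0 ^ 2)).add ((h 1).smul (s 0 0 * s 1 0))).sub
      ((h 2).smul (s 1 0 ^ 2)) using 1
    · rfl
    · simp [symG, linSub, smul_eq_C_mul]; ring
  · convert (((h 0).smul (2 * s 0 0 * s 0 1)).add ((h 1).smul (s 0 0 * s 1 1 + s 1 0 * s 0 1))).sub
      ((h 2).smul (2 * s 1 0 * s 1 1)) using 1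
    · rfl
    · rw [show symG 1 = (C 2 * X 0 * X 1 : Plane K) by rw [h2]; rfl]
      simp [symG, linSub, smul_eq_C_mul]; ring
  · convert (((h 2).smul (s 1 1 ^ 2)).sub ((h 1).smul (s 0 1 * s 1 1))).sub
      ((h 0).smul (s 0 1 ^ 2)) using 1
    · rfl
    · simp [symG, linSub, smul_eq_C_mul]; ring

end Linear

end SlModel

end LinearAutomorphisms

section Triangular

variable {A : Type*} [Ring A] [Algebra K A] {M : SlModel K lam A}

namespace SlModel

variable (M) in
/-- Evaluation of polynomials at `f`. -/
def pev : Polynomial K →ₐ[K] A := Polynomial.aeval (M.g 2)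

theorem pev_X : M.pev Polynomial.X = M.g 2 := Polynomial.aeval_X _

theorem pev_C (c : K) : M.pev (Polynomial.C c) = algebraMap K A c := Polynomial.aeval_C _ _

theorem br_h_pev (p : Polynomial K) :
    M.br (M.g 1) (M.pev p) = -M.pev (2 * Polynomial.X * Polynomial.derivative p) := by
  induction p using Polynomial.induction_on' with
  | add p q hp hq => rw [map_add, map_add, hp, hq, Polynomial.derivative_add, mul_add, map_add,
      neg_add]
  | monomial n c =>
    induction n with
    | zero => simp [Polynomial.monomial_zero_left, pev_C, br_algebraMap_right]
    | succ n ih =>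
      have e : Polynomial.monomial (n + 1) c = Polynomial.X * Polynomial.monomial n c := by
        rw [Polynomial.X_mul_monomial]
      rw [e, map_mul, M.leib, ih, pev_X, br_hf, ← pev_X, neg_mul, neg_mul, two_mul, ← two_mul,
        ← map_ofNat M.pev 2, mul_neg]
      simp only [← map_mul, ← map_add, ← neg_add, Polynomial.derivative_mul,
        Polynomial.derivative_X]
      congr 2
      ring

theorem br_f_pev (p : Polynomial K) : M.br (M.g 2) (M.pev p) = 0 := by
  induction p using Polynomial.induction_on' with
  | add p q hp hq => rw [map_add, map_add, hp, hq, add_zero]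
  | monomial n c =>
    induction n with
    | zero => simp [Polynomial.monomial_zero_left, pev_C, br_algebraMap_right]
    | succ n ih =>
      have e : Polynomial.monomial (n + 1) c = Polynomial.X * Polynomial.monomial n c := by
        rw [Polynomial.X_mul_monomial]
      rw [e, map_mul, M.leib, ih, pev_X, M.alt, mul_zero, zero_mul, add_zero]

theorem br_pev_pev (p q : Polynomial K) : M.br (M.pev p) (M.pev q) = 0 := by
  induction p using Polynomial.induction_on' with
  | add p q hp hq => rw [map_add, map_add, LinearMap.add_apply, hp, hq, add_zero]
  | monomial n c =>
    induction n with
    | zero => simp [Polynomial.monomial_zero_left, pev_C, br_algebraMap_left]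
    | succ n ih =>
      have e : Polynomial.monomial (n + 1) c = Polynomial.X * Polynomial.monomial n c := by
        rw [Polynomial.X_mul_monomial]
      rw [e, map_mul, M.leib_left, ih, pev_X, br_f_pev, mul_zero, zero_mul, add_zero]

theorem h_mul_pev (p : Polynomial K) : M.g 1 * M.pev p =
    M.pev p * M.g 1 - M.eps • M.pev (2 * Polynomial.X * Polynomial.derivative p) := by
  have h := M.comm (M.g 1) (M.pev p)
  rw [br_h_pev, smul_neg] at h
  rw [sub_eq_iff_eq_add.1 h]
  abel

variable (M) in
/-- Left multiplication by polynomials in `f`. -/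
abbrev pmod : Module (Polynomial K) A := Module.compHom A M.pev.toRingHom

section
theorem pmod_mul (p : Polynomial K) (a : A) : M.pev p * a = (letI := pmod M; p • a) := rfl

theorem pmod_pev (p : Polynomial K) : M.pev p = (letI := pmod M; p • (1 : A)) := (mul_one _).symm

theorem pmod_smul (c : K) (a : A) : c • a = (letI := pmod M; Polynomial.C c • a) := by
  rw [← pmod_mul, pev_C, Algebra.smul_def]
end

theorem br_e_pev (p : Polynomial K) : M.br (M.g 0) (M.pev p) =
    M.pev (Polynomial.derivative p) * M.g 1 - M.eps • M.pev (Polynomial.X *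
      Polynomial.derivative (Polynomial.derivative p)) := by
  induction p using Polynomial.induction_on' with
  | add p q hp hq =>
    rw [map_add, map_add, hp, hq]
    simp only [Polynomial.derivative_add, mul_add, map_add, add_mul, smul_add]
    abel
  | monomial n c =>
    induction n with
    | zero => simp [Polynomial.monomial_zero_left, pev_C, br_algebraMap_right]
    | succ n ih =>
      have e : Polynomial.monomial (n + 1) c = Polynomial.X * Polynomial.monomial n c := by
        rw [Polynomial.X_mul_monomial]
      rw [e]
      generalize Polynomial.monomial n c = p at ih
      let _ := pmod M
      rw [map_mul, M.leib, ih, pev_X, br_ef, h_mul_pev, ← pev_X]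
      simp only [Polynomial.derivative_mul, Polynomial.derivative_X, Polynomial.derivative_add,
        Polynomial.derivative_one, mul_sub, mul_smul_comm]
      simp only [pmod_mul, smul_smul, pmod_smul (M := M)]
      simp only [pmod_pev, smul_smul]
      match_scalars <;> ring

variable (M) in
/-- The images of the generators under `δ_g`. -/
def delImage (p : Polynomial K) (i : Fin 3) : A :=
  ![M.g 0 - M.pev p * M.g 1 + M.pev (Polynomial.C M.eps * Polynomial.X * Polynomial.derivative p -
      Polynomial.X * p ^ 2), M.g 1 + M.pev (2 * Polynomial.X * p), M.g 2] i

theorem pev_two : M.pev 2 = 2 := map_ofNat M.pev 2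

theorem br_pev_e (p : Polynomial K) : M.br (M.pev p) (M.g 0) =
    M.eps • M.pev (Polynomial.X * Polynomial.derivative (Polynomial.derivative p)) -
      M.pev (Polynomial.derivative p) * M.g 1 := by
  rw [M.br_swap, br_e_pev, neg_sub]

theorem br_pev_h (p : Polynomial K) :
    M.br (M.pev p) (M.g 1) = M.pev (2 * Polynomial.X * Polynomial.derivative p) := by
  rw [M.br_swap, br_h_pev, neg_neg]

theorem isSlTriple_delImage (p : Polynomial K) :
    IsSlTriple M.br lam (M.delImage p 0) (M.delImage p 1) (M.delImage p 2) := by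
  let _ := pmod M
  have d2 : Polynomial.derivative (2 : Polynomial K) = 0 := Polynomial.derivative_ofNat 2
  simp only [delImage, Matrix.cons_val_zero, Matrix.cons_val_one, Matrix.cons_val]
  constructor
  · simp only [← pev_X (M := M), map_add, map_sub, LinearMap.add_apply, LinearMap.sub_apply,
      leib_left, br_pev_pev]
    simp only [pev_X, br_ef, br_hf]
    simp only [← pev_X (M := M), ← pev_two (M := M)]
    simp only [neg_mul, mul_neg, zero_mul, sub_zero, add_zero, pmod_mul, pmod_smul (M := M)]
    simp only [pmod_pev, smul_smul]
    match_scalars <;> ring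
  · simp only [map_add, map_sub, LinearMap.add_apply, LinearMap.sub_apply, M.leib, br_he, br_h_pev,
      br_pev_e, br_pev_h, br_pev_pev, M.alt, ← pev_two (M := M)]
    simp only [neg_mul, mul_neg, zero_mul, mul_zero, sub_zero, zero_add, add_zero, mul_add,
      mul_sub, pmod_mul, pmod_smul (M := M)]
    simp only [pmod_pev, smul_smul, d2, Polynomial.derivative_mul, Polynomial.derivative_X,
      Polynomial.derivative_sub, Polynomial.derivative_pow, Polynomial.derivative_C,
      Polynomial.derivative_add, map_add, Polynomial.derivative_one]
    have c2 : Polynomial.C (2 : K) = 2 := rfl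
    match_scalars
    · ring
    · simp only [c2, Polynomial.derivative_zero]
      ring
    · ring
  · rw [map_add, LinearMap.add_apply, br_hf, ← pev_X, br_pev_pev, add_zero]
  · have hef : M.g 0 * M.pev Polynomial.X = M.pev Polynomial.X * M.g 0 + M.eps • M.g 1 := by
      rw [pev_X, ← M.br_ef, ← M.comm]; abel
    have hc := M.triple.casimir
    rw [← hc]
    simp only [pow_two, ← pev_X (M := M), ← pev_two (M := M)]
    simp only [add_mul, sub_mul, mul_add, mul_sub, mul_assoc, h_mul_pev, hef]
    simp only [pmod_mul, pmod_smul (M := M)]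
    simp only [pmod_pev, smul_smul, d2, Polynomial.derivative_mul, Polynomial.derivative_X]
    match_scalars <;> ring

theorem delImage_hom {φ : A →ₐ[K] A} (h : φ (M.g 2) = M.g 2) (p : Polynomial K) :
    φ (M.pev p) = M.pev p := by
  rw [pev, ← Polynomial.aeval_algHom_apply, h]

variable (M) in
/-- The endomorphisms `δ_g`. -/
def delHom : Multiplicative (Polynomial K) →* (A →ₐ[K] A) where
  toFun p := M.hom (isSlTriple_delImage p.toAdd)
  map_one' := by
    refine M.hom_ext ?_ ?_ ?_ <;>
    simp [hom_zero, hom_one, hom_two, delImage]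
  map_mul' p q := by
    let _ := pmod M
    have h3 : ∀ r, M.hom (isSlTriple_delImage p.toAdd) (M.pev r) = M.pev r := fun r =>
      delImage_hom (hom_two (isSlTriple_delImage p.toAdd)) r
    have h0 := hom_zero (isSlTriple_delImage (M := M) p.toAdd)
    have h1 := hom_one (isSlTriple_delImage (M := M) p.toAdd)
    have h2 := hom_two (isSlTriple_delImage (M := M) p.toAdd)
    generalize M.hom (isSlTriple_delImage p.toAdd) = φ at h0 h1 h2 h3
    refine M.hom_ext ?_ ?_ ?_
    · rw [AlgHom.mul_apply, hom_zero, hom_zero]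
      simp only [delImage, map_add, map_sub, map_mul, toAdd_mul, h0, h1, h3,
        Matrix.cons_val_zero, Matrix.cons_val_one, Polynomial.derivative_add, mul_add, add_mul]
      simp only [← map_mul, mul_add]
      simp only [pmod_mul]
      simp only [pmod_pev, smul_smul]
      match_scalars <;> ring
    · rw [AlgHom.mul_apply, hom_one, hom_one]
      simp only [delImage, map_add, toAdd_mul, h1, h3, Matrix.cons_val_one,
        Matrix.cons_val_zero, mul_add]
      abel
    · rw [AlgHom.mul_apply, hom_two, hom_two]
      exact h2.symm

variable (M) in
/-- The automorphisms `δ_g`. -/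
def delM : Multiplicative (Polynomial K) →* M.autGroup :=
  toAutGroup M.delHom fun p => hom_br (isSlTriple_delImage p.toAdd)

variable (M) in
/-- The automorphism `δ_p`. -/
def del (p : Polynomial K) : M.autGroup := M.delM (Multiplicative.ofAdd p)

theorem del_add (p q : Polynomial K) : M.del (p + q) = M.del p * M.del q :=
  map_mul M.delM _ _

theorem del_zero (p : Polynomial K) : (M.del p : A ≃ₐ[K] A) (M.g 0) = M.delImage p 0 :=
  hom_zero (isSlTriple_delImage p)
theorem del_one (p : Polynomial K) : (M.del p : A ≃ₐ[K] A) (M.g 1) = M.delImage p 1 :=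
  hom_one (isSlTriple_delImage p)
theorem del_two (p : Polynomial K) : (M.del p : A ≃ₐ[K] A) (M.g 2) = M.g 2 :=
  hom_two (isSlTriple_delImage p)

theorem autGroup_ext {φ ψ : M.autGroup} (h : ∀ i, (φ : A ≃ₐ[K] A) (M.g i) = (ψ : A ≃ₐ[K] A) (M.g i)) :
    φ = ψ := by
  have := M.hom_ext (φ := ((φ : A ≃ₐ[K] A) : A →ₐ[K] A)) (ψ := ((ψ : A ≃ₐ[K] A) : A →ₐ[K] A))
    (h 0) (h 1) (h 2)
  ext a
  exact DFunLike.congr_fun this a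

end SlModel

end Triangular

section LeadingForms

variable {A : Type*} [Ring A] [Algebra K A] {M : SlModel K lam A} {ρ σ m n : ℤ}

namespace SlModel

theorem del_C {c : K} {s : Matrix.SpecialLinearGroup (Fin 2) K} (h00 : s 0 0 = 1) (h01 : s 0 1 = 0)
    (h10 : s 1 0 = -c) (h11 : s 1 1 = 1) : M.del (Polynomial.C c) = M.lin s := by
  refine autGroup_ext fun i => ?_
  have hi : ∀ i : Fin 3, (i = 0 ∨ i = 1 ∨ i = 2) := by decide
  let _ := pmod M
  rcases hi i with rfl | rfl | rfl
  · rw [del_zero, lin_zero]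
    simp only [delImage, linImage, h00, h01, h10, h11, Matrix.cons_val_zero, pmod_mul]
    simp only [← pev_X, pmod_pev, pmod_smul (M := M), Polynomial.derivative_C, smul_smul]
    match_scalars
    · simp
    · simp
    · simp
      ring
  · rw [del_one, lin_one]
    simp only [delImage, linImage, h00, h01, h10, h11, Matrix.cons_val_one, Matrix.cons_val_zero,
      pmod_mul]
    simp only [← pev_X, pmod_pev, pmod_smul (M := M), Polynomial.derivative_C, smul_smul]
    have c2 : Polynomial.C (2 : K) = 2 := rfl
    match_scalars
    · simp
    · simp [c2]
      ring
    · simp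
  · rw [del_two, lin_two]
    simp [linImage, h00, h01, h10, h11]

/-- The action of a diagonal substitution with entries `u⁻¹`, `u` on the polynomial defining
`δ_p`. -/
def twist (u : K) (p : Polynomial K) : Polynomial K :=
  Polynomial.C (u ^ 2) * p.comp (Polynomial.C (u ^ 2) * Polynomial.X)

omit [CharZero K] in
theorem natDegree_twist {u : K} (hu : u ≠ 0) (p : Polynomial K) :
    (twist u p).natDegree = p.natDegree := by
  rw [twist, Polynomial.natDegree_C_mul (pow_ne_zero 2 hu), Polynomial.natDegree_comp,
    Polynomial.natDegree_C_mul_X _ (pow_ne_zero 2 hu), mul_one]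

theorem lin_mul_del {s : Matrix.SpecialLinearGroup (Fin 2) K} (h : s 0 1 = 0) (p : Polynomial K) :
    M.lin s * M.del p = M.del (twist (s 1 1) p) * M.lin s := by
  have hd : s 0 0 * s 1 1 = 1 := by have := det_eq s; rw [h] at this; linear_combination this
  have hev : ∀ p, (M.lin s : A ≃ₐ[K] A) (M.pev p) =
      M.pev (p.comp (Polynomial.C (s 1 1 ^ 2) * Polynomial.X)) := by
    intro p
    have h2 : ((M.lin s : A ≃ₐ[K] A) : A →ₐ[K] A) (M.g 2) =
        Polynomial.aeval (M.g 2) (Polynomial.C (s 1 1 ^ 2) * Polynomial.X) := by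
      refine (lin_two s).trans ?_
      simp [linImage, h, Algebra.smul_def]
    rw [pev, Polynomial.aeval_comp, ← h2, Polynomial.aeval_algHom_apply]
    rfl
  have hdev : ∀ p, (M.del (twist (s 1 1) p) : A ≃ₐ[K] A) (M.g 2) = M.g 2 := fun p => del_two _
  refine autGroup_ext fun i => ?_
  have hi : ∀ i : Fin 3, (i = 0 ∨ i = 1 ∨ i = 2) := by decide
  let _ := pmod M
  have c2 : Polynomial.C (2 : K) = 2 := rfl
  have hC : Polynomial.C (s 0 0) * Polynomial.C (s 1 1) = 1 := by rw [← Polynomial.C_mul, hd]; rfl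
  rcases hi i with rfl | rfl | rfl
  · rw [Subgroup.coe_mul, Subgroup.coe_mul, AlgEquiv.mul_apply, AlgEquiv.mul_apply, del_zero,
      lin_zero]
    simp only [delImage, linImage, h, Matrix.cons_val_zero, map_add, map_sub, map_mul, map_smul, hev,
      del_zero, del_one, del_two, lin_zero, lin_one, Matrix.cons_val_one, Matrix.cons_val,
      Polynomial.mul_comp, Polynomial.X_comp, Polynomial.pow_comp, Polynomial.C_comp, map_pow]
    simp only [← map_mul, ← map_pow, pmod_mul]
    simp only [← pev_X, pmod_pev, pmod_smul (M := M), smul_smul, twist]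
    simp only [Polynomial.derivative_mul, Polynomial.derivative_C, Polynomial.derivative_comp,
      Polynomial.derivative_X]
    simp only [map_mul, map_pow, c2, Polynomial.C_0, mul_zero, zero_mul, add_zero, zero_add, mul_one]
    generalize Polynomial.C (s 1 0) = c
    generalize p.comp _ = q
    generalize (Polynomial.derivative p).comp _ = q'
    generalize Polynomial.C (s 0 0) = t at *
    generalize Polynomial.C (s 1 1) = u at *
    match_scalars
    · ring
    · linear_combination q * t * u * hC
    · linear_combination (-2 * c * Polynomial.X * q * u + (Polynomial.X * q ^ 2 * u ^ 2 -
        Polynomial.C M.eps * Polynomial.X * u ^ 2 * q') * (t * u + 1)) * hC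
  · rw [Subgroup.coe_mul, Subgroup.coe_mul, AlgEquiv.mul_apply, AlgEquiv.mul_apply, del_one,
      lin_one]
    simp only [delImage, linImage, h, Matrix.cons_val_zero, map_add, map_sub, map_mul, map_smul, hev,
      del_zero, del_one, del_two, lin_zero, lin_one, Matrix.cons_val_one, Matrix.cons_val,
      Polynomial.mul_comp, Polynomial.X_comp, Polynomial.pow_comp, Polynomial.C_comp, map_pow]
    simp only [← map_mul, ← map_pow, pmod_mul]
    simp only [← pev_X, pmod_pev, pmod_smul (M := M), smul_smul, twist]
    simp only [map_mul, map_pow, c2, Polynomial.C_0, mul_zero, zero_mul, add_zero, zero_add, mul_one,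
      hd, Polynomial.C_1, Polynomial.ofNat_comp, Nat.cast_ofNat]
    generalize p.comp _ = q
    generalize Polynomial.C (s 0 0) = t at *
    generalize Polynomial.C (s 1 1) = u at *
    match_scalars
    · ring
    · ring
    · ring
  · rw [Subgroup.coe_mul, Subgroup.coe_mul, AlgEquiv.mul_apply, AlgEquiv.mul_apply, del_two,
      lin_two]
    simp [linImage, h, del_two]

theorem isSym_pev (hσ : 0 < σ) {d : ℕ} {p : Polynomial K} (hp : p.natDegree ≤ d) :
    M.IsSym ρ σ (2 * σ * d) (M.pev p) (C (p.coeff d) * (-X 1 ^ 2) ^ d) := by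
  induction d generalizing p with
  | zero =>
    rw [Polynomial.eq_C_of_natDegree_le_zero hp, pev_C]
    simpa using isSym_algebraMap (M := M) (ρ := ρ) (σ := σ) (p.coeff 0)
  | succ d ih =>
    have h1 := (isSym_g (M := M) (ρ := ρ) (σ := σ) 2).mul (ih (p := p.divX) (by
      rw [Polynomial.natDegree_divX_eq_natDegree_tsub_one]; omega))
    have h2 := (isSym_algebraMap (M := M) (ρ := ρ) (σ := σ) (p.coeff 0)).of_lt
      (m := 2 * σ * (d + 1 : ℕ)) (by positivity)
    have h3 : wtm ρ σ (expG 2) + 2 * σ * d = 2 * σ * (d + 1 : ℕ) := by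
      simp [wtm, expG]; ring
    rw [h3] at h1
    have h4 := h1.add h2
    rw [Polynomial.coeff_divX, ← pev_X, ← pev_C (M := M), ← map_mul, ← map_add,
      Polynomial.X_mul_divX_add] at h4
    convert h4 using 1
    simp [symG]
    ring

/-- The leading symbol of `δ_p`. -/
def delSub (b : K) (k : ℕ) : Plane K →ₐ[K] Plane K := aeval ![X 0 + C b * X 1 ^ k, X 1]

theorem isSym_delImage {p : Polynomial K} (hp : p.natDegree ≠ 0) (i : Fin 3) :
    M.IsSym (2 * p.natDegree + 1 : ℕ) 1 (wtm (2 * p.natDegree + 1 : ℕ) 1 (expG i)) (M.delImage p i)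
      (delSub (-(p.leadingCoeff * (-1) ^ p.natDegree)) (2 * p.natDegree + 1) (symG i)) := by
  set d := p.natDegree with hd
  have hi : ∀ i : Fin 3, (i = 0 ∨ i = 1 ∨ i = 2) := by decide
  have key : ∀ {n m : ℤ} {a : A} {u u' : Plane K}, M.IsSym (2 * d + 1 : ℕ) 1 n a u → n = m →
      u = u' → M.IsSym (2 * d + 1 : ℕ) 1 m a u' := by rintro _ _ _ _ _ h rfl rfl; exact h
  have hp1 := isSym_pev (M := M) (ρ := (2 * d + 1 : ℕ)) one_pos hd.ge
  have hp2 := isSym_pev (M := M) (ρ := (2 * d + 1 : ℕ)) one_pos (d := 2 * d + 1)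
    (p := Polynomial.X * p ^ 2) (by
      refine Polynomial.natDegree_mul_le.trans ?_
      have := Polynomial.natDegree_pow_le (p := p) (n := 2)
      rw [Polynomial.natDegree_X]; omega)
  have hp3 := (isSym_pev (M := M) (ρ := (2 * d + 1 : ℕ)) one_pos (d := d)
    (p := Polynomial.C M.eps * Polynomial.X * Polynomial.derivative p) (by
      rw [mul_assoc]
      refine (Polynomial.natDegree_C_mul_le _ _).trans (Polynomial.natDegree_mul_le.trans ?_)
      have := Polynomial.natDegree_derivative_le p
      rw [Polynomial.natDegree_X]; omega)).of_lt
      (m := 2 * 1 * (2 * d + 1 : ℕ)) (by push_cast; omega)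
  have hp4 := isSym_pev (M := M) (ρ := (2 * d + 1 : ℕ)) one_pos (d := d + 1)
    (p := 2 * Polynomial.X * p) (by
      have h2 : (2 : Polynomial K) = Polynomial.C 2 := rfl
      rw [mul_assoc, h2]
      refine (Polynomial.natDegree_C_mul_le _ _).trans (Polynomial.natDegree_mul_le.trans ?_)
      rw [Polynomial.natDegree_X]; omega)
  have c2 : (Polynomial.X * p ^ 2).coeff (2 * d + 1) = p.leadingCoeff ^ 2 := by
    rw [Polynomial.coeff_X_mul, hd, Polynomial.coeff_pow_mul_natDegree]
  have c4 : (2 * Polynomial.X * p).coeff (d + 1) = 2 * p.leadingCoeff := by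
    have h2 : (2 : Polynomial K) = Polynomial.C 2 := rfl
    rw [mul_assoc, h2, Polynomial.coeff_C_mul, Polynomial.coeff_X_mul]; rfl
  have c1 : p.coeff d = p.leadingCoeff := rfl
  rw [c1] at hp1
  rw [c2] at hp2
  rw [c4] at hp4
  have hC2 : (C (2 : K) : Plane K) = 2 := map_ofNat C 2
  have hpw : ∀ k : ℕ, (-X 1 ^ 2 : Plane K) ^ k = (-1) ^ k * (X 1 ^ k) ^ 2 := fun k => by
    rw [neg_pow]; ring
  have hsq : ((-1 : Plane K) ^ d) ^ 2 = 1 := by rw [← pow_mul, mul_comm, pow_mul]; simp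
  rcases hi i with rfl | rfl | rfl
  · have h0 := isSym_g (M := M) (ρ := (2 * d + 1 : ℕ)) (σ := 1) 0
    have h1 := hp1.mul (isSym_g (M := M) (ρ := (2 * d + 1 : ℕ)) (σ := 1) 1)
    have e1 : (2 * 1 * d : ℤ) + wtm (2 * d + 1 : ℕ) 1 (expG 1) =
      wtm (2 * d + 1 : ℕ) 1 (expG 0) := by simp [wtm, expG]; ring
    have e2 : (2 * 1 * (2 * d + 1 : ℕ) : ℤ) = wtm (2 * d + 1 : ℕ) 1 (expG 0) := by
      simp [wtm, expG]; ring
    rw [e1] at h1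
    rw [e2] at hp2 hp3
    have h2 := (h0.sub h1).add (hp3.sub hp2)
    rw [← map_sub] at h2
    refine key h2 rfl ?_
    simp only [symG, delSub, Matrix.cons_val_zero, Matrix.cons_val_one, map_pow, aeval_X, hpw,
      map_neg, map_mul, C_1]
    ring
  · have h1 := (isSym_g (M := M) (ρ := (2 * d + 1 : ℕ)) (σ := 1) 1).add
      (key hp4 (m := wtm (2 * d + 1 : ℕ) 1 (expG 1)) (by simp [wtm, expG]; ring) rfl)
    refine key h1 rfl ?_
    simp only [symG, delSub, Matrix.cons_val_zero, Matrix.cons_val_one, map_pow, aeval_X, hpw,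
      map_neg, map_mul, C_1, map_ofNat, hC2]
    ring
  · refine key (isSym_g (M := M) (ρ := (2 * d + 1 : ℕ)) (σ := 1) 2) rfl ?_
    simp [symG, delSub]


theorem IsSym.del {p : Polynomial K} (hp : p.natDegree ≠ 0) {a : A} {u : Plane K}
    (ha : M.IsSym (2 * p.natDegree + 1 : ℕ) 1 n a u) :
    M.IsSym (2 * p.natDegree + 1 : ℕ) 1 n ((M.del p : A ≃ₐ[K] A) a)
      (delSub (-(p.leadingCoeff * (-1) ^ p.natDegree)) (2 * p.natDegree + 1) u) := by
  refine IsSym.map (φ := ((M.del p : A ≃ₐ[K] A) : A →ₐ[K] A)) (fun i => ?_) ha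
  have hi : ∀ i : Fin 3, (i = 0 ∨ i = 1 ∨ i = 2) := by decide
  have : (M.del p : A ≃ₐ[K] A) (M.g i) = M.delImage p i := by
    rcases hi i with rfl | rfl | rfl
    exacts [del_zero p, del_one p, del_two p]
  change M.IsSym _ 1 _ ((M.del p : A ≃ₐ[K] A) (M.g i)) _
  rw [this]
  exact isSym_delImage hp i

end SlModel

end LeadingForms

section Reduction

variable {A : Type*} [Ring A] [Algebra K A] {M : SlModel K lam A} {ρ σ m n : ℤ}

theorem apply_eq_zero_of_pderiv_eq_zero {i : Fin 2} {u : Plane K} (h : pderiv i u = 0)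
    {d : Fin 2 →₀ ℕ} (hd : coeff d u ≠ 0) : d i = 0 := by
  by_contra hi
  have h1 := congr_arg (coeff (d - Finsupp.single i 1)) h
  have h2 : d - Finsupp.single i 1 + Finsupp.single i 1 = d :=
    tsub_add_cancel_of_le (by simpa [Finsupp.single_le_iff] using Nat.one_le_iff_ne_zero.2 hi)
  rw [coeff_pderiv, h2, coeff_zero] at h1
  exact (mul_ne_zero hd (Nat.cast_add_one_ne_zero _)) h1

theorem IsQH.eq_monomial {n : ℕ} {u : Plane K} (hu : IsQH 1 1 n u) (h : pderiv 0 u = 0) :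
    u = monomial (Finsupp.single 1 n) (coeff (Finsupp.single 1 n) u) := by
  ext d
  rw [coeff_monomial]
  split_ifs with hd
  · rw [hd]
  · by_contra h1
    have h2 := hu d h1
    have h3 := apply_eq_zero_of_pderiv_eq_zero h h1
    refine hd (Finsupp.ext fun i => ?_)
    unfold wtm at h2
    have hi : ∀ i : Fin 2, i = 0 ∨ i = 1 := by decide
    rcases hi i with rfl | rfl
    · simp [h3]
    · simp; omega

namespace SlModel

theorem pev_injective : Function.Injective M.pev := by
  refine (injective_iff_map_eq_zero _).2 fun p hp => ?_
  by_contra h0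
  have h := isSym_pev (M := M) (ρ := 1) (σ := 1) one_pos (le_refl p.natDegree)
  rw [hp] at h
  have := h.eq_zero (by norm_num)
  rw [mul_eq_zero, C_eq_zero] at this
  rcases this with h | h
  · exact h0 (Polynomial.leadingCoeff_eq_zero.1 h)
  · simp at h

theorem isSym_eq_algebraMap {a : A} {u : Plane K} (ha : M.IsSym 1 1 0 a u) :
    ∃ c, a = algebraMap K A c := by
  have h0 : u = C (coeff 0 u) := by
    ext d
    rw [coeff_C]
    split_ifs with hd
    · rw [hd]
    · by_contra h
      have h1 := ha.isQH d h
      unfold wtm at h1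
      have hi : ∀ i : Fin 2, i = 0 ∨ i = 1 := by decide
      refine hd (Finsupp.ext fun i => ?_)
      rcases hi i with rfl | rfl <;> simp <;> omega
  have h1 := ha.sub (isSym_algebraMap (M := M) (ρ := 1) (σ := 1) (coeff 0 u))
  rw [← h0, sub_self] at h1
  have h2 := isLow_neg (n := 0 - 1) zero_le_one zero_le_one (by norm_num)
    (h1.descend (by norm_num))
  exact ⟨_, sub_eq_zero.1 h2⟩

theorem isSym_pev_monomial {c : K} (k : ℕ) : ∃ p, M.IsSym 1 1 (2 * k : ℕ) (M.pev p)
    (monomial (Finsupp.single 1 (2 * k)) c) := by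
  refine ⟨Polynomial.monomial k (c * (-1) ^ k), ?_⟩
  have h := isSym_pev (M := M) (ρ := 1) (σ := 1) one_pos
    (Polynomial.natDegree_monomial_le (m := k) (c * (-1) ^ k))
  convert h using 1
  · push_cast; ring
  · rw [Polynomial.coeff_monomial, if_pos rfl, neg_pow (X 1 ^ 2 : Plane K), C_mul, C_pow, C_neg, C_1, mul_assoc,
      ← mul_assoc ((-1) ^ k), ← mul_pow, neg_one_mul, neg_neg, one_pow, one_mul, ← pow_mul,
      C_mul_X_pow_eq_monomial]

theorem exists_eq_pev {b : A} {c : K} (hb : M.br b (M.g 2) = algebraMap K A c) :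
    ∃ p, b = M.pev p := by
  obtain ⟨n, u, hn⟩ := M.exists_isLow b
  induction n generalizing b u with
  | zero =>
    obtain ⟨c, rfl⟩ := isSym_eq_algebraMap hn
    exact ⟨Polynomial.C c, (pev_C c).symm⟩
  | succ n ih =>
    have h1 := hn.br (isSym_g (M := M) (ρ := 1) (σ := 1) 2)
    have h2 := (isSym_algebraMap (M := M) (ρ := 1) (σ := 1) c).of_lt
      (m := ((n + 1 : ℕ) : ℤ) + wtm 1 1 (expG 2) - (1 + 1)) (by simp [wtm, expG])
    rw [hb] at h1
    have h3 := h1.unique (by norm_num) h2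
    have h4 : pderiv 0 u = 0 := by
      have h5 : C (2⁻¹ : K) * (2 * X 1 * pderiv 0 u) = 0 := by
        rw [← h3, ham_apply]
        simp [symG, pderiv_X_of_ne]
        ring
      simpa using h5
    have h5 := hn.isQH.eq_monomial h4
    by_cases h6 : coeff (Finsupp.single 1 (n + 1)) u = 0
    · rw [h6, map_zero] at h5
      rw [h5] at hn
      obtain ⟨v, hv⟩ := hn.descend (by norm_num)
      exact ih hb v (by simpa using hv)
    · have h7 := hn.evenSupp _ h6
      obtain ⟨k, hk⟩ : ∃ k, n + 1 = 2 * k := ⟨(n + 1) / 2, by simp at h7; omega⟩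
      obtain ⟨p, hp⟩ := isSym_pev_monomial (M := M) (c := coeff (Finsupp.single 1 (n + 1)) u) k
      rw [← hk, ← h5] at hp
      have h8 := hn.sub hp
      rw [sub_self] at h8
      obtain ⟨v, hv⟩ := h8.descend (by norm_num)
      obtain ⟨q, hq⟩ := ih (b := b - M.pev p) (by
        rw [map_sub, LinearMap.sub_apply, hb, ← pev_X, br_pev_pev, sub_zero]) v (by simpa using hv)
      exact ⟨q + p, by rw [map_add, ← hq, sub_add_cancel]⟩

variable (M) in
/-- Local nilpotency of the inner derivation of `q`. -/
def IsNil (q : A) : Prop := ∀ a, ∃ m, (M.ad q)^[m] a = 0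

theorem isNil_of_gen {q : A} (h : ∀ i, ∃ m, (M.ad q)^[m] (M.g i) = 0) : M.IsNil q := by
  intro a
  have ha : a ∈ Algebra.adjoin K (Set.range M.g) := by rw [M.adjoin_eq_top]; trivial
  induction ha using Algebra.adjoin_induction with
  | mem x hx => obtain ⟨i, rfl⟩ := hx; exact h i
  | algebraMap c => exact ⟨1, by simp [ad_apply, br_algebraMap_right]⟩
  | add a b _ _ ha hb =>
    obtain ⟨m, hm⟩ := ha
    obtain ⟨n, hn⟩ := hb
    refine ⟨max m n, ?_⟩
    rw [iterate_map_add, iterate_eq_zero_of_le hm (le_max_left _ _),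
      iterate_eq_zero_of_le hn (le_max_right _ _), add_zero]
  | mul a b _ _ ha hb =>
    obtain ⟨m, hm⟩ := ha
    obtain ⟨n, hn⟩ := hb
    exact ⟨m + n, iterate_leibniz_eq_zero (M.ad_mul q) hm hn⟩

theorem isNil_g_two : M.IsNil (M.g 2) := by
  refine isNil_of_gen fun i => ⟨3, ?_⟩
  have hi : ∀ i : Fin 3, (i = 0 ∨ i = 1 ∨ i = 2) := by decide
  rcases hi i with rfl | rfl | rfl <;>
  simp [ad_apply, br_fe, br_fh, M.alt, two_mul]

theorem IsNil.map {q : A} (h : M.IsNil q) (φ : M.autGroup) : M.IsNil ((φ : A ≃ₐ[K] A) q) := by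
  intro a
  obtain ⟨m, hm⟩ := h ((φ : A ≃ₐ[K] A).symm a)
  refine ⟨m, ?_⟩
  have key : ∀ m b, (M.ad ((φ : A ≃ₐ[K] A) q))^[m] ((φ : A ≃ₐ[K] A) b) =
      (φ : A ≃ₐ[K] A) ((M.ad q)^[m] b) := by
    intro m
    induction m with
    | zero => intro b; rfl
    | succ m ih =>
      intro b
      rw [Function.iterate_succ_apply, Function.iterate_succ_apply, ← ih, ad_apply, ad_apply,
        ← φ.2]
  rw [← (φ : A ≃ₐ[K] A).apply_symm_apply a, key, hm, map_zero]

theorem IsNil.hamHom {q : A} (h : M.IsNil q) {s : Plane K} (hρ : 0 < ρ + σ)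
    (hs : M.IsSym ρ σ n q s) (u : Plane K) : ∃ m, (hamHom s)^[m] u = 0 := by
  have key : ∀ i, ∃ m, (_root_.hamHom s)^[m] (symG i) = 0 := by
    intro i
    obtain ⟨m, hm⟩ := h (M.g i)
    refine ⟨m, ?_⟩
    have h1 : ∀ m : ℕ, M.IsSym ρ σ (wtm ρ σ (expG i) + m * (n - (ρ + σ))) ((M.ad q)^[m] (M.g i))
        ((_root_.hamHom s)^[m] (symG i)) := by
      intro m
      induction m with
      | zero => simpa using isSym_g i
      | succ m ih =>
        rw [Function.iterate_succ_apply', Function.iterate_succ_apply']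
        have := hs.br ih
        rw [show n + (wtm ρ σ (expG i) + m * (n - (ρ + σ))) - (ρ + σ) =
          wtm ρ σ (expG i) + (m + 1 : ℕ) * (n - (ρ + σ)) by push_cast; ring] at this
        exact this
    have h2 := h1 m
    rw [hm] at h2
    exact h2.eq_zero hρ
  refine hamHom_locally_nilpotent hs.mem_evenPart (key 0) ?_ ?_ u
  · obtain ⟨m, hm⟩ := key 1
    refine ⟨m, ?_⟩
    simp only [symG, Matrix.cons_val_one, Matrix.cons_val_zero] at hm
    rw [mul_assoc, two_mul, iterate_map_add, ← two_mul] at hm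
    simpa using hm
  · obtain ⟨m, hm⟩ := key 2
    refine ⟨m, ?_⟩
    simp only [symG, Matrix.cons_val] at hm
    rwa [iterate_map_neg, neg_eq_zero] at hm

end SlModel

end Reduction

section Generation

variable {A : Type*} [Ring A] [Algebra K A] {M : SlModel K lam A} {ρ σ m n : ℤ}

/-- The lower triangular unipotent matrix. -/
def lowerUni (a : K) : Matrix.SpecialLinearGroup (Fin 2) K :=
  ⟨!![1, 0; a, 1], by simp [Matrix.det_fin_two]⟩

/-- The Weyl element. -/
def weylMat : Matrix.SpecialLinearGroup (Fin 2) K :=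
  ⟨!![0, 1; -1, 0], by simp [Matrix.det_fin_two]⟩

/-- The diagonal matrix with entries `u⁻¹`, `u`. -/
def diagMat (u : K) (hu : u ≠ 0) : Matrix.SpecialLinearGroup (Fin 2) K :=
  ⟨!![u⁻¹, 0; 0, u], by simp [Matrix.det_fin_two, hu]⟩

namespace SlModel

theorem linSub_weyl (u : Plane K) : pderiv 1 u = 0 → pderiv 0 (linSub (weylMat (K := K)) u) = 0 := by
  intro h
  have h1 := pderiv_aeval_plane ![C (0 : K) * X 0 + C (-1) * X 1, C (1 : K) * X 0 + C 0 * X 1] 0 u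
  simpa [linSub, weylMat, h, pderiv_X_of_ne] using h1

theorem exists_linSub [IsAlgClosed K] {n : ℕ} (hn : 0 < n) {u : Plane K} (hu : IsQH 1 1 n u)
    (heven : u ∈ evenPart K) (hnil : ∀ v, ∃ m, (hamHom u)^[m] v = 0) :
    ∃ s t : Matrix.SpecialLinearGroup (Fin 2) K, pderiv 0 (linSub s (linSub t u)) = 0 := by
  by_cases hx : pderiv 0 u = 0
  · refine ⟨1, 1, ?_⟩
    have h1 : linSub (1 : Matrix.SpecialLinearGroup (Fin 2) K) = AlgHom.id K _ := by
      refine MvPolynomial.algHom_ext fun i => ?_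
      fin_cases i <;> simp [linSub]
    rw [h1]
    exact hx
  · obtain ⟨-, -, a, ha⟩ := IsQH.exists_triangular one_pos one_pos hn (Nat.coprime_one_right 1)
      heven (by simpa using hu) hnil hx (Or.inl ⟨rfl, rfl⟩)
    refine ⟨weylMat, lowerUni a, linSub_weyl _ ?_⟩
    simpa [linSub, lowerUni] using ha

theorem lift_mem_range_pev {U : Plane K} (h : ∀ d, coeff d U ≠ 0 → d 0 = 0) :
    ∃ p, M.lift U = M.pev p := by
  suffices M.lift U ∈ M.pev.range by obtain ⟨p, hp⟩ := this; exact ⟨p, hp.symm⟩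
  rw [U.as_sum, map_sum]
  refine sum_mem fun d hd => ?_
  rw [lift_monomial]
  refine Subalgebra.smul_mem _ ?_ _
  rw [stdMon, h d (mem_support_iff.1 hd)]
  refine ⟨Polynomial.X ^ (d 1 / 2), ?_⟩
  simp [pev_X]

theorem lift_case {n : ℕ} {U : Plane K} (hw : U ∈ weightLE K 1 1 n)
    (hU : ∀ d, wtm 1 1 d = n → coeff d U ≠ 0 → d 0 = 0) :
    (∀ d, coeff d U ≠ 0 → d 0 = 0) ∨ ∃ ρ σ : ℕ, 0 < σ ∧ σ < ρ ∧ ρ.Coprime σ ∧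
      (U ∈ weightLE K ρ σ (σ * n : ℕ)) ∧ ∃ d, coeff d U ≠ 0 ∧ 0 < d 0 ∧ wtm ρ σ d = (σ * n : ℕ) := by
  by_cases h : ∀ d, coeff d U ≠ 0 → d 0 = 0
  · exact Or.inl h
  right
  push Not at h
  obtain ⟨d₁, hd₁, hd₁'⟩ := h
  obtain ⟨d, hd, hmax⟩ := (U.support.filter fun d => d 0 ≠ 0).exists_max_image
    (fun d => (d 0 : ℚ) / ((n : ℚ) - d 1)) ⟨d₁, by simp [hd₁, hd₁']⟩
  have hlt : ∀ d, coeff d U ≠ 0 → d 0 ≠ 0 → d 0 + d 1 < n := by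
    intro d h1 h2
    have h3 := hw d h1
    have h4 : wtm 1 1 d ≠ n := fun h => h2 (hU d h h1)
    unfold wtm at h3 h4
    omega
  rw [Finset.mem_filter, mem_support_iff] at hd
  have hd2 := hlt d hd.1 hd.2
  have hg : 0 < Nat.gcd (n - d 1) (d 0) := Nat.gcd_pos_of_pos_right _ (Nat.pos_of_ne_zero hd.2)
  obtain ⟨g, ρ, σ, hg0, hco, hρ, hσ⟩ := Nat.exists_coprime' hg
  have hσ0 : 0 < σ := by
    rcases Nat.eq_zero_or_pos σ with rfl | h
    · omega
    · exact h
  have hn : n = ρ * g + d 1 := by omega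
  refine ⟨ρ, σ, hσ0, ?_, hco, ?_, d, hd.1, by omega, ?_⟩
  · by_contra hle
    have := Nat.mul_le_mul_right g (not_lt.1 hle)
    omega
  · intro d' hd'
    by_cases h0 : d' 0 = 0
    · have h3 := hw d' hd'
      unfold wtm at h3 ⊢
      rw [h0] at h3 ⊢
      push_cast
      nlinarith
    · have h1 := hmax d' (by simp [hd', h0])
      have h2 := hlt d' hd' h0
      have h3 : (0 : ℚ) < n - d' 1 := by
        have : (d' 1 : ℚ) < n := by exact_mod_cast (by omega : d' 1 < n)
        linarith
      have h4 : (0 : ℚ) < n - d 1 := by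
        have : (d 1 : ℚ) < n := by exact_mod_cast (by omega : d 1 < n)
        linarith
      rw [div_le_div_iff₀ h3 h4] at h1
      have h5 : (d' 0 : ℤ) * (n - d 1) ≤ d 0 * (n - d' 1) := by exact_mod_cast h1
      have h6 : (n : ℤ) - d 1 = ρ * g := by rw [hn]; push_cast; ring
      rw [h6, hσ] at h5
      have h7 : (g : ℤ) * (d' 0 * ρ) ≤ g * (σ * (n - d' 1)) := by push_cast at h5; linarith
      have h8 := le_of_mul_le_mul_left h7 (by exact_mod_cast hg0)
      unfold wtm
      push_cast
      linarith
  · unfold wtm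
    rw [hσ, hn]
    push_cast
    ring

variable (M) in
/-- The subgroup of tame automorphisms. -/
def tame : Subgroup M.autGroup := Subgroup.closure (Set.range M.lin ∪ Set.range M.del)

theorem lin_mem_tame (s) : M.lin s ∈ M.tame := Subgroup.subset_closure (Or.inl ⟨s, rfl⟩)

theorem del_mem_tame (p) : M.del p ∈ M.tame := Subgroup.subset_closure (Or.inr ⟨p, rfl⟩)

theorem exists_tame_pev [IsAlgClosed K] (n : ℕ) {q : A} (hq : M.IsNil q) (hn : M.IsLow 1 1 n q) :
    ∃ ψ ∈ M.tame, ∃ p, (ψ : A ≃ₐ[K] A) q = M.pev p := by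
  induction n generalizing q with
  | zero =>
    obtain ⟨u, hu⟩ := hn
    obtain ⟨c, rfl⟩ := isSym_eq_algebraMap hu
    exact ⟨1, one_mem _, Polynomial.C c, (pev_C c).symm⟩
  | succ n ih =>
    obtain ⟨u, hu⟩ := hn
    have hmove : ∀ (ψ₁ : M.autGroup) (_ : ψ₁ ∈ M.tame) (u' : Plane K)
        (_ : M.IsSym 1 1 (n + 1 : ℕ) ((ψ₁ : A ≃ₐ[K] A) q) u') (_ : pderiv 0 u' = 0),
        ∃ ψ ∈ M.tame, ∃ p, (ψ : A ≃ₐ[K] A) q = M.pev p := by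
      intro ψ₁ hψ₁ u' hu' hx
      suffices h : ∃ ψ ∈ M.tame, ∃ p, (ψ : A ≃ₐ[K] A) ((ψ₁ : A ≃ₐ[K] A) q) = M.pev p by
        obtain ⟨ψ, hψ, p, hp⟩ := h
        exact ⟨ψ * ψ₁, mul_mem hψ hψ₁, p, hp⟩
      replace hq := hq.map ψ₁
      generalize (ψ₁ : A ≃ₐ[K] A) q = q at *
      have hmono := hu'.isQH.eq_monomial hx
      by_cases hc : coeff (Finsupp.single 1 (n + 1)) u' = 0
      · rw [hc, map_zero] at hmono
        rw [hmono] at hu'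
        exact ih hq (by simpa using hu'.descend (by norm_num))
      obtain ⟨U, hev, hw, hU⟩ := exists_lift hu'.isLow
      have h1 := isSym_lift (M := M) hev hw
      rw [hU] at h1
      have h2 := h1.unique (by norm_num) hu'
      have h3 : ∀ d, wtm 1 1 d = (n + 1 : ℕ) → coeff d U = coeff d u' := by
        intro d hd
        rw [← h2, coeff_wcomp, if_pos hd]
      rcases lift_case hw (fun d hd hd' => apply_eq_zero_of_pderiv_eq_zero hx (by rwa [← h3 d hd]))
        with h4 | ⟨ρ, σ, hσ, hσρ, hco, hw', d, hd, hd0, hdw⟩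
      · obtain ⟨p, hp⟩ := lift_mem_range_pev (M := M) h4
        exact ⟨1, one_mem _, p, by rw [← hp, hU]; rfl⟩
      have h5 := isSym_lift (M := M) hev hw'
      rw [hU] at h5
      have h6 : coeff (Finsupp.single 1 (n + 1)) (wcomp K ρ σ (σ * (n + 1) : ℕ) U) ≠ 0 := by
        rw [coeff_wcomp, if_pos (by simp [wtm]), h3 _ (by simp [wtm])]
        exact hc
      have h7 : coeff d (wcomp K ρ σ (σ * (n + 1) : ℕ) U) ≠ 0 := by
        rwa [coeff_wcomp, if_pos hdw]
      generalize wcomp K ρ σ (σ * (n + 1) : ℕ) U = s at h5 h6 h7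
      obtain ⟨rfl, ⟨k, rfl⟩, a, ha⟩ := IsQH.exists_triangular (by omega) hσ n.succ_pos hco
        h5.mem_evenPart h5.isQH (hq.hamHom (by omega) h5)
        (fun h => hd0.ne' (apply_eq_zero_of_pderiv_eq_zero h h7)) (Or.inr ⟨hσρ, h6⟩)
      have hk : k ≠ 0 := by omega
      have ha0 : a ≠ 0 := by
        rintro rfl
        have h8 : (![X 0 + C 0 * X 1 ^ (2 * k + 1), X 1] : Fin 2 → Plane K) = X := by
          funext i; fin_cases i <;> simp
        rw [h8, aeval_X_left_apply] at ha
        simpa using apply_eq_zero_of_pderiv_eq_zero ha h6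
      set p := Polynomial.monomial k (-(a * (-1) ^ k)) with hp
      have hp0 : -(a * (-1) ^ k) ≠ 0 := by simp [ha0]
      have hpd : p.natDegree = k := Polynomial.natDegree_monomial_eq k hp0
      have hpl : p.leadingCoeff = -(a * (-1) ^ k) := Polynomial.leadingCoeff_monomial _ _
      have h9 := IsSym.del (M := M) (p := p) (n := (n + 1 : ℕ)) (a := q) (u := s) (by rwa [hpd])
        (by rw [hpd]; simpa using h5)
      have hsq : ((-1 : K) ^ k) * (-1) ^ k = 1 := by rw [← mul_pow]; simp
      rw [hpl, hpd, show -(-(a * (-1) ^ k) * (-1) ^ k) = a by linear_combination a * hsq] at h9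
      have h10 : pderiv 1 (delSub a (2 * k + 1) s) = 0 := ha
      have h11 := h9.change (ρ' := 1) (σ' := 1) (n' := (n + 1 : ℕ))
        (fun d hd => by unfold wtm at hd ⊢; push_cast at hd ⊢; nlinarith)
        (fun d hd => by unfold wtm at hd ⊢; push_cast at hd ⊢; nlinarith)
      have h12 : wcomp K 1 1 (n + 1 : ℕ) (delSub a (2 * k + 1) s) = 0 := by
        ext d
        rw [coeff_wcomp, coeff_zero]
        split_ifs with hd
        · by_contra h
          have e1 := apply_eq_zero_of_pderiv_eq_zero h10 h
          have e2 := h9.isQH d h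
          unfold wtm at e2 hd
          rw [e1] at e2 hd
          push_cast at e2 hd
          have : (0 : ℤ) < k := by omega
          nlinarith
        · rfl
      rw [h12] at h11
      obtain ⟨ψ, hψ, r, hr⟩ := ih (hq.map (M.del p)) (by simpa using h11.descend (by norm_num))
      exact ⟨ψ * M.del p, mul_mem hψ (del_mem_tame p), r, hr⟩
    obtain ⟨s, t, hst⟩ := exists_linSub n.succ_pos hu.isQH hu.mem_evenPart
      (hq.hamHom (by norm_num) hu)
    exact hmove (M.lin s * M.lin t) (mul_mem (lin_mem_tame s) (lin_mem_tame t)) _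
      (IsSym.lin s (IsSym.lin t hu)) hst

end SlModel

end Generation

section Elementary

variable {A : Type*} [Ring A] [Algebra K A] {M : SlModel K lam A} {ρ σ m n : ℤ}

namespace SlModel

theorem eq_zero_of_two_X_mul_derivative {R : Polynomial K}
    (h : -(2 * Polynomial.X * Polynomial.derivative R) = 2 * R) : R = 0 := by
  ext n
  have h1 := congrArg (fun p => Polynomial.coeff p n) h
  have h2 : (2 : Polynomial K) = Polynomial.C 2 := rfl
  simp only [h2, mul_assoc, Polynomial.coeff_neg, Polynomial.coeff_C_mul] at h1
  have h3 : (2 * (n + 1 : K)) * R.coeff n = 0 := by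
    cases n with
    | zero =>
      simp at h1
      simp [h1]
    | succ n =>
      rw [Polynomial.coeff_X_mul, Polynomial.coeff_derivative] at h1
      push_cast
      linear_combination -h1
  rw [Polynomial.coeff_zero]
  exact (mul_eq_zero.1 h3).resolve_left (mul_ne_zero two_ne_zero (Nat.cast_add_one_ne_zero n))

theorem eq_one_of_fix {φ : M.autGroup} {c : K}
    (h1 : (φ : A ≃ₐ[K] A) (M.g 1) = M.g 1 + algebraMap K A c)
    (h2 : (φ : A ≃ₐ[K] A) (M.g 2) = M.g 2) : φ = 1 := by
  have hb : ∀ a b, M.br ((φ : A ≃ₐ[K] A) a) ((φ : A ≃ₐ[K] A) b) = (φ : A ≃ₐ[K] A) (M.br a b) :=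
    fun a b => (φ.2 a b).symm
  have h3 : M.br ((φ : A ≃ₐ[K] A) (M.g 0) - M.g 0) (M.g 2) = algebraMap K A c := by
    rw [map_sub, LinearMap.sub_apply]
    nth_rw 1 [← h2]
    rw [hb, br_ef, h1, add_sub_cancel_left]
  obtain ⟨R, hR⟩ := exists_eq_pev h3
  have hc : algebraMap K A c = 0 := by
    rw [← h3, hR, ← pev_X, br_pev_pev]
  rw [hc, add_zero] at h1
  have h4 : M.br (M.g 1) ((φ : A ≃ₐ[K] A) (M.g 0) - M.g 0) = M.pev (2 * R) := by
    rw [map_mul, pev_two, ← hR, map_sub]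
    nth_rw 1 [← h1]
    rw [hb, br_he, map_mul, map_ofNat, mul_sub]
  rw [hR, br_h_pev, ← map_neg] at h4
  have h5 := eq_zero_of_two_X_mul_derivative (pev_injective h4)
  rw [h5, map_zero, sub_eq_zero] at hR
  refine autGroup_ext fun i => ?_
  fin_cases i
  · exact hR
  · exact h1
  · exact h2

theorem mem_tame_of_fix_f {φ : M.autGroup} {R : Polynomial K}
    (h1 : (φ : A ≃ₐ[K] A) (M.g 1) = M.g 1 + M.pev R)
    (h2 : (φ : A ≃ₐ[K] A) (M.g 2) = M.g 2) : φ ∈ M.tame := by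
  have h3 : M.del (-(Polynomial.C 2⁻¹ * R.divX)) * φ = 1 := by
    refine eq_one_of_fix (c := R.coeff 0) ?_ ?_
    · rw [Subgroup.coe_mul, AlgEquiv.mul_apply, h1, map_add, del_one, ← pev_C]
      have h4 := delImage_hom (M := M) (φ := ((M.del (-(Polynomial.C 2⁻¹ * R.divX)) : A ≃ₐ[K] A) : A →ₐ[K] A)) (del_two _) R
      rw [AlgEquiv.coe_toAlgHom] at h4
      rw [h4]
      simp only [delImage, Matrix.cons_val_one, Matrix.cons_val_zero]
      rw [add_assoc, ← map_add]
      congr 2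
      have h5 : Polynomial.C (2 : K) * Polynomial.C 2⁻¹ = 1 := by
        rw [← Polynomial.C_mul]; simp
      have h6 : (2 : Polynomial K) = Polynomial.C 2 := rfl
      rw [h6]
      linear_combination -(Polynomial.X * R.divX) * h5 - R.divX_mul_X_add
    · rw [Subgroup.coe_mul, AlgEquiv.mul_apply, h2, del_two]
  rw [← inv_eq_iff_mul_eq_one.2 h3]
  exact inv_mem (del_mem_tame _)

theorem mem_tame_of_affine [IsAlgClosed K] {φ : M.autGroup} {α β : K} (hα : α ≠ 0)
    (h2 : (φ : A ≃ₐ[K] A) (M.g 2) = α • M.g 2 + algebraMap K A β) : φ ∈ M.tame := by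
  have h3 := φ.2 (M.g 1) (M.g 2)
  rw [br_hf, h2, map_add, br_algebraMap_right, add_zero, map_mul, map_neg, map_ofNat, h2,
    map_smul] at h3
  have h4 : M.br ((φ : A ≃ₐ[K] A) (M.g 1) - M.g 1) (M.g 2) = algebraMap K A (α⁻¹ * (-2 * β)) := by
    have h5 : M.br ((φ : A ≃ₐ[K] A) (M.g 1)) (M.g 2) = α⁻¹ • (-2 * (α • M.g 2 + algebraMap K A β)) := by
      rw [h3, inv_smul_smul₀ hα]
    rw [map_sub, LinearMap.sub_apply, h5, br_hf, map_mul, map_mul, map_neg, map_ofNat, mul_add,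
      smul_add, mul_smul_comm, inv_smul_smul₀ hα, add_sub_cancel_left, Algebra.smul_def]
  obtain ⟨R, hR⟩ := exists_eq_pev h4
  rw [hR, ← pev_X, br_pev_pev] at h4
  have hβ : β = 0 := by
    rw [← pev_C, ← map_zero M.pev] at h4
    have := pev_injective h4
    simpa [hα] using this.symm
  rw [hβ, map_zero, add_zero] at h2
  obtain ⟨u, hu⟩ := IsAlgClosed.exists_pow_nat_eq α⁻¹ two_pos
  have hu0 : u ≠ 0 := by rintro rfl; simp [eq_comm, hα] at hu
  have h6 : M.lin (diagMat u hu0) * φ ∈ M.tame := by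
    refine mem_tame_of_fix_f (R := R.comp (Polynomial.C (u ^ 2) * Polynomial.X)) ?_ ?_
    · rw [Subgroup.coe_mul, AlgEquiv.mul_apply, sub_eq_iff_eq_add'.1 hR, map_add, lin_one]
      congr 1
      · simp [linImage, diagMat, hu0]
      · have h7 := Polynomial.aeval_algHom_apply ((M.lin (diagMat u hu0) : A ≃ₐ[K] A) : A →ₐ[K] A)
          (M.g 2) R
        rw [AlgEquiv.coe_toAlgHom, lin_two] at h7
        rw [pev, ← h7, Polynomial.aeval_comp]
        congr 2
        simp [linImage, diagMat, Algebra.smul_def]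
    · rw [Subgroup.coe_mul, AlgEquiv.mul_apply, h2, map_smul, lin_two]
      simp [linImage, diagMat, hu, hα]
  rw [← mul_mem_cancel_left (lin_mem_tame (diagMat u hu0))]
  exact h6

theorem mem_tame_of_pev [IsAlgClosed K] {φ : M.autGroup} {P : Polynomial K}
    (h : (φ : A ≃ₐ[K] A) (M.g 2) = M.pev P) : φ ∈ M.tame := by
  obtain ⟨Q, hQ⟩ : ∃ Q, ((φ⁻¹ : M.autGroup) : A ≃ₐ[K] A) (M.g 2) = M.pev Q := by
    refine exists_eq_pev (c := 0) ?_
    apply (φ : A ≃ₐ[K] A).injective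
    rw [φ.2, h, ← AlgEquiv.mul_apply, ← Subgroup.coe_mul, mul_inv_cancel]
    simp [br_f_pev]
  have h1 : M.g 2 = M.pev (Q.comp P) := by
    have h2 := congrArg (φ : A ≃ₐ[K] A) hQ
    rw [← AlgEquiv.mul_apply, ← Subgroup.coe_mul, mul_inv_cancel] at h2
    have h7 := Polynomial.aeval_algHom_apply ((φ : A ≃ₐ[K] A) : A →ₐ[K] A) (M.g 2) Q
    rw [AlgEquiv.coe_toAlgHom, h] at h7
    change M.g 2 = _ at h2
    rw [h2, pev, ← h7, Polynomial.aeval_comp]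
    rfl
  have h2 := pev_injective ((pev_X (M := M)).trans h1)
  have h3 := congrArg Polynomial.natDegree h2
  rw [Polynomial.natDegree_X, Polynomial.natDegree_comp, eq_comm, mul_eq_one] at h3
  have h4 := Polynomial.eq_X_add_C_of_natDegree_le_one h3.2.le
  refine mem_tame_of_affine (α := P.coeff 1) (β := P.coeff 0) ?_ ?_
  · rw [← h3.2]
    intro h5
    have := Polynomial.leadingCoeff_eq_zero.1 h5
    simp [this] at h3
  · rw [h, h4]
    simp [pev_X, pev_C, Algebra.smul_def]

theorem tame_eq_top [IsAlgClosed K] : M.tame = ⊤ := by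
  refine eq_top_iff.2 fun φ _ => ?_
  obtain ⟨n, hn⟩ := M.exists_isLow ((φ : A ≃ₐ[K] A) (M.g 2))
  obtain ⟨ψ, hψ, p, hp⟩ := exists_tame_pev n (isNil_g_two.map φ) hn
  rw [← mul_mem_cancel_left hψ]
  exact mem_tame_of_pev (P := p) hp

end SlModel

end Elementary

section Decomposition

variable {A : Type*} [Ring A] [Algebra K A] {M : SlModel K lam A} {ρ σ m n : ℤ}

theorem IsQH.eval_one_zero {N : ℕ} {u : Plane K} (hu : IsQH 1 1 N u) :
    eval ![1, 0] u = coeff (Finsupp.single 0 N) u := by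
  rw [eval_eq']
  have key : ∀ d, coeff d u ≠ 0 → d ≠ Finsupp.single 0 N → d 1 ≠ 0 := by
    intro d hd hne h0
    have h1 := hu d hd
    refine hne ?_
    ext i
    unfold wtm at h1
    fin_cases i
    · simp [h0] at h1 ⊢; omega
    · simp [h0]
  rw [Finset.sum_eq_single (Finsupp.single 0 N)]
  · simp [Fin.prod_univ_two]
  · intro d hd hne
    simp [Fin.prod_univ_two, key d (mem_support_iff.1 hd) hne]
  · intro h1
    rw [notMem_support_iff.1 h1, zero_mul]

namespace SlModel

variable (M) in
/-- `a` has degree `n` and its symbol is a multiple of `X 1 ^ n`. -/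
def IsVert (n : ℕ) (a : A) : Prop :=
  ∃ c : K, c ≠ 0 ∧ M.IsSym 1 1 n a (monomial (Finsupp.single 1 n) c)

variable (M) in
/-- `a` has degree `n` and its symbol involves `X 0 ^ n`. -/
def IsHor (n : ℕ) (a : A) : Prop := ∃ u, M.IsSym 1 1 n a u ∧ eval ![1, 0] u ≠ 0

theorem eval_linSub (s : Matrix.SpecialLinearGroup (Fin 2) K) (u : Plane K) (v : Fin 2 → K) :
    eval v (linSub s u) =
      eval ![s 0 0 * v 0 + s 1 0 * v 1, s 0 1 * v 0 + s 1 1 * v 1] u := by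
  induction u using MvPolynomial.induction_on with
  | C a => simp [linSub]
  | add p q hp hq => simp [hp, hq]
  | mul_X p i hp =>
    rw [map_mul, map_mul, map_mul, hp]
    fin_cases i <;> simp [linSub]

theorem IsVert.lin {n : ℕ} {a : A} (ha : M.IsVert n a)
    {s : Matrix.SpecialLinearGroup (Fin 2) K} (hs : s 0 1 ≠ 0) :
    M.IsHor n ((M.lin s : A ≃ₐ[K] A) a) := by
  obtain ⟨c, hc, ha⟩ := ha
  refine ⟨_, IsSym.lin s ha, ?_⟩
  rw [eval_linSub]
  simp [eval_monomial, hc, hs]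

theorem IsHor.del {n : ℕ} {a : A} (ha : M.IsHor n a) {p : Polynomial K} (hp : p.natDegree ≠ 0) :
    M.IsVert ((2 * p.natDegree + 1) * n) ((M.del p : A ≃ₐ[K] A) a) := by
  obtain ⟨u, hu, hc⟩ := ha
  rw [hu.isQH.eval_one_zero] at hc
  generalize hd : p.natDegree = k at hp
  have h1 := hu.change (ρ' := (2 * k + 1 : ℕ)) (σ' := 1) (n' := ((2 * k + 1) * n : ℕ))
    (fun d hd => by unfold wtm at hd ⊢; push_cast at hd ⊢; nlinarith)
    (fun d hd => by unfold wtm at hd ⊢; push_cast at hd ⊢; nlinarith)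
  have h2 : wcomp K (2 * k + 1 : ℕ) 1 ((2 * k + 1) * n : ℕ) u =
      monomial (Finsupp.single 0 n) (coeff (Finsupp.single 0 n) u) := by
    ext d
    rw [coeff_wcomp, coeff_monomial]
    by_cases h : coeff d u = 0
    · split_ifs with h3 h4 h4
      · rw [h4]
      · exact h
      · rw [h4, h]
      · rfl
    · have h3 := hu.isQH d h
      unfold wtm at h3 ⊢
      have h4 : (((2 * k + 1 : ℕ) : ℤ) * d 0 + 1 * d 1 = ((2 * k + 1) * n : ℕ)) ↔
          Finsupp.single 0 n = d := by
        constructor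
        · intro h5
          have h6 : (d 1 : ℤ) = 0 := by
            push_cast at h5
            have h7 : (2 * k : ℤ) * d 1 = 0 := by linear_combination (2 * k + 1 : ℤ) * h3 - h5
            rcases mul_eq_zero.1 h7 with h7 | h7
            · omega
            · exact h7
          ext i
          fin_cases i
          · simp; omega
          · simp; omega
        · rintro rfl
          simp
      simp only [h4]
      split_ifs with h5
      · rw [h5]
      · rfl
  rw [h2] at h1
  have h3 := IsSym.del (M := M) (p := p) (n := ((2 * k + 1) * n : ℕ)) (a := a) (by rwa [hd])
    (by rw [hd]; exact h1)
  rw [hd] at h3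
  have hb : -(p.leadingCoeff * (-1) ^ k) ≠ 0 := by
    rw [neg_ne_zero]
    refine mul_ne_zero (fun h => hp ?_) (pow_ne_zero _ (by simp))
    rw [← hd, Polynomial.leadingCoeff_eq_zero.1 h, Polynomial.natDegree_zero]
  generalize -(p.leadingCoeff * (-1) ^ k) = b at h3 hb
  generalize coeff (Finsupp.single 0 n) u = c at h3 hc
  have h4 := IsQH.eval_zero_one (σ := 1) (n := (2 * k + 1) * n) one_pos (by rw [one_mul]; exact h3.isQH)
  have h5 : eval ![0, 1] (delSub b (2 * k + 1) (monomial (Finsupp.single 0 n) c)) = c * b ^ n := by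
    rw [delSub, aeval_monomial]
    simp
  rw [h5] at h4
  refine ⟨c * b ^ n, mul_ne_zero hc (pow_ne_zero _ hb), ?_⟩
  have h6 := h3.change (ρ' := 1) (σ' := 1) (n' := ((2 * k + 1) * n : ℕ))
    (fun d hd => by unfold wtm at hd ⊢; push_cast at hd ⊢; nlinarith)
    (fun d hd => by unfold wtm at hd ⊢; push_cast at hd ⊢; nlinarith)
  convert h6 using 1
  ext d
  rw [coeff_wcomp, coeff_monomial]
  by_cases h : coeff d (delSub b (2 * k + 1) (monomial (Finsupp.single 0 n) c)) = 0
  · split_ifs with h7 h8 h8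
    · rw [h4, h7]
    · rw [h4, h7, h]
    · exact h.symm
    · rfl
  · have h8 := h3.isQH d h
    split_ifs with h7 h9 h9
    · rw [h4, h7]
    · rw [← h7] at h9
      simp [wtm] at h9
    · unfold wtm at h8 h9
      refine absurd ?_ h7
      have h10 : (d 0 : ℤ) = 0 := by
        push_cast at h8 h9
        have h7 : (2 * k : ℤ) * d 0 = 0 := by linear_combination h8 - h9
        rcases mul_eq_zero.1 h7 with h7 | h7
        · omega
        · exact h7
      rw [h10] at h9
      have h11 : d 1 = (2 * k + 1) * n := by
        rw [mul_zero, zero_add, one_mul] at h9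
        exact_mod_cast h9
      ext i
      fin_cases i
      · simp; omega
      · simp [h11]
    · rfl

theorem isSym_std (i : Fin 3) : M.IsSym 1 1 2 (M.g i) (symG i) := by
  have w : wtm 1 1 (expG i) = 2 := by fin_cases i <;> simp [wtm, expG]
  rw [← w]
  exact isSym_g i

theorem not_isHor_g {n : ℕ} (hn : 2 < n) (i : Fin 3) : ¬ M.IsHor n (M.g i) := by
  rintro ⟨u, hu, h⟩
  rw [hu.unique (by norm_num) ((isSym_std i).of_lt (by exact_mod_cast hn)), map_zero] at h
  exact h rfl

theorem not_isVert_g {n : ℕ} (hn : 2 < n) (i : Fin 3) : ¬ M.IsVert n (M.g i) := by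
  rintro ⟨c, hc, hu⟩
  have h := hu.unique (by norm_num) ((isSym_std i).of_lt (by exact_mod_cast hn))
  rw [monomial_eq_zero] at h
  exact hc h

theorem isHor_lin_zero {s : Matrix.SpecialLinearGroup (Fin 2) K} (hs : s 0 0 ≠ 0) :
    M.IsHor 2 ((M.lin s : A ≃ₐ[K] A) (M.g 0)) := by
  refine ⟨_, IsSym.lin s (isSym_std 0), ?_⟩
  rw [eval_linSub]
  simp [symG, hs]

theorem isHor_lin_two {s : Matrix.SpecialLinearGroup (Fin 2) K} (hs : s 0 1 ≠ 0) :
    M.IsHor 2 ((M.lin s : A ≃ₐ[K] A) (M.g 2)) := by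
  refine ⟨_, IsSym.lin s (isSym_std 2), ?_⟩
  rw [eval_linSub]
  simp [symG, hs]

theorem lin_eq_one_iff {s : Matrix.SpecialLinearGroup (Fin 2) K} :
    M.lin s = 1 ↔ s 0 0 ^ 2 = 1 ∧ s 0 1 = 0 ∧ s 1 0 = 0 := by
  constructor
  · intro h
    have key : ∀ i v, eval v (linSub s (symG i)) = eval v (symG i) := by
      intro i v
      have h1 := IsSym.lin s (isSym_std (M := M) i)
      rw [h] at h1
      rw [h1.unique (by norm_num) (isSym_std i)]
    have h1 := key 0 ![1, 0]
    have h2 := key 0 ![0, 1]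
    have h3 := key 2 ![1, 0]
    rw [eval_linSub] at h1 h2 h3
    refine ⟨by simpa [symG] using h1, by simpa [symG] using h3, by simpa [symG] using h2⟩
  · rintro ⟨h00, h01, h10⟩
    have hd := det_eq s
    rw [h01, zero_mul, sub_zero] at hd
    have h11 : s 1 1 ^ 2 = 1 := by
      have : s 0 0 ^ 2 * s 1 1 ^ 2 = 1 := by rw [← mul_pow, hd, one_pow]
      rwa [h00, one_mul] at this
    refine autGroup_ext fun i => ?_
    rw [lin_g]
    fin_cases i <;> simp [linImage, h00, h01, h10, hd, h11]

end SlModel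

end Decomposition

section Comparison

variable {A : Type*} [Ring A] [Algebra K A] {M : SlModel K lam A}
  {A₂ : Type*} [Ring A₂] [Algebra K A₂] {M₂ : SlModel K lam A₂}

namespace SlModel

variable (M M₂) in
/-- The linear automorphisms of both models. -/
def lin₂ : Matrix.SpecialLinearGroup (Fin 2) K →* M.autGroup × M₂.autGroup := M.lin.prod M₂.lin

variable (M M₂) in
/-- The automorphisms `δ_g` of both models. -/
def del₂ (p : Polynomial K) : M.autGroup × M₂.autGroup := (M.del p, M₂.del p)

theorem del₂_add (p q : Polynomial K) : del₂ M M₂ (p + q) = del₂ M M₂ p * del₂ M M₂ q := by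
  simp [del₂, del_add]

theorem lin₂_mul_del₂ {s : Matrix.SpecialLinearGroup (Fin 2) K} (h : s 0 1 = 0)
    (p : Polynomial K) : lin₂ M M₂ s * del₂ M M₂ p = del₂ M M₂ (twist (s 1 1) p) * lin₂ M M₂ s :=
  Prod.ext (lin_mul_del h p) (lin_mul_del h p)

theorem del₂_C (c : K) : del₂ M M₂ (Polynomial.C c) = lin₂ M M₂ (lowerUni (-c)) :=
  Prod.ext (del_C (by simp [lowerUni]) (by simp [lowerUni]) (by simp [lowerUni])
    (by simp [lowerUni])) (del_C (by simp [lowerUni]) (by simp [lowerUni]) (by simp [lowerUni])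
    (by simp [lowerUni]))

variable (M M₂) in
/-- Reduced words in the amalgam, with the type of the first letter. -/
inductive Word : Option Bool → M.autGroup × M₂.autGroup → Prop
  | low (s : Matrix.SpecialLinearGroup (Fin 2) K) (hs : s 0 1 = 0) : Word none (lin₂ M M₂ s)
  | lin (s : Matrix.SpecialLinearGroup (Fin 2) K) (hs : s 0 1 ≠ 0) {x γ} (hx : x ≠ some true)
      (h : Word x γ) : Word (some true) (lin₂ M M₂ s * γ)
  | del (p : Polynomial K) (hp : p.natDegree ≠ 0) {x γ} (hx : x ≠ some false)
      (h : Word x γ) : Word (some false) (del₂ M M₂ p * γ)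

theorem mul_zero_one (s t : Matrix.SpecialLinearGroup (Fin 2) K) :
    (s * t) 0 1 = s 0 0 * t 0 1 + s 0 1 * t 1 1 := by
  rw [Matrix.SpecialLinearGroup.coe_mul, Matrix.mul_apply, Fin.sum_univ_two]

theorem diag_ne_zero {s : Matrix.SpecialLinearGroup (Fin 2) K} (h : s 0 1 = 0) :
    s 0 0 ≠ 0 ∧ s 1 1 ≠ 0 := by
  have hd := det_eq s
  rw [h, zero_mul, sub_zero] at hd
  exact ⟨left_ne_zero_of_mul_eq_one hd, right_ne_zero_of_mul_eq_one hd⟩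

theorem Word.low_mul {x γ} (h : Word M M₂ x γ) {t : Matrix.SpecialLinearGroup (Fin 2) K}
    (ht : t 0 1 = 0) : Word M M₂ x (lin₂ M M₂ t * γ) := by
  induction h generalizing t with
  | low s hs =>
    rw [← map_mul]
    exact .low _ (by rw [mul_zero_one, hs, ht]; simp)
  | lin s hs hx h _ =>
    rw [← mul_assoc, ← map_mul]
    exact .lin _ (by rw [mul_zero_one, ht]; simp [hs, (diag_ne_zero ht).1]) hx h
  | del p hp hx h ih =>
    rw [← mul_assoc, lin₂_mul_del₂ ht, mul_assoc]
    exact .del _ (by rwa [natDegree_twist (diag_ne_zero ht).2]) hx (ih ht)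

theorem Word.lin_mul {x γ} (h : Word M M₂ x γ) (t : Matrix.SpecialLinearGroup (Fin 2) K) :
    ∃ y, Word M M₂ y (lin₂ M M₂ t * γ) := by
  by_cases ht : t 0 1 = 0
  · exact ⟨x, h.low_mul ht⟩
  by_cases hx : x = some true
  · cases h with
    | low s hs => simp at hx
    | lin s hs hx' h =>
      rw [← mul_assoc, ← map_mul]
      by_cases hts : (t * s) 0 1 = 0
      · exact ⟨_, h.low_mul hts⟩
      · exact ⟨_, .lin _ hts hx' h⟩
    | del p hp hx h => simp at hx
  · exact ⟨_, .lin t ht hx h⟩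

theorem Word.del_mul {x γ} (h : Word M M₂ x γ) (p : Polynomial K) :
    ∃ y, Word M M₂ y (del₂ M M₂ p * γ) := by
  by_cases hp : p.natDegree = 0
  · rw [Polynomial.eq_C_of_natDegree_eq_zero hp, del₂_C]
    exact h.lin_mul _
  by_cases hx : x = some false
  · cases h with
    | low s hs => simp at hx
    | lin s hs hx h => simp at hx
    | del q hq hx' h =>
      rw [← mul_assoc, ← del₂_add]
      by_cases hpq : (p + q).natDegree = 0
      · rw [Polynomial.eq_C_of_natDegree_eq_zero hpq, del₂_C]
        exact h.lin_mul _
      · exact ⟨_, .del _ hpq hx' h⟩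
  · exact ⟨_, .del p hp hx h⟩

variable (M M₂) in
/-- The subgroup generated by the simultaneous elementary automorphisms. -/
def tame₂ : Subgroup (M.autGroup × M₂.autGroup) :=
  Subgroup.closure (Set.range (lin₂ M M₂) ∪ Set.range (del₂ M M₂))

theorem del₂_inv (p : Polynomial K) : (del₂ M M₂ p)⁻¹ = del₂ M M₂ (-p) := by
  have h0 : del₂ M M₂ 0 = 1 := by
    have := del₂_add (M := M) (M₂ := M₂) 0 0
    rw [add_zero] at this
    exact left_eq_mul.1 this
  rw [inv_eq_iff_mul_eq_one, ← del₂_add, add_neg_cancel, h0]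

theorem exists_word {γ} (h : γ ∈ tame₂ M M₂) : ∃ x, Word M M₂ x γ := by
  induction h using Subgroup.closure_induction_left with
  | one => exact ⟨none, by simpa using Word.low (M := M) (M₂ := M₂) 1 (by simp)⟩
  | mul_left x hx y _ ih =>
    obtain ⟨z, hz⟩ := ih
    rcases hx with ⟨s, rfl⟩ | ⟨p, rfl⟩
    · exact hz.lin_mul s
    · exact hz.del_mul p
  | inv_mul_cancel x hx y _ ih =>
    obtain ⟨z, hz⟩ := ih
    rcases hx with ⟨s, rfl⟩ | ⟨p, rfl⟩
    · rw [← map_inv]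
      exact hz.lin_mul _
    · rw [del₂_inv]
      exact hz.del_mul _

variable (M M₂) in
/-- The positions of the images of the generators under a word of the given type. -/
def Position : Option Bool → M.autGroup × M₂.autGroup → Prop
  | none, γ => ∃ s, s 0 1 = 0 ∧ γ = lin₂ M M₂ s
  | some true, γ => (∃ s, s 0 1 ≠ 0 ∧ γ = lin₂ M M₂ s) ∨
      ∃ i n, 2 < n ∧ M.IsHor n ((γ.1 : A ≃ₐ[K] A) (M.g i))
  | some false, γ => ∃ i n, 2 < n ∧ M.IsVert n ((γ.1 : A ≃ₐ[K] A) (M.g i))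

theorem position_del {γ : M.autGroup × M₂.autGroup} {p : Polynomial K} (hp : p.natDegree ≠ 0)
    {i : Fin 3} {n : ℕ} (hn : 2 ≤ n) (h : M.IsHor n ((γ.1 : A ≃ₐ[K] A) (M.g i))) :
    Position M M₂ (some false) (del₂ M M₂ p * γ) :=
  ⟨i, _, by have := Nat.pos_of_ne_zero hp; nlinarith, h.del hp⟩

theorem Word.position {x γ} (h : Word M M₂ x γ) : Position M M₂ x γ := by
  induction h with
  | low s hs => exact ⟨s, hs, rfl⟩
  | @lin s hs x γ hx h ih =>
    rcases x with - | - | -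
    · obtain ⟨t, ht, rfl⟩ := ih
      refine Or.inl ⟨s * t, ?_, by rw [map_mul]⟩
      rw [mul_zero_one, ht]
      simp [hs, (diag_ne_zero ht).2]
    · obtain ⟨i, n, hn, h⟩ := ih
      exact Or.inr ⟨i, n, hn, h.lin hs⟩
    · exact absurd rfl hx
  | @del p hp x γ hx h ih =>
    rcases x with - | - | -
    · obtain ⟨t, ht, rfl⟩ := ih
      exact position_del hp le_rfl (isHor_lin_zero (diag_ne_zero ht).1)
    · exact absurd rfl hx
    · rcases ih with ⟨t, ht, rfl⟩ | ⟨i, n, hn, h⟩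
      · exact position_del hp le_rfl (isHor_lin_two ht)
      · exact position_del hp hn.le h

theorem eq_one_of_fst {γ} (h : γ ∈ tame₂ M M₂) (h1 : γ.1 = 1) : γ = 1 := by
  obtain ⟨x, hx⟩ := exists_word h
  have key : ∀ s, γ = lin₂ M M₂ s → γ = 1 := by
    intro s hs
    have h2 : M.lin s = 1 := by rw [← h1, hs]; rfl
    rw [hs]
    exact Prod.ext h2 (lin_eq_one_iff.2 (lin_eq_one_iff.1 h2))
  have hx := hx.position
  rcases x with - | - | -
  · obtain ⟨s, -, hs⟩ := hx
    exact key s hs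
  · obtain ⟨i, n, hn, h⟩ := hx
    rw [h1] at h
    exact absurd h (not_isVert_g hn i)
  · rcases hx with ⟨s, -, hs⟩ | ⟨i, n, hn, h⟩
    · exact key s hs
    · rw [h1] at h
      exact absurd h (not_isHor_g hn i)

theorem map_swap_tame₂ : (tame₂ M M₂).map (MulEquiv.prodComm : _ ≃* M₂.autGroup × M.autGroup).toMonoidHom = tame₂ M₂ M := by
  rw [tame₂, MonoidHom.map_closure, Set.image_union, ← Set.range_comp, ← Set.range_comp]
  rfl

theorem eq_one_of_snd {γ} (h : γ ∈ tame₂ M M₂) (h1 : γ.2 = 1) : γ = 1 := by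
  have h2 : γ.swap ∈ tame₂ M₂ M := by
    rw [← map_swap_tame₂]
    exact ⟨γ, h, rfl⟩
  exact Prod.swap_injective (eq_one_of_fst h2 h1)

theorem map_fst_tame₂ : (tame₂ M M₂).map (MonoidHom.fst _ _) = M.tame := by
  rw [tame₂, MonoidHom.map_closure, Set.image_union, ← Set.range_comp, ← Set.range_comp]
  rfl

theorem map_snd_tame₂ : (tame₂ M M₂).map (MonoidHom.snd _ _) = M₂.tame := by
  rw [tame₂, MonoidHom.map_closure, Set.image_union, ← Set.range_comp, ← Set.range_comp]
  rfl

variable (M M₂) in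
theorem nonempty_autGroup_mulEquiv [IsAlgClosed K] : Nonempty (M.autGroup ≃* M₂.autGroup) := by
  have h1 : Function.Bijective ((MonoidHom.fst _ _).comp (tame₂ M M₂).subtype) := by
    refine ⟨(injective_iff_map_eq_one _).2 fun γ h => Subtype.ext (eq_one_of_fst γ.2 h), ?_⟩
    intro φ
    have : φ ∈ (tame₂ M M₂).map (MonoidHom.fst _ _) := by rw [map_fst_tame₂, tame_eq_top]; trivial
    obtain ⟨γ, hγ, rfl⟩ := this
    exact ⟨⟨γ, hγ⟩, rfl⟩
  have h2 : Function.Bijective ((MonoidHom.snd _ _).comp (tame₂ M M₂).subtype) := by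
    refine ⟨(injective_iff_map_eq_one _).2 fun γ h => Subtype.ext (eq_one_of_snd γ.2 h), ?_⟩
    intro φ
    have : φ ∈ (tame₂ M M₂).map (MonoidHom.snd _ _) := by rw [map_snd_tame₂, tame_eq_top]; trivial
    obtain ⟨γ, hγ, rfl⟩ := this
    exact ⟨⟨γ, hγ⟩, rfl⟩
  exact ⟨(MulEquiv.ofBijective _ h1).symm.trans (MulEquiv.ofBijective _ h2)⟩

end SlModel

end Comparison

section PoissonModel

theorem casimir_PQ [IsAlgClosed K] (lam : K) :
    4 * pe K lam * pf K lam + ph K lam ^ 2 = algebraMap K (PQ K lam) lam := by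
  have h : Ideal.Quotient.mk (Ideal.span {4 * X 0 * X 2 + X 1 ^ 2 - C lam} : Ideal (MvPolynomial (Fin 3) K))
      (4 * X 0 * X 2 + X 1 ^ 2 - C lam) = 0 :=
    Ideal.Quotient.eq_zero_iff_mem.2 (Ideal.subset_span rfl)
  rw [map_sub, sub_eq_zero, map_add, map_mul, map_mul, map_pow, map_ofNat] at h
  exact h

theorem exists_hom_PQ [IsAlgClosed K] {T : Type*} [CommRing T] [Algebra K T] {e h f : T}
    (t : 4 * e * f + h ^ 2 = algebraMap K T lam) :
    ∃ φ : PQ K lam →ₐ[K] T, φ (pe K lam) = e ∧ φ (ph K lam) = h ∧ φ (pf K lam) = f := by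
  have h0 : ∀ a ∈ Ideal.span {4 * X 0 * X 2 + X 1 ^ 2 - C lam},
      aeval (R := K) (![e, h, f] : Fin 3 → T) a = 0 := by
    intro a ha
    have h2 : Ideal.span {4 * X 0 * X 2 + X 1 ^ 2 - C lam} ≤
        RingHom.ker (aeval (R := K) (![e, h, f] : Fin 3 → T)) := by
      rw [Ideal.span_le, Set.singleton_subset_iff, SetLike.mem_coe, RingHom.mem_ker]
      simp [← t]
    exact h2 ha
  have h1 : ∀ p, Ideal.Quotient.liftₐ _ (aeval (R := K) (![e, h, f] : Fin 3 → T)) h0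
      (Ideal.Quotient.mk _ p) = aeval (R := K) (![e, h, f] : Fin 3 → T) p := fun p => rfl
  refine ⟨Ideal.Quotient.liftₐ _ _ h0, ?_, ?_, ?_⟩
  · rw [pe, h1]; simp
  · rw [ph, h1]; simp
  · rw [pf, h1]; simp

theorem adjoin_PQ [IsAlgClosed K] (lam : K) :
    Algebra.adjoin K (Set.range ![pe K lam, ph K lam, pf K lam]) = ⊤ := by
  have h : Set.range ![pe K lam, ph K lam, pf K lam] = (Ideal.Quotient.mkₐ K
      (Ideal.span {4 * X 0 * X 2 + X 1 ^ 2 - C lam} : Ideal (MvPolynomial (Fin 3) K))) ''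
        Set.range X := by
    rw [← Set.range_comp]
    congr 1
    funext i
    fin_cases i <;> rfl
  rw [h, ← AlgHom.map_adjoin, adjoin_range_X, Algebra.map_top, AlgHom.range_eq_top]
  exact Ideal.Quotient.mkₐ_surjective K _

/-- The symbol homomorphism of `P_λ` attached to a square root of `λ`. -/
theorem exists_opP [IsAlgClosed K] {κ : K} (hκ : κ ^ 2 = lam) :
    ∃ φ : PQ K lam →ₐ[K] Plane K, φ (pe K lam) = X 0 ^ 2 * X 1 ^ 2 + C κ * X 0 ∧
      φ (ph K lam) = 2 * X 0 * X 1 ^ 2 + C κ ∧ φ (pf K lam) = -X 1 ^ 2 := by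
  refine exists_hom_PQ ?_
  rw [algebraMap_eq, ← hκ, C_pow]
  ring

/-- `P_λ` as a model. -/
def modelP [IsAlgClosed K] (B : PoissonBr K lam) : SlModel K lam (PQ K lam) where
  br := LinearMap.mk₂ K B.br B.add_left B.smul_left B.add_right B.smul_right
  leib := B.leibniz
  alt := B.alternate
  eps := 0
  comm a b := (sub_eq_zero.2 (mul_comm a b)).trans (zero_smul K _).symm
  g := ![pe K lam, ph K lam, pf K lam]
  triple := ⟨B.br_ef, B.br_he, B.br_hf, by
    rw [← casimir_PQ]
    simp only [Matrix.cons_val_zero, Matrix.cons_val_one, Matrix.cons_val]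
    ring⟩
  adjoin_eq_top := adjoin_PQ lam
  exists_hom e h f t := exists_hom_PQ (by rw [← t.casimir]; ring)
  kap := (IsAlgClosed.exists_pow_nat_eq lam two_pos).choose
  op := (Algebra.lmul K (Plane K)).comp
    (exists_opP (IsAlgClosed.exists_pow_nat_eq lam two_pos).choose_spec).choose
  op_zero u := by
    simp [(exists_opP (IsAlgClosed.exists_pow_nat_eq lam two_pos).choose_spec).choose_spec.1,
      add_mul]
  op_one u := by
    simp [(exists_opP (IsAlgClosed.exists_pow_nat_eq lam two_pos).choose_spec).choose_spec.2.1,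
      add_mul]
  op_two u := by
    simp [(exists_opP (IsAlgClosed.exists_pow_nat_eq lam two_pos).choose_spec).choose_spec.2.2,
      add_mul]

end PoissonModel

section EnvelopingModel

attribute [local instance] LieRing.ofAssociativeRing

/-- The commutator bracket of an associative algebra. -/
def commBr (K A : Type*) [Field K] [Ring A] [Algebra K A] : A →ₗ[K] A →ₗ[K] A :=
  LinearMap.mul K A - (LinearMap.mul K A).flip

theorem commBr_apply {A : Type*} [Ring A] [Algebra K A] (a b : A) :
    commBr K A a b = a * b - b * a := rfl

/-- The representation of `sl₂` attached to a triple in an associative algebra. -/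
def slHom {T : Type*} [Ring T] [Algebra K T] {e h f : T} (t : IsSlTriple (commBr K T) lam e h f) :
    ↥(LieAlgebra.SpecialLinear.sl (Fin 2) K) →ₗ⁅K⁆ T where
  toFun x := x.1 0 1 • e + x.1 0 0 • h + x.1 1 0 • f
  map_add' x y := by
    have h : ∀ i j, (x + y).1 i j = x.1 i j + y.1 i j := fun _ _ => rfl
    rw [h, h, h]
    module
  map_smul' c x := by
    have h : ∀ i j, (c • x).1 i j = c * x.1 i j := fun _ _ => rfl
    rw [h, h, h, RingHom.id_apply]
    module
  map_lie' := by
    intro x y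
    have hx : x.1 1 1 = -x.1 0 0 := by
      have := LinearMap.mem_ker.1 x.2
      rw [Matrix.traceLinearMap_apply, Matrix.trace_fin_two] at this
      linear_combination this
    have hy : y.1 1 1 = -y.1 0 0 := by
      have := LinearMap.mem_ker.1 y.2
      rw [Matrix.traceLinearMap_apply, Matrix.trace_fin_two] at this
      linear_combination this
    have t1 := t.ef
    have t2 := t.he
    have t3 := t.hf
    rw [commBr_apply] at t1 t2 t3
    have hl : ∀ i j, ⁅x, y⁆.1 i j =
        x.1 i 0 * y.1 0 j + x.1 i 1 * y.1 1 j - (y.1 i 0 * x.1 0 j + y.1 i 1 * x.1 1 j) := by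
      intro i j
      rw [← Fin.sum_univ_two (fun k => x.1 i k * y.1 k j),
        ← Fin.sum_univ_two (fun k => y.1 i k * x.1 k j)]
      rfl
    rw [Ring.lie_def]
    simp only [hl, hx, hy, add_mul, mul_add, smul_mul_smul_comm]
    rw [sub_eq_iff_eq_add] at t1 t2 t3
    rw [t1, t2, t3, two_mul, neg_mul (2 : T), two_mul]
    module

theorem exists_hom_ULam [IsAlgClosed K] {T : Type*} [Ring T] [Algebra K T] {e h f : T}
    (t : IsSlTriple (commBr K T) lam e h f) :
    ∃ φ : ULam K lam →ₐ[K] T, φ (ue K lam) = e ∧ φ (uh K lam) = h ∧ φ (uf K lam) = f := by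
  have he : UniversalEnvelopingAlgebra.lift K (slHom t) (UniversalEnvelopingAlgebra.ι K (slE K)) = e := by
    rw [UniversalEnvelopingAlgebra.lift_ι_apply]
    simp [slHom, slE]
  have hh : UniversalEnvelopingAlgebra.lift K (slHom t) (UniversalEnvelopingAlgebra.ι K (slH K)) = h := by
    rw [UniversalEnvelopingAlgebra.lift_ι_apply]
    simp [slHom, slH]
  have hf : UniversalEnvelopingAlgebra.lift K (slHom t) (UniversalEnvelopingAlgebra.ι K (slF K)) = f := by
    rw [UniversalEnvelopingAlgebra.lift_ι_apply]
    simp [slHom, slF]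
  refine ⟨RingQuot.liftAlgHom K ⟨UniversalEnvelopingAlgebra.lift K (slHom t), ?_⟩, ?_, ?_, ?_⟩
  · rintro _ _ ⟨rfl, rfl⟩
    rw [casimirU, AlgHom.commutes, ← t.casimir]
    simp only [map_add, map_mul, map_pow, map_ofNat, he, hh, hf]
  · rw [ue, RingQuot.liftAlgHom_mkAlgHom_apply, he]
  · rw [uh, RingQuot.liftAlgHom_mkAlgHom_apply, hh]
  · rw [uf, RingQuot.liftAlgHom_mkAlgHom_apply, hf]

theorem adjoin_ULam [IsAlgClosed K] (lam : K) :
    Algebra.adjoin K (Set.range ![ue K lam, uh K lam, uf K lam]) = ⊤ := by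
  let π : TensorAlgebra K ↥(LieAlgebra.SpecialLinear.sl (Fin 2) K) →ₐ[K] ULam K lam :=
    (RingQuot.mkAlgHom K _).comp (UniversalEnvelopingAlgebra.mkAlgHom K _)
  have hπ : Function.Surjective π :=
    (RingQuot.mkAlgHom_surjective K _).comp (RingCon.mk'_surjective _)
  rw [eq_top_iff, ← AlgHom.range_eq_top π |>.2 hπ, ← Algebra.map_top,
    ← TensorAlgebra.adjoin_range_ι, AlgHom.map_adjoin, Algebra.adjoin_le_iff]
  rintro _ ⟨_, ⟨x, rfl⟩, rfl⟩
  have hx : x = x.1 0 1 • slE K + x.1 0 0 • slH K + x.1 1 0 • slF K := by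
    have := LinearMap.mem_ker.1 x.2
    rw [Matrix.traceLinearMap_apply, Matrix.trace_fin_two] at this
    refine Subtype.ext (Matrix.ext fun i j => ?_)
    fin_cases i <;> fin_cases j <;> simp [slE, slF, slH]
    linear_combination this
  have hg : ∀ i, (![ue K lam, uh K lam, uf K lam] : Fin 3 → _) i ∈
      Algebra.adjoin K (Set.range ![ue K lam, uh K lam, uf K lam]) :=
    fun i => Algebra.subset_adjoin ⟨i, rfl⟩
  have h0 : π (TensorAlgebra.ι K (slE K)) = ue K lam := rfl
  have h1 : π (TensorAlgebra.ι K (slH K)) = uh K lam := rfl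
  have h2 : π (TensorAlgebra.ι K (slF K)) = uf K lam := rfl
  rw [hx]
  simp only [map_add, map_smul, h0, h1, h2]
  exact add_mem (add_mem (Subalgebra.smul_mem _ (hg 0) _) (Subalgebra.smul_mem _ (hg 1) _))
    (Subalgebra.smul_mem _ (hg 2) _)

theorem ULam_triple [IsAlgClosed K] (lam : K) :
    IsSlTriple (commBr K (ULam K lam)) lam (ue K lam) (uh K lam) (uf K lam) := by
  have hl : ∀ x y, commBr K (ULam K lam) (RingQuot.mkAlgHom K _ (UniversalEnvelopingAlgebra.ι K x))
      (RingQuot.mkAlgHom K _ (UniversalEnvelopingAlgebra.ι K y)) =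
      RingQuot.mkAlgHom K _ (UniversalEnvelopingAlgebra.ι K ⁅x, y⁆) := by
    intro x y
    rw [commBr_apply, LieHom.map_lie, Ring.lie_def, map_sub, map_mul, map_mul]
  refine ⟨?_, ?_, ?_, ?_⟩
  · rw [ue, uf, hl, uh]
    congr 2
    refine Subtype.ext (Matrix.ext fun i j => ?_)
    rw [LieSubalgebra.coe_bracket, Ring.lie_def]
    fin_cases i <;> fin_cases j <;> simp [slE, slF, slH]
  · have : ⁅slH K, slE K⁆ = (2 : K) • slE K := by
      refine Subtype.ext (Matrix.ext fun i j => ?_)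
      rw [LieSubalgebra.coe_bracket, Ring.lie_def]
      fin_cases i <;> fin_cases j <;> simp [slE, slF, slH]
      norm_num
    rw [uh, ue, hl, this, map_smul, map_smul, two_smul, two_mul]
  · have : ⁅slH K, slF K⁆ = (-2 : K) • slF K := by
      refine Subtype.ext (Matrix.ext fun i j => ?_)
      rw [LieSubalgebra.coe_bracket, Ring.lie_def]
      fin_cases i <;> fin_cases j <;> simp [slE, slF, slH]
      norm_num
    rw [uh, uf, hl, this, map_smul, map_smul, neg_smul, two_smul, neg_mul, two_mul]
  · have h : RingQuot.mkAlgHom K (fun a b : USl2 K => a = casimirU K ∧ b = algebraMap K (USl2 K) lam) (casimirU K) = _ :=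
      RingQuot.mkAlgHom_rel K ⟨rfl, rfl⟩
    rw [casimirU, AlgHom.commutes] at h
    simp only [map_add, map_mul, map_pow, map_ofNat] at h
    exact h

variable (K) in
/-- The operator of `e`. -/
def opE (κ : K) : Module.End K (Plane K) :=
  LinearMap.mulLeft K (X 0 ^ 2 * X 1 ^ 2) + (LinearMap.mulLeft K (X 0 ^ 2) ∘ₗ
    (pderiv 0 : Derivation K (Plane K) (Plane K)).toLinearMap + LinearMap.mulLeft K (C κ * X 0))

variable (K) in
/-- The operator of `h`. -/
def opH (κ : K) : Module.End K (Plane K) :=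
  LinearMap.mulLeft K (2 * X 0 * X 1 ^ 2) + (LinearMap.mulLeft K (2 * X 0) ∘ₗ
    (pderiv 0 : Derivation K (Plane K) (Plane K)).toLinearMap + LinearMap.mulLeft K (C κ))

variable (K) in
/-- The operator of `f`. -/
def opF : Module.End K (Plane K) :=
  LinearMap.mulLeft K (-X 1 ^ 2) - (pderiv 0 : Derivation K (Plane K) (Plane K)).toLinearMap

theorem opE_apply (κ : K) (u : Plane K) :
    opE K κ u = X 0 ^ 2 * X 1 ^ 2 * u + (X 0 ^ 2 * pderiv 0 u + C κ * X 0 * u) := rfl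

theorem opH_apply (κ : K) (u : Plane K) :
    opH K κ u = 2 * X 0 * X 1 ^ 2 * u + (2 * X 0 * pderiv 0 u + C κ * u) := rfl

theorem opF_apply (u : Plane K) : opF K u = -X 1 ^ 2 * u - pderiv 0 u := rfl

theorem op_triple {κ : K} (hκ : κ ^ 2 - 2 * κ = lam) :
    IsSlTriple (commBr K (Module.End K (Plane K))) lam (opE K κ) (opH K κ) (opF K) := by
  have d10 : pderiv 0 (X 1 : Plane K) = 0 := pderiv_X_of_ne (by decide)
  have d2 : pderiv 0 (2 : Plane K) = 0 := by
    rw [show (2 : Plane K) = C 2 from (map_ofNat C 2).symm, pderiv_C]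
  have two : ∀ v : Plane K, (2 : Module.End K (Plane K)) v = 2 * v := by
    intro v
    have h : (2 : Module.End K (Plane K)) = 1 + 1 := one_add_one_eq_two.symm
    rw [h, LinearMap.add_apply, Module.End.one_apply, two_mul]
  refine ⟨?_, ?_, ?_, ?_⟩
  · refine LinearMap.ext fun u => ?_
    rw [commBr_apply]
    simp only [LinearMap.sub_apply, Module.End.mul_apply, opE_apply, opH_apply, opF_apply, map_add, map_sub,
      map_neg, Derivation.leibniz, Derivation.leibniz_pow, pderiv_X_self, d10, d2, pderiv_C,
      smul_eq_mul, nsmul_eq_mul]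
    push_cast
    ring
  · refine LinearMap.ext fun u => ?_
    rw [commBr_apply]
    simp only [LinearMap.sub_apply, Module.End.mul_apply, opE_apply, opH_apply, opF_apply, map_add, map_sub,
      map_neg, Derivation.leibniz, Derivation.leibniz_pow, pderiv_X_self, d10, d2, pderiv_C,
      smul_eq_mul, nsmul_eq_mul, two]
    push_cast
    ring
  · refine LinearMap.ext fun u => ?_
    rw [commBr_apply]
    simp only [LinearMap.sub_apply, LinearMap.neg_apply, neg_mul (2 : Module.End K (Plane K)), Module.End.mul_apply, opE_apply, opH_apply, opF_apply, map_add, map_sub,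
      map_neg, Derivation.leibniz, Derivation.leibniz_pow, pderiv_X_self, d10, d2, pderiv_C,
      smul_eq_mul, nsmul_eq_mul, two]
    push_cast
    ring
  · refine LinearMap.ext fun u => ?_
    have hC : (C lam : Plane K) = C κ ^ 2 - 2 * C κ := by
      rw [← hκ, map_sub, map_mul, map_pow, map_ofNat]
    rw [Module.algebraMap_end_apply, smul_eq_C_mul, hC]
    simp only [pow_two (opH K κ), LinearMap.add_apply, Module.End.mul_apply, opE_apply, opH_apply, opF_apply, map_add, map_sub,
      map_neg, Derivation.leibniz, Derivation.leibniz_pow, pderiv_X_self, d10, d2, pderiv_C,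
      smul_eq_mul, nsmul_eq_mul, two]
    push_cast
    ring

theorem exists_kappa [IsAlgClosed K] (lam : K) : ∃ κ : K, κ ^ 2 - 2 * κ = lam := by
  obtain ⟨z, hz⟩ := IsAlgClosed.exists_pow_nat_eq (lam + 1) two_pos
  exact ⟨z + 1, by linear_combination hz⟩

theorem exists_opU [IsAlgClosed K] (lam : K) : ∃ κ : K, ∃ φ : ULam K lam →ₐ[K] Module.End K (Plane K),
    φ (ue K lam) = opE K κ ∧ φ (uh K lam) = opH K κ ∧ φ (uf K lam) = opF K := by
  obtain ⟨κ, hκ⟩ := exists_kappa lam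
  exact ⟨κ, exists_hom_ULam (op_triple hκ)⟩

variable (lam) in
/-- `U_λ` as a model. -/
def modelU [IsAlgClosed K] : SlModel K lam (ULam K lam) where
  br := commBr K _
  leib a b c := by simp only [commBr_apply, mul_sub, sub_mul, mul_assoc]; abel
  alt a := sub_self _
  eps := 1
  comm a b := (one_smul K _).symm
  g := ![ue K lam, uh K lam, uf K lam]
  triple := ULam_triple lam
  adjoin_eq_top := adjoin_ULam lam
  exists_hom e h f t := exists_hom_ULam t
  kap := (exists_opU lam).choose
  op := (exists_opU lam).choose_spec.choose
  op_zero u := by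
    simp [(exists_opU lam).choose_spec.choose_spec.1, opE_apply]
  op_one u := by
    rw [mul_one, map_ofNat]
    simp [(exists_opU lam).choose_spec.choose_spec.2.1, opH_apply]
  op_two u := by
    simp [(exists_opU lam).choose_spec.choose_spec.2.2, opF_apply, sub_eq_add_neg]

theorem autGroup_modelU [IsAlgClosed K] : (modelU lam).autGroup = ⊤ := by
  refine eq_top_iff.2 fun φ _ a b => ?_
  change φ (a * b - b * a) = φ a * φ b - φ b * φ a
  rw [map_sub, map_mul, map_mul]

end EnvelopingModel

end AutomorphismGroups

/-- The automorphism groups of `P_λ` and `U_λ` are isomorphic: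
`Aut(P_λ) ≅ Aut(U_λ)` as groups. -/
theorem autP_iso_autU (B : PoissonBr K lam) :
    Nonempty (↥(PAut B) ≃* (ULam K lam ≃ₐ[K] ULam K lam)) := by
  obtain ⟨i⟩ := SlModel.nonempty_autGroup_mulEquiv (modelP B) (modelU lam)
  exact ⟨i.trans ((MulEquiv.subgroupCongr autGroup_modelU).trans Subgroup.topEquiv)⟩
end
end

section
/- The images of the monomials Z^m Y^n (m, n ≥ 0) and Y^n X^r (n ≥ 0, r ≥ 1) in P_λ form a K-linear basis of P_λ; equivalently, the elements f^m h^n (m, n ≥ 0) and h^n e^r (n ≥ 0, r ≥ 1) form a K-linear basis of P_λ. -/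
noncomputable section

open scoped Pointwise

variable (K : Type*) [Field K] [IsAlgClosed K] [CharZero K] (lam : K)

variable {K lam}

/-- Indices of the basis monomials of `P_λ`: triples `(m, n, r)` with `m = 0` or `r = 0`,
encoding the monomial `f^m h^n e^r` (i.e. `f^m h^n` when `r = 0`, and `h^n e^r` when `m = 0`). -/
def Wrd : Type := {w : ℕ × ℕ × ℕ // w.1 = 0 ∨ w.2.2 = 0}

/-- Total degree of a basis monomial. -/
def wdeg (w : Wrd) : ℕ := w.1.1 + w.1.2.1 + w.1.2.2

variable (K lam) in
/-- The basis monomial `f^m h^n e^r` of `P_λ`. -/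
def wval (w : Wrd) : PQ K lam :=
  pf K lam ^ w.1.1 * ph K lam ^ w.1.2.1 * pe K lam ^ w.1.2.2

/-- The order on basis monomials: compare total degree first, then (for words of the same
total degree) lexicographically as words in the letters `f > h > e`, which amounts to
comparing the exponent of `f` and then the exponent of `h`. -/
instance : LinearOrder Wrd :=
  LinearOrder.lift' (fun w : Wrd => toLex ((wdeg w), toLex (w.1.1, w.1.2.1)))
    (by
      intro a b h
      have h' := toLex.injective h
      have hd : wdeg a = wdeg b := (Prod.ext_iff.mp h').1
      have h2 : ((a.1.1, a.1.2.1) : ℕ × ℕ) = (b.1.1, b.1.2.1) :=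
        toLex.injective (congrArg Prod.snd h')
      have hm : a.1.1 = b.1.1 := (Prod.ext_iff.mp h2).1
      have hn : a.1.2.1 = b.1.2.1 := (Prod.ext_iff.mp h2).2
      have hr : a.1.2.2 = b.1.2.2 := by unfold wdeg at hd; omega
      exact Subtype.ext (Prod.ext hm (Prod.ext hn hr)))

open scoped LaurentPolynomial

omit [IsAlgClosed K] [CharZero K] in
theorem four_mul_pe_mul_pf :
    4 * pe K lam * pf K lam + ph K lam ^ 2 = algebraMap K (PQ K lam) lam := by
  rw [← sub_eq_zero]
  exact Ideal.Quotient.eq_zero_iff_mem.mpr (Ideal.subset_span rfl)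

omit [IsAlgClosed K] [CharZero K] in
theorem smul_eq_algebraMap_mul (a : K) (x : PQ K lam) : a • x = algebraMap K (PQ K lam) a * x :=
  Algebra.smul_def a x

omit [IsAlgClosed K] in
theorem monomial_mem_span_range_wval (m n r : ℕ) :
    pf K lam ^ m * ph K lam ^ n * pe K lam ^ r ∈ Submodule.span K (Set.range (wval K lam)) := by
  induction m generalizing n r with
  | zero => exact Submodule.subset_span ⟨⟨(0, n, r), Or.inl rfl⟩, rfl⟩
  | succ m ih =>
    cases r with
    | zero => exact Submodule.subset_span ⟨⟨(m + 1, n, 0), Or.inr rfl⟩, rfl⟩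
    | succ r =>
      have key : pf K lam ^ (m + 1) * ph K lam ^ n * pe K lam ^ (r + 1) =
          (4⁻¹ : K) • (lam • (pf K lam ^ m * ph K lam ^ n * pe K lam ^ r) -
            pf K lam ^ m * ph K lam ^ (n + 2) * pe K lam ^ r) := by
        rw [eq_inv_smul_iff₀ (OfNat.ofNat_ne_zero 4), smul_eq_algebraMap_mul, smul_eq_algebraMap_mul,
          ← four_mul_pe_mul_pf, map_ofNat]
        ring
      rw [key]
      exact Submodule.smul_mem _ _ (Submodule.sub_mem _ (Submodule.smul_mem _ _ (ih n r))
        (ih (n + 2) r))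

omit [IsAlgClosed K] in
theorem span_range_wval : Submodule.span K (Set.range (wval K lam)) = ⊤ := by
  refine eq_top_iff.mpr fun x _ => ?_
  obtain ⟨p, rfl⟩ := Ideal.Quotient.mk_surjective x
  induction p using MvPolynomial.induction_on' with
  | add p q hp hq =>
    rw [map_add]
    exact Submodule.add_mem _ (hp trivial) (hq trivial)
  | monomial u a =>
    have key : Ideal.Quotient.mk _ (MvPolynomial.monomial u a) =
        a • (pf K lam ^ u 2 * ph K lam ^ u 1 * pe K lam ^ u 0) := by
      rw [MvPolynomial.monomial_eq, Finsupp.prod_fintype _ _ (by simp), Fin.prod_univ_three,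
        smul_eq_algebraMap_mul, map_mul, map_mul, map_mul, map_pow, map_pow, map_pow]
      change algebraMap K (PQ K lam) a * (pe K lam ^ u 0 * ph K lam ^ u 1 * pf K lam ^ u 2) = _
      ring
    rw [key]
    exact Submodule.smul_mem _ _ (monomial_mem_span_range_wval _ _ _)

variable (lam) in
/-- The polynomial `(λ - Y²) / 4`, which is the value of `XZ` on the surface `4XZ + Y² = λ`. -/
def xzPoly : Polynomial K :=
  Polynomial.C 4⁻¹ * (Polynomial.C lam - Polynomial.X ^ 2)

omit [IsAlgClosed K] in
theorem xzPoly_ne_zero : xzPoly lam ≠ 0 := by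
  refine mul_ne_zero (Polynomial.C_ne_zero.mpr (inv_ne_zero (OfNat.ofNat_ne_zero 4))) fun h => ?_
  simpa [Polynomial.coeff_C] using congrArg (fun p => Polynomial.coeff p 2) h

variable (K lam) in
/-- The algebra homomorphism `P_λ → K[Y][T;T⁻¹]` with `e ↦ T`, `h ↦ Y`,
`f ↦ ((λ - Y²) / 4) T⁻¹`. -/
def toLaurent : PQ K lam →ₐ[K] (Polynomial K)[T;T⁻¹] :=
  Ideal.Quotient.liftₐ _
    (MvPolynomial.aeval ![LaurentPolynomial.T 1, LaurentPolynomial.C Polynomial.X,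
      LaurentPolynomial.C (xzPoly lam) * LaurentPolynomial.T (-1)])
    (by
      intro a ha
      rw [← RingHom.mem_ker]
      refine (Ideal.span_le.mpr ?_) ha
      rintro _ rfl
      have hT : (LaurentPolynomial.T 1 * LaurentPolynomial.T (-1) : (Polynomial K)[T;T⁻¹]) = 1 := by
        rw [← LaurentPolynomial.T_add]
        simp
      have hp : 4 * xzPoly lam + Polynomial.X ^ 2 - Polynomial.C lam = 0 := by
        have h4 : (4 : Polynomial K) * Polynomial.C 4⁻¹ = 1 := by
          rw [← map_ofNat Polynomial.C 4, ← map_mul, mul_inv_cancel₀ (OfNat.ofNat_ne_zero 4), map_one]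
        rw [xzPoly]
        linear_combination (Polynomial.C lam - Polynomial.X ^ 2) * h4
      have hC := congrArg (LaurentPolynomial.C (R := Polynomial K)) hp
      simp only [map_add, map_sub, map_mul, map_pow, map_zero, map_ofNat] at hC
      have hlam : algebraMap K (Polynomial K)[T;T⁻¹] lam =
          LaurentPolynomial.C (Polynomial.C lam) := rfl
      simp only [SetLike.mem_coe, RingHom.mem_ker, map_add, map_sub, map_mul, map_pow,
        map_ofNat, MvPolynomial.aeval_X, MvPolynomial.aeval_C, hlam,
        Matrix.cons_val]
      linear_combination hC + 4 * LaurentPolynomial.C (xzPoly lam) * hT)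

omit [IsAlgClosed K] in
theorem toLaurent_wval (w : Wrd) :
    (toLaurent K lam (wval K lam w)).coeff =
      Finsupp.single ((w.1.2.2 : ℤ) - w.1.1) (xzPoly lam ^ w.1.1 * Polynomial.X ^ w.1.2.1) := by
  have he : toLaurent K lam (pe K lam) = LaurentPolynomial.T 1 :=
    (MvPolynomial.aeval_X _ _).trans rfl
  have hh : toLaurent K lam (ph K lam) = LaurentPolynomial.C Polynomial.X :=
    (MvPolynomial.aeval_X _ _).trans rfl
  have hf : toLaurent K lam (pf K lam) =
      LaurentPolynomial.C (xzPoly lam) * LaurentPolynomial.T (-1) :=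
    (MvPolynomial.aeval_X _ _).trans rfl
  have key : toLaurent K lam (wval K lam w) =
      .single ((w.1.2.2 : ℤ) - w.1.1) (xzPoly lam ^ w.1.1 * Polynomial.X ^ w.1.2.1) := by
    rw [wval, map_mul, map_mul, map_pow, map_pow, map_pow, he, hh, hf,
      LaurentPolynomial.single_eq_C_mul_T, mul_pow, LaurentPolynomial.T_pow,
      LaurentPolynomial.T_pow, sub_eq_add_neg, LaurentPolynomial.T_add, map_mul, map_pow,
      map_pow, mul_one, mul_neg_one]
    ring
  rw [key, AddMonoidAlgebra.coeff_single]

omit [IsAlgClosed K] [CharZero K] in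
theorem linearIndependent_mul_X_pow {p : Polynomial K} (hp : p ≠ 0) :
    LinearIndependent K fun n : ℕ => p * Polynomial.X ^ n := by
  have hX : LinearIndependent K fun n : ℕ => (Polynomial.X ^ n : Polynomial K) := by
    simpa [Polynomial.coe_basisMonomials, Polynomial.monomial_one_right_eq_X_pow] using
      (Polynomial.basisMonomials K).linearIndependent
  exact hX.map' (LinearMap.mulLeft K p)
    (LinearMap.ker_eq_bot.mpr (mul_right_injective₀ hp))

omit [IsAlgClosed K] in
theorem linearIndependent_wval : LinearIndependent K (wval K lam) := by
  have hsingle := Finsupp.linearIndependent_single (R := K)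
    (f := fun (i : ℤ) (n : ℕ) => xzPoly lam ^ (-i).toNat * Polynomial.X ^ n)
    fun i => linearIndependent_mul_X_pow (pow_ne_zero _ xzPoly_ne_zero)
  have hinj : Function.Injective
      fun w : Wrd => (⟨(w.1.2.2 : ℤ) - w.1.1, w.1.2.1⟩ : Σ _ : ℤ, ℕ) := by
    rintro ⟨⟨m, n, r⟩, hw⟩ ⟨⟨m', n', r'⟩, hw'⟩ h
    simp only [Sigma.mk.injEq, heq_eq_eq] at h hw hw'
    obtain ⟨h, rfl⟩ := h
    obtain rfl : m = m' := by omega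
    obtain rfl : r = r' := by omega
    rfl
  refine LinearIndependent.of_comp
    ((AddMonoidAlgebra.coeffLinearEquiv K).toLinearMap ∘ₗ (toLaurent K lam).toLinearMap) ?_
  convert hsingle.comp _ hinj using 1
  funext w
  refine (toLaurent_wval w).trans ?_
  rcases w with ⟨⟨m, n, r⟩, hw⟩
  have hm : (-((r : ℤ) - m)).toNat = m := by
    simp only at hw
    omega
  change _ = Finsupp.single ((r : ℤ) - m) (xzPoly lam ^ (-((r : ℤ) - m)).toNat * Polynomial.X ^ n)
  rw [hm]

/-- The elements `f^m h^n` (`m, n ≥ 0`) and `h^n e^r` (`n ≥ 0`, `r ≥ 1`)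
form a `K`-linear basis of `P_λ`: the family `w ↦ f^m h^n e^r` indexed by triples with
`m = 0` or `r = 0` is linearly independent and spans `P_λ`. -/
theorem monomials_form_basis :
    LinearIndependent K (wval K lam) ∧
    Submodule.span K (Set.range (wval K lam)) = (⊤ : Submodule K (PQ K lam)) :=
  ⟨linearIndependent_wval, span_range_wval⟩
end
end
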